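/- Let n ≥ 3 and let φ be a Hörmander-type phase function on M × Σ ⊆ ℝⁿ × ℝ^{n−1} satisfying Bourgain's condition, with fixed compact parameter sets M₀, Σ₀, 𝒱₀ as in the tube setup. Fix ε, η, η̃ > 0 with η̃ ≤ η/10. Then there exists δ₀ > 0 (depending on ε, η, η̃, n, φ) such that for all δ ∈ (0, δ₀): if SK′(φ, ε, η, δ^{1/2}) holds and SK′(φ_{n,rest}, η/10, η̃, δ^{1/2}) holds, then SK′(φ, ε, η̃/10, δ) holds. -/

import Mathlib

open Metric Set Topology MeasureTheory

noncomputable section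

/-- ξ-gradient ∇_ξφ(x,ξ). -/
def gradXi (n : ℕ) (φ : (Fin n → ℝ) → (Fin (n-1) → ℝ) → ℝ)
    (x : Fin n → ℝ) (ξ : Fin (n-1) → ℝ) : Fin (n-1) → ℝ :=
  fun j => fderiv ℝ (φ x) ξ (Pi.single j (1:ℝ))

/-- ξ-Hessian ∇_ξ²φ(x,ξ). -/
def hessXi (n : ℕ) (φ : (Fin n → ℝ) → (Fin (n-1) → ℝ) → ℝ)
    (x : Fin n → ℝ) (ξ : Fin (n-1) → ℝ) : Matrix (Fin (n-1)) (Fin (n-1)) ℝ :=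
  Matrix.of fun i j => fderiv ℝ (fun η => gradXi n φ x η i) ξ (Pi.single j (1:ℝ))

/-- Mixed Hessian ∇_x∇_ξφ(x,ξ) : entry (i,j) is ∂_{x_i}∂_{ξ_j}φ. -/
def mixedHess (n : ℕ) (φ : (Fin n → ℝ) → (Fin (n-1) → ℝ) → ℝ)
    (x : Fin n → ℝ) (ξ : Fin (n-1) → ℝ) : Matrix (Fin n) (Fin (n-1)) ℝ :=
  Matrix.of fun i j => fderiv ℝ (fun y => gradXi n φ y ξ j) x (Pi.single i (1:ℝ))

/-- Gauss map: G(x,ξ)ᵢ = det(∂_{ξ_1}∇_xφ, …, ∂_{ξ_{n-1}}∇_xφ, eᵢ), so that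
⟨G(x,ξ), w⟩ = det(∂_{ξ_1}∇_xφ, …, ∂_{ξ_{n-1}}∇_xφ, w) for all w. -/
def gaussMap (n : ℕ) (φ : (Fin n → ℝ) → (Fin (n-1) → ℝ) → ℝ)
    (x : Fin n → ℝ) (ξ : Fin (n-1) → ℝ) : Fin n → ℝ :=
  fun i => Matrix.det (Matrix.of fun a b : Fin n =>
    if h : (b : ℕ) < n - 1 then mixedHess n φ x ξ a ⟨(b : ℕ), h⟩
    else (Pi.single i (1:ℝ) : Fin n → ℝ) a)

/-- Directional derivative (G(x,ξ)·∇_x) f at x. -/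
def GD (n : ℕ) (φ : (Fin n → ℝ) → (Fin (n-1) → ℝ) → ℝ)
    (f : (Fin n → ℝ) → ℝ) (ξ : Fin (n-1) → ℝ) (x : Fin n → ℝ) : ℝ :=
  fderiv ℝ f x (gaussMap n φ x ξ)

/-- The matrix (G(x,ξ)·∇_x)∇_ξ²φ(x,ξ). -/
def GDhess (n : ℕ) (φ : (Fin n → ℝ) → (Fin (n-1) → ℝ) → ℝ)
    (x : Fin n → ℝ) (ξ : Fin (n-1) → ℝ) : Matrix (Fin (n-1)) (Fin (n-1)) ℝ :=
  Matrix.of fun i j => GD n φ (fun y => hessXi n φ y ξ i j) ξ x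

/-- The matrix (G(x,ξ)·∇_x)²∇_ξ²φ(x,ξ). -/
def GD2hess (n : ℕ) (φ : (Fin n → ℝ) → (Fin (n-1) → ℝ) → ℝ)
    (x : Fin n → ℝ) (ξ : Fin (n-1) → ℝ) : Matrix (Fin (n-1)) (Fin (n-1)) ℝ :=
  Matrix.of fun i j => GD n φ (fun y => GD n φ (fun z => hessXi n φ z ξ i j) ξ y) ξ x

/-- Bourgain's condition on M × Σ. -/
def BourgainCond (n : ℕ) (φ : (Fin n → ℝ) → (Fin (n-1) → ℝ) → ℝ)
    (M : Set (Fin n → ℝ)) (Ω : Set (Fin (n-1) → ℝ)) : Prop :=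
  ∃ lam : (Fin n → ℝ) → (Fin (n-1) → ℝ) → ℝ,
    ∀ x ∈ M, ∀ ξ ∈ Ω, GD2hess n φ x ξ = lam x ξ • GDhess n φ x ξ

/-- Hörmander-type phase function: smooth, (H1) and (H2) on M × Σ. -/
def IsHormander (n : ℕ) (φ : (Fin n → ℝ) → (Fin (n-1) → ℝ) → ℝ)
    (M : Set (Fin n → ℝ)) (Ω : Set (Fin (n-1) → ℝ)) : Prop :=
  ContDiffOn ℝ (⊤ : ℕ∞) (fun q : (Fin n → ℝ) × (Fin (n-1) → ℝ) => φ q.1 q.2) (M ×ˢ Ω) ∧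
  (∀ x ∈ M, ∀ ξ ∈ Ω, (mixedHess n φ x ξ).rank = n - 1) ∧
  (∀ x ∈ M, ∀ ξ ∈ Ω, (GDhess n φ x ξ).det ≠ 0)

/-- The point (x̄, t) ∈ ℝⁿ. -/
def toPt (n : ℕ) (xb : Fin (n-1) → ℝ) (t : ℝ) : Fin n → ℝ :=
  fun i => if h : (i : ℕ) < n - 1 then xb ⟨(i : ℕ), h⟩ else t

/-- line_{ξ,v} = {(v,0) − s(ξ,1) : s ∈ ℝ} ⊆ ℝⁿ. -/
def lineSet (n : ℕ) (ξ v : Fin (n-1) → ℝ) : Set (Fin n → ℝ) :=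
  {p | ∃ s : ℝ, p = toPt n v 0 - s • toPt n ξ 1}

end

noncomputable section

/-- The φ-curve ℓ_{ξ,v} = {x ∈ M : ∇_ξφ(x,ξ) = v}. -/
def curveSet (n : ℕ) (φ : (Fin n → ℝ) → (Fin (n-1) → ℝ) → ℝ)
    (M : Set (Fin n → ℝ)) (ξ v : Fin (n-1) → ℝ) : Set (Fin n → ℝ) :=
  {x ∈ M | gradXi n φ x ξ = v}

/-- The (δ,φ)-tube with parameter p = (ξ,v): the δ-neighborhood of ℓ_{ξ,v} ∩ M₀. -/
def tube (n : ℕ) (φ : (Fin n → ℝ) → (Fin (n-1) → ℝ) → ℝ)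
    (M M₀ : Set (Fin n → ℝ)) (δ : ℝ)
    (p : (Fin (n-1) → ℝ) × (Fin (n-1) → ℝ)) : Set (Fin n → ℝ) :=
  {y | ∃ x ∈ curveSet n φ M p.1 p.2 ∩ M₀, dist y x ≤ δ}

/-- The assertion SK′(φ, ε, η, δ): for every finite collection of essentially distinct
(δ,φ)-tubes which for each δ ≤ ρ ≤ 1 can be covered by (ρ,φ)-tubes of which at most
δ^{-η} are pairwise essentially parallel, and every shading Y with
Σ_T |Y(T)| ≥ δ^η, one has |⋃_T Y(T)| ≥ δ^ε. -/
def SKp (n : ℕ) (φ : (Fin n → ℝ) → (Fin (n-1) → ℝ) → ℝ)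
    (M M₀ : Set (Fin n → ℝ)) (S₀ : Set (Fin (n-1) → ℝ)) (ε η δ : ℝ) : Prop :=
  let V₀ : Set (Fin (n-1) → ℝ) :=
    (fun q : (Fin n → ℝ) × (Fin (n-1) → ℝ) => gradXi n φ q.1 q.2) '' (M₀ ×ˢ S₀)
  ∀ P : Finset ((Fin (n-1) → ℝ) × (Fin (n-1) → ℝ)),
    (∀ p ∈ P, p ∈ S₀ ×ˢ V₀) →
    (∀ p ∈ P, ∀ q ∈ P, p ≠ q → δ ≤ dist p q) →
    (∀ ρ ∈ Set.Icc δ 1, ∃ Q : Finset ((Fin (n-1) → ℝ) × (Fin (n-1) → ℝ)),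
      (∀ q ∈ Q, q ∈ S₀ ×ˢ V₀) ∧
      (∀ p ∈ P, Metric.ball p δ ⊆ ⋃ q ∈ Q, Metric.ball q ρ) ∧
      (∀ S ⊆ Q, (∀ q ∈ S, ∀ q' ∈ S, dist q.1 q'.1 ≤ ρ) → (S.card : ℝ) ≤ δ ^ (-η))) →
    ∀ Y : ((Fin (n-1) → ℝ) × (Fin (n-1) → ℝ)) → Set (Fin n → ℝ),
      (∀ p ∈ P, MeasurableSet (Y p) ∧ Y p ⊆ tube n φ M M₀ δ p) →
      ENNReal.ofReal (δ ^ η) ≤ ∑ p ∈ P, volume (Y p) →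
      ENNReal.ofReal (δ ^ ε) ≤ volume (⋃ p ∈ P, Y p)

end

noncomputable section

/-- The restriction phase φ_{n,rest}((x,t),ξ) = x·ξ + ½ t |ξ|², with n = m+1 variables
x = (x 0, …, x (m-1)) and t = x m. -/
def φrest (m : ℕ) (x : Fin (m+1) → ℝ) (ξ : Fin m → ℝ) : ℝ :=
  (∑ j : Fin m, x (Fin.castSucc j) * ξ j) + (1/2) * x (Fin.last m) * (∑ j : Fin m, (ξ j)^2)

end

/-! ### Grids, separated subsets and pigeonholing -/

theorem exists_separated_subset {α : Type*} [PseudoMetricSpace α] (P : Finset α) {r : ℝ}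
    (hr : 0 < r) :
    ∃ R ⊆ P, (∀ a ∈ R, ∀ b ∈ R, a ≠ b → r ≤ dist a b) ∧ ∀ p ∈ P, ∃ q ∈ R, dist p q < r := by
  classical
  induction P using Finset.induction_on with
  | empty => exact ⟨∅, by simp⟩
  | insert p P hp ih =>
    obtain ⟨R, hRP, hsep, hcov⟩ := ih
    by_cases h : ∃ q ∈ R, dist p q < r
    · refine ⟨R, hRP.trans (Finset.subset_insert _ _), hsep, ?_⟩
      intro p' hp'
      rcases Finset.mem_insert.1 hp' with rfl | hp'
      · exact h
      · exact hcov p' hp'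
    · push Not at h
      refine ⟨insert p R, Finset.insert_subset_insert _ hRP, ?_, ?_⟩
      · intro a ha b hb hab
        rcases Finset.mem_insert.1 ha with ha' | ha' <;>
          rcases Finset.mem_insert.1 hb with hb' | hb'
        · exact absurd (ha'.trans hb'.symm) hab
        · rw [ha']; exact h b hb'
        · rw [dist_comm, hb']; exact h a ha'
        · exact hsep a ha' b hb' hab
      · intro p' hp'
        rcases Finset.mem_insert.1 hp' with rfl | hp'
        · exact ⟨p', Finset.mem_insert_self _ _, by simpa using hr⟩
        · obtain ⟨q, hq, h'⟩ := hcov p' hp'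
          exact ⟨q, Finset.mem_insert_of_mem hq, h'⟩

/-- The index of the half-open grid cube of side `r` containing `x`. -/
noncomputable def gridCell {ι : Type*} (r : ℝ) (x : ι → ℝ) : ι → ℤ := fun i => ⌊x i / r⌋

theorem dist_lt_of_gridCell_eq {ι : Type*} [Fintype ι] {r : ℝ} (hr : 0 < r) {x y : ι → ℝ}
    (h : gridCell r x = gridCell r y) : dist x y < r := by
  rw [dist_pi_lt_iff hr]
  intro i
  have h1 : ⌊x i / r⌋ = ⌊y i / r⌋ := congrFun h i
  have h2 := Int.abs_sub_lt_one_of_floor_eq_floor h1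
  rw [Real.dist_eq]
  rw [← sub_div, abs_div, abs_of_pos hr, div_lt_one hr] at h2
  exact h2

theorem abs_gridCell_sub_le {ι : Type*} [Fintype ι] {r : ℝ} (hr : 0 < r) {x y : ι → ℝ} {K : ℕ}
    (h : dist x y ≤ K * r) (i : ι) : |gridCell r x i - gridCell r y i| ≤ K + 1 := by
  have h1 : |x i - y i| ≤ K * r := by
    rw [← Real.dist_eq]; exact (dist_le_pi_dist x y i).trans h
  have h2 : |x i / r - y i / r| ≤ K := by
    rw [← sub_div, abs_div, abs_of_pos hr, div_le_iff₀ hr]; exact h1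
  have h3 := abs_le.1 h2
  have a1 := Int.floor_le (x i / r)
  have a2 := Int.lt_floor_add_one (x i / r)
  have b1 := Int.floor_le (y i / r)
  have b2 := Int.lt_floor_add_one (y i / r)
  simp only [gridCell]
  rw [abs_le]
  constructor
  · have : (-(K + 1 : ℝ) - 1) < (⌊x i / r⌋ : ℝ) - ⌊y i / r⌋ := by linarith
    have : (-((K : ℤ) + 1) - 1) < ⌊x i / r⌋ - ⌊y i / r⌋ := by exact_mod_cast this
    linarith
  · have : (⌊x i / r⌋ : ℝ) - ⌊y i / r⌋ < (K + 1 : ℝ) + 1 := by linarith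
    have : ⌊x i / r⌋ - ⌊y i / r⌋ < ((K : ℤ) + 1) + 1 := by exact_mod_cast this
    linarith

theorem card_image_gridCell_le {α ι : Type*} [Fintype ι] [DecidableEq ι]
    {r : ℝ} (hr : 0 < r) (S : Finset α)
    (f : α → ι → ℝ) (K : ℕ) (h : ∀ a ∈ S, ∀ b ∈ S, dist (f a) (f b) ≤ K * r) :
    (S.image (fun a => gridCell r (f a))).card ≤ (2 * K + 3) ^ Fintype.card ι := by
  rcases S.eq_empty_or_nonempty with rfl | ⟨a, ha⟩
  · simp
  have hsub : S.image (fun a => gridCell r (f a)) ⊆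
      Fintype.piFinset (fun i => Finset.Icc (gridCell r (f a) i - (K + 1))
        (gridCell r (f a) i + (K + 1))) := by
    intro k hk
    obtain ⟨b, hb, rfl⟩ := Finset.mem_image.1 hk
    rw [Fintype.mem_piFinset]
    intro i
    have := abs_le.1 (abs_gridCell_sub_le hr (h b hb a ha) i)
    rw [Finset.mem_Icc]
    constructor <;> linarith
  refine (Finset.card_le_card hsub).trans ?_
  rw [Fintype.card_piFinset]
  apply le_of_eq
  rw [← Finset.card_univ, ← Finset.prod_const]
  refine Finset.prod_congr rfl fun i _ => ?_
  rw [Int.card_Icc]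
  omega

/-- The grid index of a tube parameter. -/
noncomputable def pairCell {ι : Type*} (r : ℝ) (p : (ι → ℝ) × (ι → ℝ)) : ι ⊕ ι → ℤ :=
  gridCell r (Sum.elim p.1 p.2)

theorem dist_sumElim {ι : Type*} [Fintype ι] (p q : (ι → ℝ) × (ι → ℝ)) :
    dist (Sum.elim p.1 p.2) (Sum.elim q.1 q.2) = dist p q := by
  apply le_antisymm
  · rw [dist_pi_le_iff dist_nonneg]
    rintro (i | i)
    · exact (dist_le_pi_dist p.1 q.1 i).trans (le_max_left _ _)
    · exact (dist_le_pi_dist p.2 q.2 i).trans (le_max_right _ _)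
  · rw [Prod.dist_eq]
    apply max_le <;> rw [dist_pi_le_iff dist_nonneg] <;> intro i
    · exact dist_le_pi_dist (Sum.elim p.1 p.2) (Sum.elim q.1 q.2) (Sum.inl i)
    · exact dist_le_pi_dist (Sum.elim p.1 p.2) (Sum.elim q.1 q.2) (Sum.inr i)

theorem dist_lt_of_pairCell_eq {ι : Type*} [Fintype ι] {r : ℝ} (hr : 0 < r)
    {p q : (ι → ℝ) × (ι → ℝ)} (h : pairCell r p = pairCell r q) : dist p q < r := by
  rw [← dist_sumElim]; exact dist_lt_of_gridCell_eq hr h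

/-- Two parameters in distinct grid cells whose indices agree modulo `N` are far apart. -/
theorem le_dist_of_pairCell_congr {ι : Type*} [Fintype ι] {r : ℝ} (hr : 0 < r) {N : ℕ}
    {p q : (ι → ℝ) × (ι → ℝ)} (hne : pairCell r p ≠ pairCell r q)
    (hmod : ∀ i, (pairCell r p i : ZMod N) = (pairCell r q i : ZMod N)) :
    ((N : ℝ) - 1) * r ≤ dist p q := by
  obtain ⟨i, hi⟩ := Function.ne_iff.1 hne
  have h1 := (ZMod.intCast_eq_intCast_iff_dvd_sub _ _ _).1 (hmod i)
  have h2 : (N : ℤ) ≤ |pairCell r q i - pairCell r p i| :=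
    Int.le_of_dvd (abs_pos.2 (sub_ne_zero.2 hi.symm)) ((dvd_abs _ _).2 h1)
  rw [← dist_sumElim]
  refine le_trans ?_ (dist_le_pi_dist _ _ i)
  set x := Sum.elim p.1 p.2 i
  set y := Sum.elim q.1 q.2 i
  have a1 := Int.floor_le (x / r)
  have a2 := Int.lt_floor_add_one (x / r)
  have b1 := Int.floor_le (y / r)
  have b2 := Int.lt_floor_add_one (y / r)
  have h3 : (N : ℝ) ≤ |(⌊y / r⌋ : ℝ) - ⌊x / r⌋| := by exact_mod_cast h2
  have h4 : (N : ℝ) - 1 ≤ |x / r - y / r| := by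
    rcases le_abs'.1 h3 with h | h
    · exact le_trans (by linarith) (le_abs_self _)
    · exact le_trans (by linarith) (neg_le_abs _)
  rw [← sub_div, abs_div, abs_of_pos hr, le_div_iff₀ hr] at h4
  rw [Real.dist_eq]; exact h4

theorem exists_pairCell_dist_lt {ι : Type*} [Fintype ι] (P : Finset ((ι → ℝ) × (ι → ℝ))) {r : ℝ}
    (hr : 0 < r) :
    ∃ a : (ι → ℝ) × (ι → ℝ) → (ι → ℝ) × (ι → ℝ), (∀ p ∈ P, a p ∈ P) ∧ (∀ p ∈ P, dist p (a p) < r) ∧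
      (∀ p ∈ P, ∀ q ∈ P, a p ≠ a q → pairCell r (a p) ≠ pairCell r (a q)) ∧
      (∀ p ∈ P, pairCell r (a p) = pairCell r p) := by
  classical
  have h : ∀ k : ι ⊕ ι → ℤ, ∃ q, (∃ p ∈ P, pairCell r p = k) → q ∈ P ∧ pairCell r q = k := by
    intro k
    by_cases hk : ∃ p ∈ P, pairCell r p = k
    · obtain ⟨p, hp, h⟩ := hk
      exact ⟨p, fun _ => ⟨hp, h⟩⟩
    · exact ⟨0, fun h => absurd h hk⟩
  choose b hb using h
  have hb' : ∀ p ∈ P, b (pairCell r p) ∈ P ∧ pairCell r (b (pairCell r p)) = pairCell r p :=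
    fun p hp => hb _ ⟨p, hp, rfl⟩
  refine ⟨fun p => b (pairCell r p), fun p hp => (hb' p hp).1, fun p hp => ?_,
    fun p hp q hq hne h => ?_, fun p hp => (hb' p hp).2⟩
  · exact dist_lt_of_pairCell_eq hr (hb' p hp).2.symm
  · rw [(hb' p hp).2, (hb' q hq).2] at h
    exact hne (by simp only [h])

theorem exists_le_sum_filter {α β : Type*} [Fintype β] [DecidableEq β] [Nonempty β]
    (P : Finset α) (c : α → β) (f : α → ℝ) :
    ∃ b, (∑ p ∈ P, f p) / Fintype.card β ≤ ∑ p ∈ P with c p = b, f p := by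
  have h0 : (0 : ℝ) < Fintype.card β := by exact_mod_cast Fintype.card_pos
  obtain ⟨b, -, hb⟩ := Finset.exists_le_sum_fiber_of_maps_to_of_nsmul_le_sum (s := P)
    (t := Finset.univ) (f := c) (w := f) (b := (∑ p ∈ P, f p) / Fintype.card β)
    (fun a _ => Finset.mem_univ _) Finset.univ_nonempty (by
      rw [nsmul_eq_mul, Finset.card_univ, mul_div_cancel₀ _ h0.ne'])
  exact ⟨b, hb⟩

/-! ### Families with few essentially parallel members -/

/-- At most `N` members of `Q` are pairwise parallel at scale `ρ`. -/
def FewParallel {d : ℕ} (Q : Finset ((Fin d → ℝ) × (Fin d → ℝ))) (ρ N : ℝ) : Prop :=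
  ∀ S ⊆ Q, (∀ q ∈ S, ∀ q' ∈ S, dist q.1 q'.1 ≤ ρ) → (S.card : ℝ) ≤ N

theorem FewParallel.card_le_of_dist {d : ℕ} {Q : Finset ((Fin d → ℝ) × (Fin d → ℝ))} {ρ N : ℝ}
    (h : FewParallel Q ρ N) (hρ : 0 < ρ) (K : ℕ) {S : Finset ((Fin d → ℝ) × (Fin d → ℝ))}
    (hSQ : S ⊆ Q) (hS : ∀ q ∈ S, ∀ q' ∈ S, dist q.1 q'.1 ≤ K * ρ) :
    (S.card : ℝ) ≤ (2 * K + 3) ^ d * N := by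
  classical
  have hN : 0 ≤ N := by simpa using h ∅ (by simp) (by simp)
  have h1 := Finset.card_le_mul_card_image (f := fun q => gridCell ρ q.1) S ⌊N⌋₊ (by
    intro k _
    apply Nat.le_floor
    apply h _ ((Finset.filter_subset _ _).trans hSQ)
    intro q hq q' hq'
    rw [Finset.mem_filter] at hq hq'
    exact (dist_lt_of_gridCell_eq hρ (hq.2.trans hq'.2.symm)).le)
  have h2 := card_image_gridCell_le hρ S (fun q => q.1) K hS
  rw [Fintype.card_fin] at h2
  calc (S.card : ℝ) ≤ ((⌊N⌋₊ * (S.image (fun q => gridCell ρ q.1)).card : ℕ) : ℝ) := by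
        exact_mod_cast h1
    _ ≤ N * (2 * K + 3) ^ d := by
        push_cast
        apply mul_le_mul (Nat.floor_le hN) (by exact_mod_cast h2) (by positivity) hN
    _ = _ := mul_comm _ _

/-- Transfer of parallel bounds along a map with controlled fibres. -/
theorem FewParallel.transfer {d : ℕ} {P Q : Finset ((Fin d → ℝ) × (Fin d → ℝ))} {ρ₀ N : ℝ}
    (h : FewParallel Q ρ₀ N) (hρ₀ : 0 < ρ₀) {r : ℝ} (hr : 0 < r) (ρ : ℝ) (K : ℕ)
    (hsep : ∀ a ∈ P, ∀ b ∈ P, a ≠ b → r ≤ dist a b)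
    (f : (Fin d → ℝ) × (Fin d → ℝ) → (Fin d → ℝ) × (Fin d → ℝ)) (hf : ∀ a ∈ P, f a ∈ Q)
    (h1 : ∀ a ∈ P, ∀ b ∈ P, dist a.1 b.1 ≤ ρ → dist (f a).1 (f b).1 ≤ K * ρ₀)
    (h2 : ∀ a ∈ P, ∀ b ∈ P, f a = f b → dist a b ≤ K * r) :
    FewParallel P ρ ((2 * K + 3) ^ (3 * d) * N) := by
  classical
  intro S hSP hS
  have hN : 0 ≤ N := by simpa using h ∅ (by simp) (by simp)
  have c1 : ((S.image f).card : ℝ) ≤ (2 * K + 3) ^ d * N := by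
    apply h.card_le_of_dist hρ₀ K
    · intro q hq
      obtain ⟨a, ha, rfl⟩ := Finset.mem_image.1 hq
      exact hf a (hSP ha)
    · intro q hq q' hq'
      obtain ⟨a, ha, rfl⟩ := Finset.mem_image.1 hq
      obtain ⟨b, hb, rfl⟩ := Finset.mem_image.1 hq'
      exact h1 a (hSP ha) b (hSP hb) (hS a ha b hb)
  have c2 := Finset.card_le_mul_card_image (f := f) S ((2 * K + 3) ^ (2 * d)) (by
    intro q _
    have hinj : Set.InjOn (fun a : (Fin d → ℝ) × (Fin d → ℝ) => gridCell r (Sum.elim a.1 a.2))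
        ((S.filter fun a => f a = q : Finset _) : Set ((Fin d → ℝ) × (Fin d → ℝ))) := by
      intro a ha b hb hab
      have ha' := Finset.mem_filter.1 (Finset.mem_coe.1 ha)
      have hb' := Finset.mem_filter.1 (Finset.mem_coe.1 hb)
      by_contra hne
      exact absurd (dist_lt_of_pairCell_eq hr (p := a) (q := b) hab)
        (not_lt.2 (hsep a (hSP ha'.1) b (hSP hb'.1) hne))
    rw [← Finset.card_image_of_injOn hinj]
    refine (card_image_gridCell_le hr _
      (fun a : (Fin d → ℝ) × (Fin d → ℝ) => Sum.elim a.1 a.2) K ?_).trans ?_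
    · intro a ha b hb
      rw [Finset.mem_filter] at ha hb
      rw [dist_sumElim]
      exact h2 a (hSP ha.1) b (hSP hb.1) (ha.2.trans hb.2.symm)
    · simp [two_mul])
  calc (S.card : ℝ) ≤ (((2 * K + 3) ^ (2 * d) * (S.image f).card : ℕ) : ℝ) := by exact_mod_cast c2
    _ = (2 * K + 3) ^ (2 * d) * ((S.image f).card : ℝ) := by push_cast; ring
    _ ≤ (2 * K + 3) ^ (2 * d) * ((2 * K + 3) ^ d * N) := by gcongr
    _ = _ := by rw [← mul_assoc, ← pow_add]; congr 2; omega

theorem FewParallel.mono {d : ℕ} {Q Q' : Finset ((Fin d → ℝ) × (Fin d → ℝ))} {ρ N N' : ℝ}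
    (h : FewParallel Q ρ N) (hQ : Q' ⊆ Q) (hN : N ≤ N') : FewParallel Q' ρ N' :=
  fun S hS hS' => (h S (hS.trans hQ) hS').trans hN

/-- Total cardinality from a parallel bound, when all directions lie in a set of diameter `R`. -/
theorem FewParallel.card_le {d : ℕ} {Q : Finset ((Fin d → ℝ) × (Fin d → ℝ))} {ρ N : ℝ}
    (h : FewParallel Q ρ N) (hρ : 0 < ρ) {R : ℝ} (hR : ρ ≤ R)
    (hQ : ∀ q ∈ Q, ∀ q' ∈ Q, dist q.1 q'.1 ≤ R) :
    (Q.card : ℝ) ≤ (7 * R / ρ) ^ d * N := by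
  have hN : 0 ≤ N := by simpa using h ∅ (by simp) (by simp)
  have h1 : 1 ≤ R / ρ := (one_le_div hρ).2 hR
  have hK : (⌈R / ρ⌉₊ : ℝ) < R / ρ + 1 := Nat.ceil_lt_add_one (by positivity)
  refine (h.card_le_of_dist hρ ⌈R / ρ⌉₊ subset_rfl ?_).trans ?_
  · intro q hq q' hq'
    refine (hQ q hq q' hq').trans ?_
    rw [← div_le_iff₀ hρ]
    exact Nat.le_ceil _
  · gcongr
    rw [mul_div_assoc]
    linarith

/-- A maximal separated subset gives a cover at every scale `ρ ≥ s`, with parallel count controlled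
by another family. -/
theorem exists_cover_fewParallel {d : ℕ} {P Q : Finset ((Fin d → ℝ) × (Fin d → ℝ))} {ρ₀ N : ℝ}
    (h : FewParallel Q ρ₀ N) (hρ₀ : 0 < ρ₀) {s ρ : ℝ} (hs : 0 < s) (hρ : s ≤ ρ) (K : ℕ)
    (hsep : ∀ a ∈ P, ∀ b ∈ P, a ≠ b → s ≤ dist a b)
    (f : (Fin d → ℝ) × (Fin d → ℝ) → (Fin d → ℝ) × (Fin d → ℝ)) (hf : ∀ a ∈ P, f a ∈ Q)
    (h1 : ∀ a ∈ P, ∀ b ∈ P, dist a.1 b.1 ≤ ρ → dist (f a).1 (f b).1 ≤ K * ρ₀)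
    (h2 : ∀ a ∈ P, ∀ b ∈ P, f a = f b → dist a b ≤ K * (ρ / 2)) :
    ∃ R ⊆ P, (∀ p ∈ P, Metric.ball p s ⊆ ⋃ q ∈ R, Metric.ball q ρ) ∧
      FewParallel R ρ ((2 * K + 3) ^ (3 * d) * N) := by
  have key : ∃ R ⊆ P, (∀ p ∈ P, Metric.ball p s ⊆ ⋃ q ∈ R, Metric.ball q ρ) ∧
      (∀ a ∈ R, ∀ b ∈ R, a ≠ b → ρ / 2 ≤ dist a b) := by
    by_cases h2s : ρ < 2 * s
    · refine ⟨P, subset_rfl, fun p hp => ?_, fun a ha b hb hab => ?_⟩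
      · exact (Metric.ball_subset_ball hρ).trans
          (Set.subset_biUnion_of_mem (u := fun q => Metric.ball q ρ) hp)
      · have := hsep a ha b hb hab
        linarith
    · obtain ⟨R, hRP, hRsep, hcov⟩ := exists_separated_subset P (r := ρ / 2) (by linarith)
      refine ⟨R, hRP, fun p hp => ?_, hRsep⟩
      obtain ⟨q, hq, hd⟩ := hcov p hp
      refine (Metric.ball_subset_ball' ?_).trans
        (Set.subset_biUnion_of_mem (u := fun q => Metric.ball q ρ) hq)
      linarith
  obtain ⟨R, hRP, hcov, hRsep⟩ := key
  refine ⟨R, hRP, hcov, ?_⟩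
  exact h.transfer hρ₀ (r := ρ / 2) (by linarith) ρ K hRsep f (fun a ha => hf a (hRP ha))
    (fun a ha b hb => h1 a (hRP ha) b (hRP hb)) (fun a ha b hb => h2 a (hRP ha) b (hRP hb))

/-! ### Volume estimates -/

theorem volume_image_le_of_dist_le {n : ℕ} {f : (Fin n → ℝ) → Fin n → ℝ} {S : Set (Fin n → ℝ)}
    {K : ℝ} (hK : 0 ≤ K) (h : ∀ x ∈ S, ∀ y ∈ S, dist (f x) (f y) ≤ K * dist x y) :
    volume (f '' S) ≤ ENNReal.ofReal (K ^ n) * volume S := by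
  have hL : LipschitzOnWith K.toNNReal f S := by
    apply LipschitzOnWith.of_dist_le_mul
    intro x hx y hy
    rw [Real.coe_toNNReal K hK]
    exact h x hx y hy
  have h1 := hL.hausdorffMeasure_image_le (d := n) (by positivity)
  have h2 : (Measure.hausdorffMeasure n : Measure (Fin n → ℝ)) = volume := by
    have := hausdorffMeasure_pi_real (ι := Fin n)
    rwa [Fintype.card_fin] at this
  rw [h2, ENNReal.rpow_natCast] at h1
  rw [ENNReal.ofReal_pow hK]
  exact h1

theorem volume_le_of_dist_le {n : ℕ} {f : (Fin n → ℝ) → Fin n → ℝ} {S : Set (Fin n → ℝ)}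
    {K : ℝ} (hK : 0 ≤ K) (h : ∀ x ∈ S, ∀ y ∈ S, dist x y ≤ K * dist (f x) (f y)) :
    volume S ≤ ENNReal.ofReal (K ^ n) * volume (f '' S) := by
  have hinj : Set.InjOn f S := by
    intro x hx y hy hxy
    have := h x hx y hy
    rw [hxy, dist_self, mul_zero] at this
    exact dist_le_zero.1 this
  have h1 := volume_image_le_of_dist_le (f := Function.invFunOn f S) (S := f '' S) hK (by
    rintro _ ⟨x, hx, rfl⟩ _ ⟨y, hy, rfl⟩
    rw [hinj.leftInvOn_invFunOn hx, hinj.leftInvOn_invFunOn hy]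
    exact h x hx y hy)
  rwa [hinj.leftInvOn_invFunOn.image_image] at h1

theorem dist_snoc {d : ℕ} (u u' : Fin d → ℝ) (t t' : ℝ) :
    dist (Fin.snoc u t : Fin (d + 1) → ℝ) (Fin.snoc u' t') = max (dist u u') (dist t t') := by
  apply le_antisymm
  · rw [dist_pi_le_iff (le_max_of_le_left dist_nonneg)]
    intro i
    refine Fin.lastCases ?_ (fun j => ?_) i
    · simp
    · simp only [Fin.snoc_castSucc]
      exact (dist_le_pi_dist u u' j).trans (le_max_left _ _)
  · apply max_le
    · rw [dist_pi_le_iff dist_nonneg]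
      intro j
      have := dist_le_pi_dist (Fin.snoc u t : Fin (d + 1) → ℝ) (Fin.snoc u' t') j.castSucc
      simpa only [Fin.snoc_castSucc] using this
    · have := dist_le_pi_dist (Fin.snoc u t : Fin (d + 1) → ℝ) (Fin.snoc u' t') (Fin.last d)
      simpa only [Fin.snoc_last] using this

theorem volume_image_snoc_smul {d : ℕ} {c : ℝ} (hc : 0 ≤ c) (u : (Fin (d + 1) → ℝ) → Fin d → ℝ)
    (t : (Fin (d + 1) → ℝ) → ℝ) (S : Set (Fin (d + 1) → ℝ)) :
    volume ((fun x => (Fin.snoc (c • u x) (t x) : Fin (d + 1) → ℝ)) '' S) =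
      ENNReal.ofReal (c ^ d) *
        volume ((fun x => (Fin.snoc (u x) (t x) : Fin (d + 1) → ℝ)) '' S) := by
  have h := Measure.addHaar_image_linearMap (volume : Measure (Fin (d + 1) → ℝ))
    (Matrix.toLin' (Matrix.diagonal (Fin.snoc (fun _ => c) 1 : Fin (d + 1) → ℝ)))
    ((fun x => (Fin.snoc (u x) (t x) : Fin (d + 1) → ℝ)) '' S)
  rw [LinearMap.det_toLin', Matrix.det_diagonal, Fin.prod_univ_castSucc, Set.image_image] at h
  simp only [Fin.snoc_castSucc, Fin.snoc_last, Finset.prod_const, Finset.card_univ,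
    Fintype.card_fin, mul_one] at h
  rw [abs_of_nonneg (pow_nonneg hc d)] at h
  rw [← h]
  congr 1
  apply Set.image_congr
  intro x _
  ext i
  rw [Matrix.toLin'_apply, Matrix.mulVec_diagonal]
  refine Fin.lastCases ?_ (fun j => ?_) i
  · simp
  · simp

theorem volume_snoc_box {d : ℕ} {a b : ℝ} (ha : 0 ≤ a) :
    volume {z : Fin (d + 1) → ℝ | (∀ i : Fin d, |z i.castSucc| ≤ a) ∧ |z (Fin.last d)| ≤ b} =
      ENNReal.ofReal ((2 * a) ^ d * (2 * b)) := by
  have : {z : Fin (d + 1) → ℝ | (∀ i : Fin d, |z i.castSucc| ≤ a) ∧ |z (Fin.last d)| ≤ b} =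
      Set.Icc (Fin.snoc (fun _ => -a) (-b)) (Fin.snoc (fun _ => a) b) := by
    ext z
    simp only [Set.mem_ofPred_eq, Set.mem_Icc, Pi.le_def, Fin.forall_fin_succ', Fin.snoc_castSucc,
      Fin.snoc_last, abs_le]
    constructor
    · rintro ⟨h1, h2⟩
      exact ⟨⟨fun i => (h1 i).1, h2.1⟩, ⟨fun i => (h1 i).2, h2.2⟩⟩
    · rintro ⟨⟨h1, h2⟩, h3, h4⟩
      exact ⟨fun i => ⟨h1 i, h3 i⟩, h2, h4⟩
  rw [this, Real.volume_Icc_pi, Fin.prod_univ_castSucc]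
  simp only [Fin.snoc_castSucc, Fin.snoc_last, Finset.prod_const, Finset.card_univ,
    Fintype.card_fin]
  rw [ENNReal.ofReal_mul (by positivity), ENNReal.ofReal_pow (by positivity)]
  congr 2
  · congr 1; ring
  · ring

/-- The union of the cells of a partition in which `Z` has density at least `θ`. -/
def denseCells {α κ : Type*} [MeasurableSpace α] (μ : Measure α) (c : α → κ) (θ : ENNReal)
    (Z : Set α) : Set α :=
  c ⁻¹' {k | (Z ∩ c ⁻¹' {k}).Nonempty ∧ θ * μ (c ⁻¹' {k}) ≤ μ (Z ∩ c ⁻¹' {k})}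

section DenseCells
variable {α κ ι : Type*} [MeasurableSpace α] [MeasurableSpace κ] [Countable κ]
  [MeasurableSingletonClass κ] {μ : Measure α} {c : α → κ} {θ : ENNReal}

theorem measurableSet_denseCells (hc : Measurable c) (Z : Set α) :
    MeasurableSet (denseCells μ c θ Z) :=
  hc (Set.Countable.measurableSet (Set.to_countable _))

theorem measure_inter_preimage_eq_tsum (hc : Measurable c) (S : Set α) (A : Set κ) :
    μ (S ∩ c ⁻¹' A) = ∑' k : A, μ (S ∩ c ⁻¹' {(k : κ)}) := by
  have hA : MeasurableSet (c ⁻¹' A) := hc (Set.Countable.measurableSet (Set.to_countable _))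
  have h := tsum_measure_preimage_singleton (μ := μ.restrict S) (Set.to_countable A) (f := c)
    (fun y _ => hc (measurableSet_singleton y))
  rw [Measure.restrict_apply hA, Set.inter_comm] at h
  rw [← h]
  refine tsum_congr fun k => ?_
  rw [Measure.restrict_apply (hc (measurableSet_singleton _)), Set.inter_comm]

theorem mul_measure_biUnion_denseCells_le (hc : Measurable c) (Q : Finset ι) (Z : ι → Set α) :
    θ * μ (⋃ q ∈ Q, denseCells μ c θ (Z q)) ≤ μ (⋃ q ∈ Q, Z q) := by
  set A : Set κ := {k | ∃ q ∈ Q, θ * μ (c ⁻¹' {k}) ≤ μ (Z q ∩ c ⁻¹' {k})} with hA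
  have h1 : (⋃ q ∈ Q, denseCells μ c θ (Z q)) ⊆ Set.univ ∩ c ⁻¹' A := by
    intro x hx
    simp only [Set.mem_iUnion] at hx
    obtain ⟨q, hq, h⟩ := hx
    exact ⟨trivial, q, hq, h.2⟩
  calc θ * μ (⋃ q ∈ Q, denseCells μ c θ (Z q)) ≤ θ * μ (Set.univ ∩ c ⁻¹' A) := by gcongr
    _ = ∑' k : A, θ * μ (c ⁻¹' {(k : κ)}) := by
        rw [measure_inter_preimage_eq_tsum hc, ENNReal.tsum_mul_left]
        simp only [Set.univ_inter]
    _ ≤ ∑' k : A, μ ((⋃ q ∈ Q, Z q) ∩ c ⁻¹' {(k : κ)}) := by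
        refine ENNReal.tsum_le_tsum fun k => ?_
        obtain ⟨q, hq, h⟩ := k.2
        refine h.trans (measure_mono ?_)
        exact Set.inter_subset_inter_left _ (Set.subset_biUnion_of_mem (u := Z) hq)
    _ = μ ((⋃ q ∈ Q, Z q) ∩ c ⁻¹' A) := (measure_inter_preimage_eq_tsum hc _ _).symm
    _ ≤ μ (⋃ q ∈ Q, Z q) := measure_mono Set.inter_subset_left

theorem measure_le_measure_denseCells_add (hc : Measurable c) (Z W : Set α)
    (hW : ∀ x ∈ Z, ∀ y, c y = c x → y ∈ W) :
    μ Z ≤ μ (denseCells μ c θ Z) + θ * μ W := by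
  set A : Set κ := {k | (Z ∩ c ⁻¹' {k}).Nonempty ∧ ¬ θ * μ (c ⁻¹' {k}) ≤ μ (Z ∩ c ⁻¹' {k})} with hA
  have h1 : Z ⊆ denseCells μ c θ Z ∪ (Z ∩ c ⁻¹' A) := by
    intro x hx
    have hne : (Z ∩ c ⁻¹' {c x}).Nonempty := ⟨x, hx, rfl⟩
    by_cases h : θ * μ (c ⁻¹' {c x}) ≤ μ (Z ∩ c ⁻¹' {c x})
    · exact Or.inl ⟨hne, h⟩
    · exact Or.inr ⟨hx, hne, h⟩
  refine (measure_mono h1).trans ((measure_union_le _ _).trans ?_)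
  gcongr
  calc μ (Z ∩ c ⁻¹' A) = ∑' k : A, μ (Z ∩ c ⁻¹' {(k : κ)}) := measure_inter_preimage_eq_tsum hc _ _
    _ ≤ ∑' k : A, θ * μ (Set.univ ∩ c ⁻¹' {(k : κ)}) := by
        refine ENNReal.tsum_le_tsum fun k => ?_
        rw [Set.univ_inter]
        exact (not_le.1 k.2.2).le
    _ = θ * μ (Set.univ ∩ c ⁻¹' A) := by
        rw [ENNReal.tsum_mul_left, measure_inter_preimage_eq_tsum hc]
    _ ≤ θ * μ W := by
        gcongr
        rintro x ⟨-, ⟨y, hy, hyx⟩, -⟩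
        exact hW y hy x hyx.symm

end DenseCells

/-- Shadings can be shrunk by concentric balls to any prescribed smaller total volume. -/
theorem exists_sum_volume_inter_closedBall_eq {ι : Type*} {n : ℕ} (hn : n ≠ 0) (Q : Finset ι)
    (Y : ι → Set (Fin n → ℝ)) (R : ℝ) (hY : ∀ q ∈ Q, Y q ⊆ closedBall 0 R) {t : ℝ} (ht : 0 ≤ t)
    (hle : t ≤ ∑ q ∈ Q, volume.real (Y q)) :
    ∃ a, ∑ q ∈ Q, volume.real (Y q ∩ closedBall 0 a) = t := by
  have hvol : ∀ a : ℝ, 0 ≤ a → volume.real (closedBall (0 : Fin n → ℝ) a) = (2 * a) ^ n := by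
    intro a ha
    rw [measureReal_def, Real.volume_pi_closedBall _ ha, Fintype.card_fin,
      ENNReal.toReal_ofReal (by positivity)]
  have hfin : ∀ a : ℝ, volume (closedBall (0 : Fin n → ℝ) a) ≠ ⊤ := fun a =>
    measure_closedBall_lt_top.ne
  have hfin' : ∀ (q : ι) (a : ℝ), volume (Y q ∩ closedBall (0 : Fin n → ℝ) a) ≠ ⊤ := fun q a =>
    measure_ne_top_of_subset Set.inter_subset_right (hfin a)
  set f : ℝ → ℝ := fun a => ∑ q ∈ Q, volume.real (Y q ∩ closedBall 0 a) with hf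
  have hmono : Monotone f := by
    intro a b hab
    refine Finset.sum_le_sum fun q _ => ?_
    exact measureReal_mono (Set.inter_subset_inter_right _ (closedBall_subset_closedBall hab))
      (hfin' q b)
  have hdiff : ∀ a b : ℝ, 0 ≤ a → a ≤ b → f b - f a ≤ Q.card * ((2 * b) ^ n - (2 * a) ^ n) := by
    intro a b ha hab
    rw [hf, ← Finset.sum_sub_distrib, ← nsmul_eq_mul]
    refine Finset.sum_le_card_nsmul _ _ _ fun q _ => ?_
    rw [← hvol a ha, ← hvol b (ha.trans hab), sub_le_iff_le_add]
    have h1 : Y q ∩ closedBall 0 b ⊆ (closedBall 0 b \ closedBall 0 a) ∪ (Y q ∩ closedBall 0 a) := by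
      rintro x ⟨h1, h2⟩
      by_cases h : x ∈ closedBall (0 : Fin n → ℝ) a
      · exact Or.inr ⟨h1, h⟩
      · exact Or.inl ⟨h2, h⟩
    refine (measureReal_mono h1 ?_).trans ((measureReal_union_le _ _).trans ?_)
    · exact measure_ne_top_of_subset (Set.union_subset Set.sdiff_subset (Set.inter_subset_right.trans
        (closedBall_subset_closedBall hab))) (hfin b)
    · gcongr
      rw [measureReal_sdiff (closedBall_subset_closedBall hab) measurableSet_closedBall (hfin b)]
  have hcont : ContinuousOn f (Set.Icc 0 (max R 0)) := by
    intro a ha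
    have hg : ContinuousWithinAt (fun b : ℝ => (Q.card : ℝ) * |(2 * b) ^ n - (2 * a) ^ n|)
        (Set.Icc 0 (max R 0)) a := by fun_prop
    rw [ContinuousWithinAt, tendsto_iff_dist_tendsto_zero]
    have hg' := hg.tendsto
    simp only [sub_self, abs_zero, mul_zero] at hg'
    refine squeeze_zero' (Filter.Eventually.of_forall fun _ => dist_nonneg) ?_ hg'
    filter_upwards [self_mem_nhdsWithin] with b hb
    rw [Real.dist_eq]
    rcases le_total a b with hab | hab
    · rw [abs_of_nonneg (sub_nonneg.2 (hmono hab))]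
      refine (hdiff a b ha.1 hab).trans ?_
      gcongr
      exact le_abs_self _
    · rw [abs_sub_comm, abs_of_nonneg (sub_nonneg.2 (hmono hab)), abs_sub_comm]
      refine (hdiff b a hb.1 hab).trans ?_
      gcongr
      exact le_abs_self _
  have h0 : f 0 ≤ t := by
    have : f 0 = 0 := by
      refine Finset.sum_eq_zero fun q _ => ?_
      have := measureReal_mono (μ := volume) (Set.inter_subset_right (s := Y q)) (hfin 0)
      rw [hvol 0 le_rfl, mul_zero, zero_pow hn] at this
      exact le_antisymm this measureReal_nonneg
    rw [this]; exact ht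
  have h1 : t ≤ f (max R 0) := by
    refine hle.trans (le_of_eq (Finset.sum_congr rfl fun q hq => ?_))
    rw [Set.inter_eq_left.2 ((hY q hq).trans (closedBall_subset_closedBall (le_max_left _ _)))]
  obtain ⟨a, -, ha⟩ := intermediate_value_Icc (le_max_right R 0) hcont ⟨h0, h1⟩
  exact ⟨a, ha⟩

theorem measurable_gridCell {ι : Type*} (r : ℝ) :
    Measurable (gridCell r : (ι → ℝ) → ι → ℤ) := by
  refine measurable_pi_lambda _ fun i => ?_
  have h : Measurable fun x : ι → ℝ => x i / r := by fun_prop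
  exact Int.measurable_floor.comp h

section Chart

variable {E F V : Type*} [NormedAddCommGroup E] [NormedSpace ℝ E] [NormedAddCommGroup F]
  [NormedSpace ℝ F] [NormedAddCommGroup V] [NormedSpace ℝ V]

lemma eq_of_hasDerivAt_zero {f : ℝ → V} {r : ℝ}
    (hf : ∀ t ∈ Ioo (-r) r, HasDerivAt f 0 t) {t : ℝ} (ht : t ∈ Ioo (-r) r) : f t = f 0 := by
  have h0 : (0 : ℝ) ∈ Ioo (-r) r := by
    constructor <;> linarith [ht.1, ht.2]
  exact isOpen_Ioo.is_const_of_deriv_eq_zero isPreconnected_Ioo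
    (fun t ht => (hf t ht).differentiableAt.differentiableWithinAt)
    (fun t ht => (hf t ht).deriv) ht h0

/-- If `H` has derivative `S` along the vector field `G`, and the derivative of `S` along `G` is
proportional to `S`, then `H` is affine along an integral curve parametrised by `ℓ ∘ H`. -/
lemma affine_along_curve {H S : E → V} {G : E → E} (ℓ : V →L[ℝ] ℝ) {X : ℝ → E} {r b : ℝ}
    (hX : ∀ t ∈ Ioo (-r) r, ∃ c : ℝ, HasDerivAt X (c • G (X t)) t)
    (hH : ∀ t ∈ Ioo (-r) r, DifferentiableAt ℝ H (X t))
    (hHS : ∀ t ∈ Ioo (-r) r, fderiv ℝ H (X t) (G (X t)) = S (X t))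
    (hS : ∀ t ∈ Ioo (-r) r, DifferentiableAt ℝ S (X t))
    (hSS : ∀ t ∈ Ioo (-r) r, ∃ l : ℝ, fderiv ℝ S (X t) (G (X t)) = l • S (X t))
    (hne : ∀ t ∈ Ioo (-r) r, ℓ (S (X t)) ≠ 0)
    (hT : ∀ t ∈ Ioo (-r) r, ℓ (H (X t)) = t + b) {t : ℝ} (ht : t ∈ Ioo (-r) r) :
    H (X t) = H (X 0) + t • ((ℓ (S (X 0)))⁻¹ • S (X 0)) := by
  have hX' : ∀ t ∈ Ioo (-r) r, HasDerivAt X ((ℓ (S (X t)))⁻¹ • G (X t)) t := by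
    intro t ht
    obtain ⟨c, hc⟩ := hX t ht
    have h1 : HasDerivAt (fun t => H (X t)) (fderiv ℝ H (X t) (c • G (X t))) t :=
      (hH t ht).hasFDerivAt.comp_hasDerivAt t hc
    have h2 : HasDerivAt (fun t => ℓ (H (X t))) (ℓ (fderiv ℝ H (X t) (c • G (X t)))) t :=
      ℓ.hasFDerivAt.comp_hasDerivAt t h1
    have h3 : HasDerivAt (fun t => ℓ (H (X t))) 1 t := by
      refine ((hasDerivAt_id t).add_const b).congr_of_eventuallyEq ?_
      filter_upwards [isOpen_Ioo.mem_nhds ht] with u hu using hT u hu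
    have h4 := h2.unique h3
    rw [map_smul, hHS t ht, map_smul, smul_eq_mul] at h4
    have : c = (ℓ (S (X t)))⁻¹ := eq_inv_of_mul_eq_one_left h4
    rwa [← this]
  set R : ℝ → V := fun t => (ℓ (S (X t)))⁻¹ • S (X t) with hR
  have hRc : ∀ t ∈ Ioo (-r) r, R t = R 0 := by
    intro t ht
    refine eq_of_hasDerivAt_zero (fun t ht => ?_) ht
    obtain ⟨l, hl⟩ := hSS t ht
    have h1 : HasDerivAt (fun t => S (X t)) ((ℓ (S (X t)))⁻¹ • (l • S (X t))) t := by
      have := (hS t ht).hasFDerivAt.comp_hasDerivAt t (hX' t ht)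
      rwa [map_smul, hl] at this
    have h2 : HasDerivAt (fun t => ℓ (S (X t))) (ℓ ((ℓ (S (X t)))⁻¹ • (l • S (X t)))) t :=
      ℓ.hasFDerivAt.comp_hasDerivAt t h1
    have h3 := (h2.inv (hne t ht)).smul h1
    refine h3.congr_deriv ?_
    have := hne t ht
    simp only [map_smul, smul_eq_mul, smul_smul, Pi.inv_apply]
    rw [← add_smul]
    convert zero_smul ℝ _ using 2
    field_simp
    ring
  have hfin := eq_of_hasDerivAt_zero (f := fun t => H (X t) - t • R 0) (fun t ht => ?_) ht
  · simp only [zero_smul, sub_zero] at hfin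
    rw [← hfin]; simp [hR]
  · have h1 : HasDerivAt (fun t => H (X t)) (R t) t := by
      have := (hH t ht).hasFDerivAt.comp_hasDerivAt t (hX' t ht)
      rwa [map_smul, hHS t ht] at this
    have h2 : HasDerivAt (fun t : ℝ => t • R 0) ((1:ℝ) • R 0) t :=
      (hasDerivAt_id t).smul_const (R 0)
    have := h1.sub h2
    rwa [hRc t ht, one_smul, sub_self] at this

lemma exists_equiv_prod [FiniteDimensional ℝ E] [FiniteDimensional ℝ F]
    (hEF : Module.finrank ℝ E = Module.finrank ℝ F + 1) {L : E →L[ℝ] F} {l : E →L[ℝ] ℝ} {G : E}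
    (hL : Function.Surjective L) (hG : L G = 0) (hl : l G ≠ 0) :
    ∃ D : E ≃L[ℝ] (F × ℝ), ∀ e, D e = (L e, l e) := by
  have hfr : Module.finrank ℝ E = Module.finrank ℝ (F × ℝ) := by
    simp [hEF]
  have hsurj : Function.Surjective (L.prod l) := by
    rintro ⟨f, t⟩
    obtain ⟨e, he⟩ := hL f
    refine ⟨e + ((t - l e) / l G) • G, ?_⟩
    simp [he, hG]
    field_simp
    ring
  have hinj : Function.Injective (L.prod l : E →ₗ[ℝ] F × ℝ) :=
    (LinearMap.injective_iff_surjective_of_finrank_eq_finrank hfr).2 hsurj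
  refine ⟨(LinearEquiv.ofBijective (L.prod l : E →ₗ[ℝ] F × ℝ)
    ⟨hinj, hsurj⟩).toContinuousLinearEquiv, fun e => rfl⟩

end Chart

section Chart

variable {E F V : Type*} [NormedAddCommGroup E] [NormedSpace ℝ E] [NormedAddCommGroup F]
  [NormedSpace ℝ F] [NormedAddCommGroup V] [NormedSpace ℝ V]

lemma exists_eq_smul_of_apply_eq_zero [FiniteDimensional ℝ E] [FiniteDimensional ℝ F]
    (hEF : Module.finrank ℝ E = Module.finrank ℝ F + 1) {L : E →L[ℝ] F} {l : E →L[ℝ] ℝ} {G : E}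
    (hL : Function.Surjective L) (hG : L G = 0) (hl : l G ≠ 0) {e : E} (he : L e = 0) :
    ∃ c : ℝ, e = c • G := by
  obtain ⟨D, hD⟩ := exists_equiv_prod hEF hL hG hl
  refine ⟨l e / l G, D.injective ?_⟩
  rw [hD, hD]
  simp [he, hG, hl]

/-- A neighbourhood of `(xc, ξc)` on which the family of curves `g x ξ = v` is straightened, up to
quadratic errors, by `T` and `g`. -/
structure IsChart (g : E → F → F) (x₀ : E) (r₀ : ℝ) (xc : E) (ξc : F) (T : E → F → ℝ) (w : F)
    (κ K c lam₀ : ℝ) : Prop where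
  κ_pos : 0 < κ
  one_le_K : 1 ≤ K
  c_pos : 0 < c
  lam₀_pos : 0 < lam₀
  abs_T_le : ∀ x ∈ ball xc κ, ∀ ξ ∈ ball ξc κ, |T x ξ| ≤ 1 / 2
  dist_le : ∀ x ∈ ball xc κ, ∀ x' ∈ ball xc κ, ∀ ξ ∈ ball ξc κ,
    dist (g x ξ) (g x' ξ) ≤ K * dist x x'
  dist_T_le : ∀ x ∈ ball xc κ, ∀ x' ∈ ball xc κ, ∀ ξ ∈ ball ξc κ,
    dist (T x ξ) (T x' ξ) ≤ K * dist x x'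
  le_max : ∀ x ∈ ball xc κ, ∀ x' ∈ ball xc κ, ∀ ξ ∈ ball ξc κ,
    dist x x' ≤ K * max (dist (g x ξ) (g x' ξ)) (dist (T x ξ) (T x' ξ))
  dist_right_le : ∀ x ∈ ball xc κ, ∀ ξ ∈ ball ξc κ, ∀ ξ' ∈ ball ξc κ,
    dist (g x ξ) (g x ξ') ≤ K * dist ξ ξ'
  straight : ∀ x' ∈ ball xc κ, ∀ ξ' ∈ ball ξc κ, ∃ A B : F →L[ℝ] F, ‖A‖ ≤ K ∧ ‖B‖ ≤ K ∧
    (∀ ω, ‖ω‖ ≤ K * ‖A ω‖) ∧ ∀ x ∈ ball xc κ, ∀ ξ ∈ ball ξc κ,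
      ‖g x ξ' - g x' ξ' + (B + T x ξ' • A) (ξ - ξ') - (g x ξ - g x' ξ')‖ ≤
        K * (‖ξ - ξ'‖ ^ 2 + ‖g x ξ - g x' ξ'‖ ^ 2)
  shift : ∀ x ∈ ball xc κ ∩ closedBall x₀ r₀, ∀ ξ ∈ ball ξc κ, ∀ ξ' ∈ ball ξc κ, ∀ (v : F) (lam : ℝ),
    0 < lam → lam ≤ lam₀ → dist ξ ξ' ≤ c * lam → dist (g x ξ) v ≤ c * lam →
      ∃ x' ∈ closedBall x₀ r₀, g x' ξ' = v + lam • w ∧ dist x' x ≤ K * lam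

/-- The shift field of `IsChart`, from the linearisation of `(g, T)` and a local inverse. -/
lemma exists_shift_of_linearization {Ψ : E → F × ℝ} (D : E ≃L[ℝ] (F × ℝ)) {N ε₁ : ℝ}
    (hN : ∀ y, ‖D.symm y‖ ≤ N * ‖y‖) (hN0 : 0 ≤ N) (hε : N * ε₁ ≤ 1 / 16)
    {x x' : E} (happ : ‖Ψ x' - Ψ x - D (x' - x)‖ ≤ ε₁ * ‖x' - x‖) {x₀ xc : E} {r₀ lam : ℝ}
    (hx : x ∈ closedBall x₀ r₀) (hxc : xc ∈ closedBall x₀ r₀) (hxx : dist x xc ≤ r₀ / 2)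
    (hlam : 0 < lam) (hlam1 : lam ≤ 1) {b : F × ℝ} (hb : N * ‖b‖ ≤ r₀ / 16 * lam)
    (hx' : Ψ x' - Ψ x = b + lam • D (x₀ - xc)) :
    x' ∈ closedBall x₀ r₀ ∧ dist x' x ≤ 2 * r₀ * lam := by
  rw [mem_closedBall, dist_eq_norm] at hx hxc
  rw [dist_eq_norm] at hxx
  rw [mem_closedBall, dist_eq_norm, dist_eq_norm]
  rw [norm_sub_rev] at hxc
  have h1 : D.symm (b - (Ψ x' - Ψ x - D (x' - x))) = x' - x - lam • (x₀ - xc) := by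
    apply D.injective
    rw [D.apply_symm_apply, hx', map_sub D (x' - x), map_smul]
    abel
  have h2 : ‖x' - x - lam • (x₀ - xc)‖ ≤ r₀ / 16 * lam + 1 / 16 * ‖x' - x‖ := by
    rw [← h1]
    refine (hN _).trans ?_
    calc N * ‖b - (Ψ x' - Ψ x - D (x' - x))‖ ≤ N * (‖b‖ + ε₁ * ‖x' - x‖) := by
          gcongr
          exact (norm_sub_le _ _).trans (by gcongr)
      _ = N * ‖b‖ + (N * ε₁) * ‖x' - x‖ := by ring
      _ ≤ _ := by gcongr
  have h3 : ‖lam • (x₀ - xc)‖ ≤ lam * r₀ := by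
    rw [norm_smul, Real.norm_of_nonneg hlam.le]; gcongr
  have h4 : ‖x' - x‖ ≤ ‖x' - x - lam • (x₀ - xc)‖ + ‖lam • (x₀ - xc)‖ := by
    simpa using norm_add_le (x' - x - lam • (x₀ - xc)) (lam • (x₀ - xc))
  have hr : 0 ≤ r₀ * lam := mul_nonneg ((norm_nonneg _).trans hx) hlam.le
  refine ⟨?_, by nlinarith⟩
  have h5 : x' - x₀ = (1 - lam) • (x - x₀) + lam • (x - xc) + (x' - x - lam • (x₀ - xc)) := by
    module
  have h6 : ‖(1 - lam) • (x - x₀)‖ ≤ (1 - lam) * r₀ := by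
    rw [norm_smul, Real.norm_of_nonneg (by linarith)]
    have : 0 ≤ 1 - lam := by linarith
    gcongr
  have h7 : ‖lam • (x - xc)‖ ≤ lam * (r₀ / 2) := by
    rw [norm_smul, Real.norm_of_nonneg hlam.le]; gcongr
  rw [h5]
  have h8 := norm_add₃_le (a := (1 - lam) • (x - x₀)) (b := lam • (x - xc))
    (c := x' - x - lam • (x₀ - xc))
  nlinarith

/-- First order Taylor estimate with a Lipschitz derivative. -/
lemma norm_sub_sub_le_of_lipschitz {f : F → V} {f' : F → F →L[ℝ] V} {s : Set F} (hs : Convex ℝ s)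
    {L : ℝ} (hL : 0 ≤ L) (hf : ∀ ξ ∈ s, HasFDerivAt f (f' ξ) ξ)
    (hlip : ∀ ξ ∈ s, ∀ ξ' ∈ s, ‖f' ξ - f' ξ'‖ ≤ L * ‖ξ - ξ'‖) {a b : F} (ha : a ∈ s) (hb : b ∈ s) :
    ‖f b - f a - f' a (b - a)‖ ≤ L * ‖b - a‖ ^ 2 := by
  have hsub : segment ℝ a b ⊆ s := hs.segment_subset ha hb
  have := (convex_segment a b).norm_image_sub_le_of_norm_hasFDerivWithin_le' (f := f) (f' := f')
    (φ := f' a) (C := L * ‖b - a‖) (fun ξ hξ => (hf ξ (hsub hξ)).hasFDerivWithinAt)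
    (fun ξ hξ => by
      refine (hlip ξ (hsub hξ) a ha).trans ?_
      gcongr
      rw [← dist_eq_norm, ← dist_eq_norm, dist_comm ξ, dist_comm b]
      have := dist_add_dist_of_mem_segment hξ
      linarith [dist_nonneg (x := ξ) (y := b)])
    (left_mem_segment ℝ a b) (right_mem_segment ℝ a b)
  linarith [this, sq ‖b - a‖, mul_assoc L ‖b - a‖ ‖b - a‖]

end Chart

section Chart

variable {E F V : Type*} [NormedAddCommGroup E] [NormedSpace ℝ E] [NormedAddCommGroup F]
  [NormedSpace ℝ F] [NormedAddCommGroup V] [NormedSpace ℝ V]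

lemma exists_norm_sub_sub_le {Ψ : E × F → V} {xc : E} {ξc : F} (hΨ : ContDiffAt ℝ 1 Ψ (xc, ξc))
    {D : E →L[ℝ] V} (hD : ∀ e, fderiv ℝ Ψ (xc, ξc) (e, 0) = D e) {ε₁ : ℝ} (hε : 0 < ε₁) :
    ∃ r > 0, ∀ x ∈ ball xc r, ∀ x' ∈ ball xc r, ∀ ξ ∈ ball ξc r,
      ‖Ψ (x', ξ) - Ψ (x, ξ) - D (x' - x)‖ ≤ ε₁ * ‖x' - x‖ := by
  obtain ⟨s, hs, happ⟩ := (hΨ.hasStrictFDerivAt one_ne_zero).approximates_deriv_on_nhds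
    (c := ⟨ε₁, hε.le⟩) (Or.inr hε)
  obtain ⟨r, hr, hrs⟩ := Metric.mem_nhds_iff.1 hs
  rw [← ball_prod_same] at hrs
  refine ⟨r, hr, fun x hx x' hx' ξ hξ => ?_⟩
  have := happ (x', ξ) (hrs ⟨hx', hξ⟩) (x, ξ) (hrs ⟨hx, hξ⟩)
  have hc : ‖((x', ξ) : E × F) - (x, ξ)‖ = ‖x' - x‖ := by simp [Prod.norm_def]
  have hd : ((x', ξ) : E × F) - (x, ξ) = (x' - x, 0) := by simp
  rw [hc, hd, hD] at this
  exact this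

lemma exists_param_localInverse [CompleteSpace E] [CompleteSpace F] {Ψ : E × F → V} {xc : E}
    {ξc : F} (hΨ : ContDiffAt ℝ 1 Ψ (xc, ξc)) {D : E ≃L[ℝ] V}
    (hD : ∀ e, fderiv ℝ Ψ (xc, ξc) (e, 0) = D e) {r : ℝ} (hr : 0 < r) :
    ∃ X : V × F → E, ∃ r₂ > 0, ∀ y ∈ ball (Ψ (xc, ξc)) r₂, ∀ ξ ∈ ball ξc r₂,
      X (y, ξ) ∈ ball xc r ∧ Ψ (X (y, ξ), ξ) = y ∧ DifferentiableAt ℝ X (y, ξ) := by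
  set B : F →L[ℝ] V := (fderiv ℝ Ψ (xc, ξc)).comp (ContinuousLinearMap.inr ℝ E F)
  have hDB : ∀ q : E × F, fderiv ℝ Ψ (xc, ξc) q = D q.1 + B q.2 := by
    intro q
    rw [← hD]
    simp only [B, ContinuousLinearMap.comp_apply, ContinuousLinearMap.inr_apply, ← map_add]
    simp
  let D' : (E × F) ≃L[ℝ] (V × F) := ContinuousLinearEquiv.equivOfInverse
    (((fderiv ℝ Ψ (xc, ξc))).prod (ContinuousLinearMap.snd ℝ E F))
    (((D.symm : V →L[ℝ] E).comp (ContinuousLinearMap.fst ℝ V F -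
      B.comp (ContinuousLinearMap.snd ℝ V F))).prod (ContinuousLinearMap.snd ℝ V F))
    (fun q => by ext <;> simp [hDB])
    (fun q => by ext <;> simp [hDB])
  have hFc : ContDiffAt ℝ 1 (fun p : E × F => (Ψ p, p.2)) (xc, ξc) := hΨ.prodMk contDiffAt_snd
  have hF' : HasFDerivAt (fun p : E × F => (Ψ p, p.2)) (D' : E × F →L[ℝ] V × F) (xc, ξc) :=
    (hΨ.differentiableAt one_ne_zero).hasFDerivAt.prodMk hasFDerivAt_snd
  set Y := hFc.localInverse hF' one_ne_zero with hY
  have hYd : ContDiffAt ℝ 1 Y (Ψ (xc, ξc), ξc) := hFc.to_localInverse hF' one_ne_zero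
  have h1 : ∀ᶠ z in 𝓝 (Ψ (xc, ξc), ξc), (Ψ (Y z), (Y z).2) = z :=
    (hFc.hasStrictFDerivAt' hF' one_ne_zero).eventually_right_inverse
  have h2 : ∀ᶠ z in 𝓝 (Ψ (xc, ξc), ξc), DifferentiableAt ℝ Y z :=
    (hYd.eventually (by simp)).mono fun z hz => hz.differentiableAt one_ne_zero
  have h3 : Y (Ψ (xc, ξc), ξc) = (xc, ξc) :=
    (hFc.hasStrictFDerivAt' hF' one_ne_zero).localInverse_apply_image
  have h4 : ∀ᶠ z in 𝓝 (Ψ (xc, ξc), ξc), Y z ∈ ball (xc, ξc) r := by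
    apply hYd.continuousAt
    rw [h3]
    exact ball_mem_nhds _ hr
  obtain ⟨r₂, hr₂, hsub⟩ := Metric.mem_nhds_iff.1 (h1.and (h2.and h4))
  rw [← ball_prod_same] at hsub
  refine ⟨fun z => (Y z).1, r₂, hr₂, fun y hy ξ hξ => ?_⟩
  obtain ⟨ha, hb, hc⟩ := hsub (mk_mem_prod hy hξ)
  rw [← ball_prod_same] at hc
  have hs : (Y (y, ξ)).2 = ξ := (Prod.mk.inj ha).2
  refine ⟨hc.1, ?_, hb.fst⟩
  rw [show ((Y (y, ξ)).1, ξ) = Y (y, ξ) from Prod.ext rfl hs.symm]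
  exact (Prod.mk.inj ha).1

/-- The differential identities satisfied by the gradient map `g`, its `ξ`-derivative `H`, the
direction field `G` of its fibres and the derivative `S` of `H` along `G`. -/
structure IsPhaseData (g : E → F → F) (H S : E × F → F →L[ℝ] F) (G : E × F → E)
    (O : Set (E × F)) : Prop where
  isOpen : IsOpen O
  contDiffOn : ContDiffOn ℝ 1 (fun p : E × F => g p.1 p.2) O
  contDiffOn_H : ContDiffOn ℝ 1 H O
  contDiffOn_S : ContDiffOn ℝ 1 S O
  hasFDerivAt : ∀ p ∈ O, HasFDerivAt (g p.1) (H p) p.2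
  fderiv_apply_G : ∀ p ∈ O, fderiv ℝ (fun x => g x p.2) p.1 (G p) = 0
  surjective : ∀ p ∈ O, Function.Surjective (fderiv ℝ (fun x => g x p.2) p.1)
  fderiv_H : ∀ p ∈ O, fderiv ℝ (fun x => H (x, p.2)) p.1 (G p) = S p
  fderiv_S : ∀ p ∈ O, ∃ l : ℝ, fderiv ℝ (fun x => S (x, p.2)) p.1 (G p) = l • S p

lemma differentiableAt_left {f : E × F → V} {O : Set (E × F)} (hO : IsOpen O)
    (hf : ContDiffOn ℝ 1 f O) {x : E} {ξ : F} (h : (x, ξ) ∈ O) :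
    DifferentiableAt ℝ (fun x => f (x, ξ)) x := by
  have := (hf.contDiffAt (hO.mem_nhds h)).differentiableAt one_ne_zero
  exact this.comp x (differentiableAt_id.prodMk (differentiableAt_const ξ))

lemma IsPhaseData.affine [FiniteDimensional ℝ E] [FiniteDimensional ℝ F]
    (hEF : Module.finrank ℝ E = Module.finrank ℝ F + 1)
    {g : E → F → F} {H S : E × F → F →L[ℝ] F} {G : E × F → E}
    {O : Set (E × F)} (h : IsPhaseData g H S G O) (l : (F →L[ℝ] F) →L[ℝ] ℝ) {b r : ℝ} {ξ v : F}
    {X : ℝ → E} (hX : ∀ t ∈ Ioo (-r) r, DifferentiableAt ℝ X t)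
    (hXO : ∀ t ∈ Ioo (-r) r, (X t, ξ) ∈ O) (hl : ∀ t ∈ Ioo (-r) r, l (S (X t, ξ)) ≠ 0)
    (hg : ∀ t ∈ Ioo (-r) r, g (X t) ξ = v) (hT : ∀ t ∈ Ioo (-r) r, l (H (X t, ξ)) = t + b)
    {t : ℝ} (ht : t ∈ Ioo (-r) r) :
    H (X t, ξ) = H (X 0, ξ) + t • ((l (S (X 0, ξ)))⁻¹ • S (X 0, ξ)) := by
  refine affine_along_curve (H := fun x => H (x, ξ)) (S := fun x => S (x, ξ))
    (G := fun x => G (x, ξ)) l (b := b) (fun t ht => ?_)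
    (fun t ht => differentiableAt_left h.isOpen h.contDiffOn_H (hXO t ht))
    (fun t ht => h.fderiv_H _ (hXO t ht))
    (fun t ht => differentiableAt_left h.isOpen h.contDiffOn_S (hXO t ht))
    (fun t ht => h.fderiv_S _ (hXO t ht)) hl hT ht
  have hO := hXO t ht
  have hgd : DifferentiableAt ℝ (fun x => g x ξ) (X t) :=
    differentiableAt_left h.isOpen h.contDiffOn hO
  have hHd := differentiableAt_left h.isOpen h.contDiffOn_H hO
  have h0 : fderiv ℝ (fun x => g x ξ) (X t) (deriv X t) = 0 := by
    have h1 := hgd.hasFDerivAt.comp_hasDerivAt t (hX t ht).hasDerivAt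
    have h2 : HasDerivAt ((fun x => g x ξ) ∘ X) 0 t := by
      refine (hasDerivAt_const t v).congr_of_eventuallyEq ?_
      filter_upwards [isOpen_Ioo.mem_nhds ht] with u hu using hg u hu
    exact h1.unique h2
  obtain ⟨c, hc⟩ := exists_eq_smul_of_apply_eq_zero hEF
    (l := l.comp (fderiv ℝ (fun x => H (x, ξ)) (X t))) (h.surjective _ hO) (h.fderiv_apply_G _ hO)
    (by
      have := h.fderiv_H _ hO
      simp only at this
      rw [ContinuousLinearMap.comp_apply, this]
      exact hl t ht) h0
  exact ⟨c, hc ▸ (hX t ht).hasDerivAt⟩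

end Chart

section Chart

variable {E F V : Type*} [NormedAddCommGroup E] [NormedSpace ℝ E] [NormedAddCommGroup F]
  [NormedSpace ℝ F] [NormedAddCommGroup V] [NormedSpace ℝ V]

lemma exists_ball_prod_subset {E F : Type*} [PseudoMetricSpace E] [PseudoMetricSpace F] {xc : E} {ξc : F} {P : E × F → Prop} (h : ∀ᶠ p in 𝓝 (xc, ξc), P p) :
    ∃ r > 0, ∀ x ∈ ball xc r, ∀ ξ ∈ ball ξc r, P (x, ξ) := by
  obtain ⟨r, hr, hrs⟩ := Metric.mem_nhds_iff.1 h
  rw [← ball_prod_same] at hrs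
  exact ⟨r, hr, fun x hx ξ hξ => hrs ⟨hx, hξ⟩⟩

/-- Uniform injectivity is an open condition. -/
lemma norm_le_of_norm_sub_le {A A₀ : F →L[ℝ] V} {C : ℝ} (hC : 0 ≤ C)
    (h₀ : ∀ ω, ‖ω‖ ≤ C * ‖A₀ ω‖) (h : C * ‖A - A₀‖ ≤ 1 / 2) (ω : F) : ‖ω‖ ≤ 2 * C * ‖A ω‖ := by
  have h1 : ‖A₀ ω‖ ≤ ‖A ω‖ + ‖A - A₀‖ * ‖ω‖ := by
    have := norm_sub_norm_le (A₀ ω) (A ω)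
    have h2 := (A - A₀).le_opNorm ω
    rw [_root_.sub_apply, norm_sub_rev] at h2
    linarith
  have h3 := h₀ ω
  have h4 : C * ‖A₀ ω‖ ≤ C * (‖A ω‖ + ‖A - A₀‖ * ‖ω‖) := by gcongr
  have h5 : C * ‖A - A₀‖ * ‖ω‖ ≤ 1 / 2 * ‖ω‖ := by gcongr
  nlinarith

set_option maxHeartbeats 1000000 in
lemma IsPhaseData.exists_isChart [FiniteDimensional ℝ E] [FiniteDimensional ℝ F]
    (hEF : Module.finrank ℝ E = Module.finrank ℝ F + 1)
    {g : E → F → F} {H S : E × F → F →L[ℝ] F} {G : E × F → E}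
    {O : Set (E × F)} (h : IsPhaseData g H S G O) {xc : E} {ξc : F} (hc : (xc, ξc) ∈ O)
    (hinj : Function.Injective (S (xc, ξc))) (l : (F →L[ℝ] F) →L[ℝ] ℝ)
    (hl : l (S (xc, ξc)) ≠ 0) {x₀ : E} {r₀ : ℝ} (hr₀ : 0 < r₀) (hxc : xc ∈ closedBall x₀ r₀) :
    ∃ (T : E → F → ℝ) (w : F) (κ c lam₀ : ℝ) (K : ℕ), IsChart g x₀ r₀ xc ξc T w κ K c lam₀ := by
  have : CompleteSpace E := FiniteDimensional.complete ℝ E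
  have : CompleteSpace F := FiniteDimensional.complete ℝ F
  have hOn : O ∈ 𝓝 (xc, ξc) := h.isOpen.mem_nhds hc
  set b := l (H (xc, ξc)) with hb
  set T : E → F → ℝ := fun x ξ => l (H (x, ξ)) - b with hT
  set Ψ : E × F → F × ℝ := fun p => (g p.1 p.2, l (H p) - b) with hΨdef
  have hHc := h.contDiffOn_H.contDiffAt hOn
  have hΨ : ContDiffAt ℝ 1 Ψ (xc, ξc) := (h.contDiffOn.contDiffAt hOn).prodMk
    ((l.contDiff.contDiffAt.comp _ hHc).sub contDiffAt_const)
  have hgd : DifferentiableAt ℝ (fun x => g x ξc) xc := differentiableAt_left h.isOpen h.contDiffOn hc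
  have hHd := differentiableAt_left h.isOpen h.contDiffOn_H hc
  have hlG : (l.comp (fderiv ℝ (fun x => H (x, ξc)) xc)) (G (xc, ξc)) ≠ 0 := by
    have := h.fderiv_H _ hc
    simp only at this
    rw [ContinuousLinearMap.comp_apply, this]
    exact hl
  obtain ⟨D, hD⟩ := exists_equiv_prod hEF (h.surjective _ hc) (h.fderiv_apply_G _ hc) hlG
  have hDΨ : ∀ e, fderiv ℝ Ψ (xc, ξc) (e, 0) = D e := by
    intro e
    have h1 : HasFDerivAt (fun x : E => Ψ (x, ξc)) ((fderiv ℝ Ψ (xc, ξc)).comp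
        ((ContinuousLinearMap.id ℝ E).prod 0)) xc :=
      HasFDerivAt.comp (g := Ψ) (f := fun x : E => (x, ξc)) xc
        (hΨ.differentiableAt one_ne_zero).hasFDerivAt ((hasFDerivAt_id xc).prodMk (hasFDerivAt_const ξc xc))
    have h2 : HasFDerivAt (fun x : E => Ψ (x, ξc)) ((fderiv ℝ (fun x => g x ξc) xc).prod
        (l.comp (fderiv ℝ (fun x => H (x, ξc)) xc))) xc :=
      hgd.hasFDerivAt.prodMk ((l.hasFDerivAt.comp xc hHd.hasFDerivAt).sub_const b)
    have h3 := DFunLike.congr_fun (h1.unique h2) e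
    rw [hD]
    simpa using h3
  have hΨc : Ψ (xc, ξc) = (g xc ξc, 0) := by simp [hΨdef, hb]
  -- the constants
  set N : ℝ := ‖(D.symm : F × ℝ →L[ℝ] E)‖ with hNdef
  have hN0 : 0 ≤ N := norm_nonneg _
  have hN : ∀ y, ‖D.symm y‖ ≤ N * ‖y‖ := fun y => (D.symm : F × ℝ →L[ℝ] E).le_opNorm y
  set ε₁ : ℝ := 1 / (16 * (N + 1)) with hε₁
  have hε₁0 : 0 < ε₁ := by positivity
  have hNε : N * ε₁ ≤ 1 / 16 := by
    rw [hε₁, mul_one_div, div_le_div_iff₀ (by positivity) (by norm_num)]; linarith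
  set R : E × F → F →L[ℝ] F := fun p => (l (S p))⁻¹ • S p with hR
  have hSc := (h.contDiffOn_S.contDiffAt hOn).continuousAt
  have hlS : ContinuousAt (fun p => l (S p)) (xc, ξc) := l.continuous.continuousAt.comp hSc
  have hRc : ContinuousAt R (xc, ξc) := (hlS.inv₀ hl).smul hSc
  obtain ⟨CR, hCR0, hCR⟩ := (R (xc, ξc) : F →ₗ[ℝ] F).exists_antilipschitzWith (by
    rw [LinearMap.ker_eq_bot]
    intro u v huv
    simp only [ContinuousLinearMap.coe_coe, hR, _root_.smul_apply] at huv
    exact hinj ((smul_right_injective F (inv_ne_zero hl)) huv))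
  have hCRn : ∀ ω, ‖ω‖ ≤ (CR : ℝ) * ‖R (xc, ξc) ω‖ := by
    intro ω
    have := hCR.le_mul_dist ω 0
    simpa using this
  obtain ⟨ra, hra, happ⟩ := exists_norm_sub_sub_le hΨ (D := (D : E →L[ℝ] F × ℝ)) hDΨ hε₁0
  obtain ⟨LH, sH, hsH, hLH⟩ := hHc.exists_lipschitzOnWith
  obtain ⟨Lg, sg, hsg, hLg⟩ := (h.contDiffOn.contDiffAt hOn).exists_lipschitzOnWith
  have hRev : ∀ᶠ p in 𝓝 (xc, ξc), (CR : ℝ) * ‖R p - R (xc, ξc)‖ ≤ 1 / 2 := by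
    have : ContinuousAt (fun p => (CR : ℝ) * ‖R p - R (xc, ξc)‖) (xc, ξc) :=
      continuousAt_const.mul (hRc.sub continuousAt_const).norm
    exact this.eventually_le_const (by simp)
  have hRev2 : ∀ᶠ p in 𝓝 (xc, ξc), ‖R p‖ ≤ ‖R (xc, ξc)‖ + 1 :=
    (hRc.norm.eventually (gt_mem_nhds (lt_add_one _))).mono fun p hp => hp.le
  have hHev : ∀ᶠ p in 𝓝 (xc, ξc), ‖H p‖ ≤ ‖H (xc, ξc)‖ + 1 :=
    (hHc.continuousAt.norm.eventually (gt_mem_nhds (lt_add_one _))).mono fun p hp => hp.le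
  obtain ⟨rb, hrb, hbig⟩ := exists_ball_prod_subset ((Filter.eventually_of_mem hOn fun _ h => h).and
    ((Filter.eventually_of_mem hsH fun _ h => h).and ((Filter.eventually_of_mem hsg fun _ h => h).and
    (hRev.and (hRev2.and (hHev.and (hlS.eventually (isOpen_ne.mem_nhds hl))))))))
  set r := min ra rb with hr
  have hr0 : 0 < r := lt_min hra hrb
  have hba : ∀ {x}, x ∈ ball xc r → x ∈ ball xc ra := fun h =>
    ball_subset_ball (min_le_left _ _) h
  have hba' : ∀ {ξ}, ξ ∈ ball ξc r → ξ ∈ ball ξc ra := fun h =>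
    ball_subset_ball (min_le_left _ _) h
  replace hbig := fun x (hx : x ∈ ball xc r) ξ (hξ : ξ ∈ ball ξc r) =>
    hbig x (ball_subset_ball (min_le_right _ _) hx) ξ (ball_subset_ball (min_le_right _ _) hξ)
  have hHx : ∀ x ∈ ball xc r, ∀ x' ∈ ball xc r, ∀ ξ ∈ ball ξc r,
      ‖H (x, ξ) - H (x', ξ)‖ ≤ LH * ‖x - x'‖ := by
    intro x hx x' hx' ξ hξ
    have := hLH.norm_sub_le (hbig x hx ξ hξ).2.1 (hbig x' hx' ξ hξ).2.1
    simpa [Prod.norm_def] using this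
  have hHξ : ∀ x ∈ ball xc r, ∀ ξ ∈ ball ξc r, ∀ ξ' ∈ ball ξc r,
      ‖H (x, ξ) - H (x, ξ')‖ ≤ LH * ‖ξ - ξ'‖ := by
    intro x hx ξ hξ ξ' hξ'
    have := hLH.norm_sub_le (hbig x hx ξ hξ).2.1 (hbig x hx ξ' hξ').2.1
    simpa [Prod.norm_def] using this
  have hgξ : ∀ x ∈ ball xc r, ∀ ξ ∈ ball ξc r, ∀ ξ' ∈ ball ξc r,
      ‖g x ξ - g x ξ'‖ ≤ Lg * ‖ξ - ξ'‖ := by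
    intro x hx ξ hξ ξ' hξ'
    have := hLg.norm_sub_le (hbig x hx ξ hξ).2.2.1 (hbig x hx ξ' hξ').2.2.1
    simpa [Prod.norm_def] using this
  have hlip : ∀ x ∈ ball xc r, ∀ x' ∈ ball xc r, ∀ ξ ∈ ball ξc r,
      ‖Ψ (x', ξ) - Ψ (x, ξ)‖ ≤ (‖(D : E →L[ℝ] F × ℝ)‖ + ε₁) * ‖x' - x‖ := by
    intro x hx x' hx' ξ hξ
    have h1 := happ x (hba hx) x' (hba hx') ξ (hba' hξ)
    have h2 := (D : E →L[ℝ] F × ℝ).le_opNorm (x' - x)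
    have h3 := norm_add_le (Ψ (x', ξ) - Ψ (x, ξ) - D (x' - x)) (D (x' - x))
    rw [sub_add_cancel] at h3
    refine h3.trans ?_
    rw [add_mul, add_comm]
    exact add_le_add h2 h1
  have hanti : ∀ x ∈ ball xc r, ∀ x' ∈ ball xc r, ∀ ξ ∈ ball ξc r,
      ‖x' - x‖ ≤ 2 * N * ‖Ψ (x', ξ) - Ψ (x, ξ)‖ := by
    intro x hx x' hx' ξ hξ
    have h1 := happ x (hba hx) x' (hba hx') ξ (hba' hξ)
    have h2 : x' - x = D.symm (Ψ (x', ξ) - Ψ (x, ξ) - (Ψ (x', ξ) - Ψ (x, ξ) - D (x' - x))) := by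
      rw [sub_sub_cancel, D.symm_apply_apply]
    have h3 : ‖x' - x‖ ≤ N * (‖Ψ (x', ξ) - Ψ (x, ξ)‖ + ε₁ * ‖x' - x‖) := by
      conv_lhs => rw [h2]
      refine (hN _).trans ?_
      gcongr
      exact (norm_sub_le _ _).trans (by gcongr; exact h1)
    have h4 : N * ε₁ * ‖x' - x‖ ≤ 1 / 16 * ‖x' - x‖ := by gcongr
    have h5 : 0 ≤ N * ‖Ψ (x', ξ) - Ψ (x, ξ)‖ := by positivity
    nlinarith
  obtain ⟨X, r₂, hr₂, hX⟩ := exists_param_localInverse hΨ hDΨ hr0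
  set r₃ := min r₂ (1 / 2) with hr₃
  have hr₃0 : 0 < r₃ := lt_min hr₂ (by norm_num)
  have hr₃2 : r₃ ≤ r₂ := min_le_left _ _
  obtain ⟨rc, hrc, hsmall⟩ := exists_ball_prod_subset (P := fun p => dist (Ψ p) (Ψ (xc, ξc)) < r₃ / 2)
    (hΨ.continuousAt (ball_mem_nhds _ (half_pos hr₃0)))
  set κ := min rc (min r (min (r₀ / 2) r₃)) with hκ
  have hκ0 : 0 < κ := lt_min hrc (lt_min hr0 (lt_min (half_pos hr₀) hr₃0))
  have hκr : κ ≤ r := (min_le_right _ _).trans (min_le_left _ _)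
  have hκr₀ : κ ≤ r₀ / 2 := (min_le_right _ _).trans ((min_le_right _ _).trans (min_le_left _ _))
  have hκr₃ : κ ≤ r₃ := (min_le_right _ _).trans ((min_le_right _ _).trans (min_le_right _ _))
  have hxr : ∀ {x}, x ∈ ball xc κ → x ∈ ball xc r := fun h => ball_subset_ball hκr h
  have hξr : ∀ {ξ}, ξ ∈ ball ξc κ → ξ ∈ ball ξc r := fun h => ball_subset_ball hκr h
  replace hsmall : ∀ x ∈ ball xc κ, ∀ ξ ∈ ball ξc κ,
      dist (g x ξ) (g xc ξc) < r₃ / 2 ∧ |T x ξ| < r₃ / 2 := by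
    intro x hx ξ hξ
    have := hsmall x (ball_subset_ball (min_le_left _ _) hx) ξ
      (ball_subset_ball (min_le_left _ _) hξ)
    rw [hΨc, Prod.dist_eq, max_lt_iff, Real.dist_eq, sub_zero] at this
    exact this
  set e := x₀ - xc with he
  set c : ℝ := min (1 / 2) (r₀ / (16 * (N + 1) * (1 + Lg))) with hcdef
  have hc0 : 0 < c := by positivity
  have hc2 : c ≤ 1 / 2 := min_le_left _ _
  have hcN : N * ((1 + Lg) * c) ≤ r₀ / 16 := by
    have h1 : c ≤ r₀ / (16 * (N + 1) * (1 + Lg)) := min_le_right _ _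
    rw [le_div_iff₀ (by positivity)] at h1
    have : 0 ≤ c * (1 + Lg) := by positivity
    nlinarith
  set lam₀ : ℝ := min 1 (r₃ / (4 * (1 + ‖D e‖))) with hlam₀
  have hlam0 : 0 < lam₀ := by positivity
  set K : ℕ := ⌈1 + (‖(D : E →L[ℝ] F × ℝ)‖ + ε₁) + 2 * N + Lg + (‖R (xc, ξc)‖ + 1) +
    (‖H (xc, ξc)‖ + 1) + 2 * CR + (LH + LH * (2 * N) * Lg + LH * (2 * N)) + 2 * r₀⌉₊ with hK
  have hKle := Nat.le_ceil (1 + (‖(D : E →L[ℝ] F × ℝ)‖ + ε₁) + 2 * N + Lg + (‖R (xc, ξc)‖ + 1) +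
    (‖H (xc, ξc)‖ + 1) + 2 * CR + (LH + LH * (2 * N) * Lg + LH * (2 * N)) + 2 * r₀)
  rw [← hK] at hKle
  have p1 : 0 ≤ ‖(D : E →L[ℝ] F × ℝ)‖ := norm_nonneg _
  have p2 : 0 ≤ ‖R (xc, ξc)‖ := norm_nonneg _
  have p3 : 0 ≤ ‖H (xc, ξc)‖ := norm_nonneg _
  have p4 : 0 ≤ (CR : ℝ) := CR.2
  have p5 : 0 ≤ (Lg : ℝ) := Lg.2
  have p6 : 0 ≤ (LH : ℝ) * (2 * N) * Lg := by positivity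
  have p7 : 0 ≤ (LH : ℝ) * (2 * N) := by positivity
  have p8 : 0 ≤ (LH : ℝ) := LH.2
  have p9 : 2 * (CR : ℝ) ≤ K := by linarith
  have p10 : (LH + LH * (2 * N) * Lg + LH * (2 * N)) ≤ (K : ℝ) := by linarith
  have p11 : 2 * r₀ ≤ (K : ℝ) := by linarith
  clear_value K
  refine ⟨T, (D e).1, κ, c, lam₀, K, ⟨hκ0, by linarith, hc0, hlam0, ?_, ?_, ?_, ?_, ?_, ?_, ?_⟩⟩
  · intro x hx ξ hξ
    have := (hsmall x hx ξ hξ).2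
    have h2 : r₃ ≤ 1 / 2 := min_le_right _ _
    linarith
  · intro x hx x' hx' ξ hξ
    have := hlip x' (hxr hx') x (hxr hx) ξ (hξr hξ)
    rw [← dist_eq_norm, ← dist_eq_norm] at this
    refine ((le_max_left _ _).trans this).trans ?_
    gcongr
    linarith
  · intro x hx x' hx' ξ hξ
    have := hlip x' (hxr hx') x (hxr hx) ξ (hξr hξ)
    rw [← dist_eq_norm, ← dist_eq_norm] at this
    refine ((le_max_right _ _).trans this).trans ?_
    gcongr
    linarith
  · intro x hx x' hx' ξ hξ
    have := hanti x' (hxr hx') x (hxr hx) ξ (hξr hξ)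
    rw [← dist_eq_norm, ← dist_eq_norm] at this
    refine this.trans ?_
    rw [Prod.dist_eq]
    gcongr
    linarith
  · intro x hx ξ hξ ξ' hξ'
    rw [dist_eq_norm, dist_eq_norm]
    refine (hgξ x (hxr hx) ξ (hξr hξ) ξ' (hξr hξ')).trans ?_
    gcongr
    linarith
  · intro x' hx' ξ' hξ'
    set v := g x' ξ' with hv
    have hξ₂ : ξ' ∈ ball ξc r₂ := ball_subset_ball (hκr₃.trans hr₃2) hξ'
    have hy : ∀ t ∈ Ioo (-r₃) r₃, ((v, t) : F × ℝ) ∈ ball (Ψ (xc, ξc)) r₂ := by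
      intro t ht
      rw [mem_ball, hΨc, Prod.dist_eq, max_lt_iff, Real.dist_eq, sub_zero]
      exact ⟨by linarith [(hsmall x' hx' ξ' hξ').1], by
        rw [abs_lt]; constructor <;> linarith [ht.1, ht.2]⟩
    set Z : ℝ → E := fun t => X ((v, t), ξ') with hZ
    have hZ' := fun t ht => hX (v, t) (hy t ht) ξ' hξ₂
    have hZd : ∀ t ∈ Ioo (-r₃) r₃, DifferentiableAt ℝ Z t := fun t ht =>
      DifferentiableAt.comp (g := X) (f := fun t : ℝ => ((v, t), ξ')) t (hZ' t ht).2.2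
        (by fun_prop)
    have hZg : ∀ t ∈ Ioo (-r₃) r₃, g (Z t) ξ' = v := fun t ht =>
      congrArg Prod.fst (hZ' t ht).2.1
    have hZT : ∀ t ∈ Ioo (-r₃) r₃, T (Z t) ξ' = t := fun t ht =>
      congrArg Prod.snd (hZ' t ht).2.1
    have h0 : (0 : ℝ) ∈ Ioo (-r₃) r₃ := ⟨by linarith, hr₃0⟩
    have haff := fun t ht => h.affine hEF l (b := b) hZd
      (fun t ht => (hbig _ (hZ' t ht).1 ξ' (hξr hξ')).1)
      (fun t ht => (hbig _ (hZ' t ht).1 ξ' (hξr hξ')).2.2.2.2.2.2) hZg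
      (fun t ht => by linarith [hZT t ht, show T (Z t) ξ' = l (H (Z t, ξ')) - b from rfl])
      (t := t) ht
    obtain ⟨-, -, -, hb4, hb5, hb6, -⟩ := hbig _ (hZ' 0 h0).1 ξ' (hξr hξ')
    refine ⟨R (Z 0, ξ'), H (Z 0, ξ'), by linarith, by linarith, fun ω => ?_, ?_⟩
    · refine (norm_le_of_norm_sub_le CR.2 hCRn hb4 ω).trans ?_
      exact mul_le_mul_of_nonneg_right p9 (norm_nonneg _)
    intro x hx ξ hξ
    have ht : T x ξ' ∈ Ioo (-r₃) r₃ := by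
      have := abs_lt.1 (hsmall x hx ξ' hξ').2
      constructor <;> linarith [this.1, this.2]
    rw [← haff _ ht]
    set y := Z (T x ξ') with hy
    have e1 : ‖g x ξ - g x ξ' - H (x, ξ') (ξ - ξ')‖ ≤ LH * ‖ξ - ξ'‖ ^ 2 :=
      norm_sub_sub_le_of_lipschitz (f := g x) (f' := fun ξ => H (x, ξ)) (convex_ball ξc κ) LH.2
        (fun η hη => h.hasFDerivAt _ (hbig x (hxr hx) η (hξr hη)).1)
        (fun η hη η' hη' => hHξ x (hxr hx) η (hξr hη) η' (hξr hη')) hξ' hξ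
    have e2 : ‖y - x‖ ≤ 2 * N * ‖g x ξ' - v‖ := by
      have := hanti x (hxr hx) y (hZ' _ ht).1 ξ' (hξr hξ')
      have h2 : Ψ (y, ξ') - Ψ (x, ξ') = (v - g x ξ', 0) := by
        ext1
        · exact congrArg (· - g x ξ') (hZg _ ht)
        · exact sub_eq_zero.2 (hZT _ ht)
      rw [h2, Prod.norm_mk, norm_zero, max_eq_left (norm_nonneg _), norm_sub_rev v] at this
      exact this
    have e3 : ‖g x ξ' - v‖ ≤ ‖g x ξ - v‖ + Lg * ‖ξ - ξ'‖ := by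
      have := hgξ x (hxr hx) ξ (hξr hξ) ξ' (hξr hξ')
      have h2 := norm_sub_le (g x ξ - v) (g x ξ - g x ξ')
      rw [sub_sub_sub_cancel_left] at h2
      linarith
    have e4 : ‖(H (y, ξ') - H (x, ξ')) (ξ - ξ')‖ ≤
        LH * (2 * N * (‖g x ξ - v‖ + Lg * ‖ξ - ξ'‖)) * ‖ξ - ξ'‖ := by
      refine (ContinuousLinearMap.le_opNorm _ _).trans ?_
      gcongr
      refine (hHx y (hZ' _ ht).1 x (hxr hx) ξ' (hξr hξ')).trans ?_
      gcongr
      refine e2.trans ?_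
      gcongr
    have e5 : g x ξ' - v + H (y, ξ') (ξ - ξ') - (g x ξ - v) =
        (H (y, ξ') - H (x, ξ')) (ξ - ξ') - (g x ξ - g x ξ' - H (x, ξ') (ξ - ξ')) := by
      rw [_root_.sub_apply]; abel
    rw [e5]
    refine (norm_sub_le _ _).trans ((add_le_add e4 e1).trans ?_)
    set u := ‖ξ - ξ'‖ with hu
    set z := ‖g x ξ - v‖ with hz
    have hu0 : 0 ≤ u := norm_nonneg _
    have hz0 : 0 ≤ z := norm_nonneg _
    have huz : z * u ≤ u ^ 2 + z ^ 2 := by nlinarith [sq_nonneg (u - z)]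
    have e6 : (LH : ℝ) * (2 * N) * (z * u) ≤ LH * (2 * N) * (u ^ 2 + z ^ 2) := by gcongr
    have e7 : (LH + LH * (2 * N) * Lg + LH * (2 * N)) * (u ^ 2 + z ^ 2) ≤
        K * (u ^ 2 + z ^ 2) := by
      gcongr
    have e8 : 0 ≤ (LH + LH * (2 * N) * Lg) * z ^ 2 := by positivity
    linarith
  · intro x hx ξ hξ ξ' hξ' v lam hlam hlamle h1 h2
    have hlam1 : lam ≤ 1 := hlamle.trans (min_le_left _ _)
    have hlam2 : lam * (4 * (1 + ‖D e‖)) ≤ r₃ := by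
      rw [← le_div_iff₀ (by positivity)]
      exact hlamle.trans (min_le_right _ _)
    have hDe := norm_nonneg (D e)
    have hlD : 0 ≤ lam * ‖D e‖ := by positivity
    have hcl : c * lam ≤ 1 / 2 * lam := by gcongr
    have hξ₂ : ξ' ∈ ball ξc r₂ := ball_subset_ball (hκr₃.trans hr₃2) hξ'
    have hn1 : ‖lam • (D e).1‖ ≤ lam * ‖D e‖ := by
      rw [norm_smul, Real.norm_of_nonneg hlam.le]
      gcongr
      exact le_max_left _ _
    have hn2 : |lam * (D e).2| ≤ lam * ‖D e‖ := by
      rw [abs_mul, abs_of_nonneg hlam.le]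
      gcongr
      exact le_max_right _ _
    have hmem : ((v + lam • (D e).1, T x ξ' + lam * (D e).2) : F × ℝ) ∈
        ball (Ψ (xc, ξc)) r₂ := by
      rw [mem_ball, hΨc, Prod.dist_eq, max_lt_iff, Real.dist_eq, sub_zero]
      constructor
      · have h3 : dist (v + lam • (D e).1) v ≤ lam * ‖D e‖ := by simpa using hn1
        have h4 := dist_triangle4 (v + lam • (D e).1) v (g x ξ) (g xc ξc)
        have h5 := (hsmall x hx.1 ξ hξ).1
        rw [dist_comm v] at h4
        linarith
      · have h3 := abs_add_le (T x ξ') (lam * (D e).2)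
        have h5 := (hsmall x hx.1 ξ' hξ').2
        linarith
    obtain ⟨hX1, hX2, -⟩ := hX _ hmem ξ' hξ₂
    set x' := X ((v + lam • (D e).1, T x ξ' + lam * (D e).2), ξ') with hx'
    have hdiff : Ψ (x', ξ') - Ψ (x, ξ') = (v - g x ξ', 0) + lam • D e := by
      rw [hX2]
      ext1
      · change v + lam • (D e).1 - g x ξ' = v - g x ξ' + lam • (D e).1
        abel
      · change T x ξ' + lam * (D e).2 - T x ξ' = 0 + lam * (D e).2
        ring
    have hvb : ‖v - g x ξ'‖ ≤ (1 + Lg) * (c * lam) := by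
      have h3 := hgξ x (hxr hx.1) ξ (hξr hξ) ξ' (hξr hξ')
      have h4 : (Lg : ℝ) * ‖ξ - ξ'‖ ≤ Lg * (c * lam) := by
        rw [← dist_eq_norm]; gcongr
      rw [dist_eq_norm, norm_sub_rev] at h2
      have h5 := norm_add_le (v - g x ξ) (g x ξ - g x ξ')
      rw [sub_add_sub_cancel] at h5
      linarith
    have hfin := exists_shift_of_linearization (Ψ := fun x => Ψ (x, ξ')) D hN hN0 hNε
      (happ x (hba (hxr hx.1)) x' (hba hX1) ξ' (hba' (hξr hξ'))) hx.2 hxc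
      ((mem_ball.1 hx.1).le.trans hκr₀) hlam hlam1 (b := (v - g x ξ', 0)) (by
        rw [Prod.norm_mk, norm_zero, max_eq_left (norm_nonneg _)]
        calc N * ‖v - g x ξ'‖ ≤ N * ((1 + Lg) * (c * lam)) := by gcongr
          _ = N * ((1 + Lg) * c) * lam := by ring
          _ ≤ _ := by gcongr) hdiff
    refine ⟨x', hfin.1, congrArg Prod.fst hX2, hfin.2.trans ?_⟩
    gcongr

end Chart

section PhaseData

variable {E F V : Type*} [NormedAddCommGroup E] [NormedSpace ℝ E] [NormedAddCommGroup F]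
  [NormedSpace ℝ F] [NormedAddCommGroup V] [NormedSpace ℝ V]

lemma fderiv_right_eq {u : E × F → V} {p : E × F} (hu : DifferentiableAt ℝ u p) :
    fderiv ℝ (fun ξ => u (p.1, ξ)) p.2 = (fderiv ℝ u p).comp (ContinuousLinearMap.inr ℝ E F) :=
  (HasFDerivAt.comp (g := u) (f := fun ξ => (p.1, ξ)) p.2 hu.hasFDerivAt
    (hasFDerivAt_prodMk_right p.1 p.2)).fderiv

lemma fderiv_left_eq {u : E × F → V} {p : E × F} (hu : DifferentiableAt ℝ u p) :
    fderiv ℝ (fun x => u (x, p.2)) p.1 = (fderiv ℝ u p).comp (ContinuousLinearMap.inl ℝ E F) :=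
  (HasFDerivAt.comp (g := u) (f := fun x => (x, p.2)) p.1 hu.hasFDerivAt
    (hasFDerivAt_prodMk_left p.1 p.2)).fderiv

lemma ContDiffOn.fderiv_right_param {u : E × F → V} {O : Set (E × F)} (hO : IsOpen O)
    (hu : ContDiffOn ℝ (⊤ : ℕ∞) u O) :
    ContDiffOn ℝ (⊤ : ℕ∞) (fun p : E × F => fderiv ℝ (fun ξ => u (p.1, ξ)) p.2) O := by
  refine ((hu.fderiv_of_isOpen hO (m := (⊤ : ℕ∞)) (by simp)).clm_comp
    (contDiffOn_const (c := ContinuousLinearMap.inr ℝ E F))).congr fun p hp => ?_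
  exact fderiv_right_eq ((hu.contDiffAt (hO.mem_nhds hp)).differentiableAt (by simp))

lemma ContDiffOn.fderiv_left_param {u : E × F → V} {O : Set (E × F)} (hO : IsOpen O)
    (hu : ContDiffOn ℝ (⊤ : ℕ∞) u O) :
    ContDiffOn ℝ (⊤ : ℕ∞) (fun p : E × F => fderiv ℝ (fun x => u (x, p.2)) p.1) O := by
  refine ((hu.fderiv_of_isOpen hO (m := (⊤ : ℕ∞)) (by simp)).clm_comp
    (contDiffOn_const (c := ContinuousLinearMap.inl ℝ E F))).congr fun p hp => ?_
  exact fderiv_left_eq ((hu.contDiffAt (hO.mem_nhds hp)).differentiableAt (by simp))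

lemma differentiableAt_right_of_contDiffOn {u : E × F → V} {O : Set (E × F)} (hO : IsOpen O)
    (hu : ContDiffOn ℝ (⊤ : ℕ∞) u O) {p : E × F} (hp : p ∈ O) :
    DifferentiableAt ℝ (fun ξ => u (p.1, ξ)) p.2 :=
  DifferentiableAt.comp (g := u) (f := fun ξ => (p.1, ξ)) p.2
    ((hu.contDiffAt (hO.mem_nhds hp)).differentiableAt (by simp)) (by fun_prop)

lemma differentiableAt_left_of_contDiffOn {u : E × F → V} {O : Set (E × F)} (hO : IsOpen O)
    (hu : ContDiffOn ℝ (⊤ : ℕ∞) u O) {p : E × F} (hp : p ∈ O) :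
    DifferentiableAt ℝ (fun x => u (x, p.2)) p.1 :=
  DifferentiableAt.comp (g := u) (f := fun x => (x, p.2)) p.1
    ((hu.contDiffAt (hO.mem_nhds hp)).differentiableAt (by simp)) (by fun_prop)

lemma ContDiffOn.matrix_det {ι : Type*} [Fintype ι] [DecidableEq ι] {N : E → Matrix ι ι ℝ}
    {O : Set E} {n : WithTop ℕ∞} (h : ∀ a b, ContDiffOn ℝ n (fun p => N p a b) O) :
    ContDiffOn ℝ n (fun p => (N p).det) O := by
  simp only [Matrix.det_apply]
  exact ContDiffOn.sum fun σ _ => (contDiffOn_prod fun i _ => h _ _).const_smul _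

lemma apply_eq_sum_single {d : ℕ} (L : (Fin d → ℝ) →L[ℝ] V) (ω : Fin d → ℝ) :
    L ω = ∑ j, ω j • L (Pi.single j 1) := by
  rw [← ContinuousLinearMap.coe_coe, LinearMap.pi_apply_eq_sum_univ]
  refine Finset.sum_congr rfl fun j _ => ?_
  congr 2
  ext i
  simp [Pi.single_apply, eq_comm]

variable {d : ℕ} {φ : (Fin (d + 1) → ℝ) → (Fin d → ℝ) → ℝ} {M : Set (Fin (d + 1) → ℝ)}
  {Ω : Set (Fin d → ℝ)}

/-- `∇_ξ φ`, with values in `Fin d → ℝ`. -/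
noncomputable def phaseGrad (φ : (Fin (d + 1) → ℝ) → (Fin d → ℝ) → ℝ) (x : Fin (d + 1) → ℝ) (ξ : Fin d → ℝ) :
    Fin d → ℝ := gradXi (d + 1) φ x ξ

/-- `∇_ξ² φ` as a linear map. -/
noncomputable def phaseHess (φ : (Fin (d + 1) → ℝ) → (Fin d → ℝ) → ℝ) (p : (Fin (d + 1) → ℝ) × (Fin d → ℝ)) :
    (Fin d → ℝ) →L[ℝ] (Fin d → ℝ) := fderiv ℝ (fun ξ => phaseGrad φ p.1 ξ) p.2

/-- `(G · ∇_x) ∇_ξ² φ` as a linear map. -/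
noncomputable def phaseGDHess (φ : (Fin (d + 1) → ℝ) → (Fin d → ℝ) → ℝ)
    (p : (Fin (d + 1) → ℝ) × (Fin d → ℝ)) : (Fin d → ℝ) →L[ℝ] (Fin d → ℝ) :=
  fderiv ℝ (fun x => phaseHess φ (x, p.2)) p.1 (gaussMap (d + 1) φ p.1 p.2)

lemma contDiffOn_phaseGrad (hM : IsOpen M) (hΩ : IsOpen Ω)
    (hφ : ContDiffOn ℝ (⊤ : ℕ∞) (fun q : (Fin (d + 1) → ℝ) × (Fin d → ℝ) => φ q.1 q.2) (M ×ˢ Ω)) :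
    ContDiffOn ℝ (⊤ : ℕ∞) (fun q : (Fin (d + 1) → ℝ) × (Fin d → ℝ) => phaseGrad φ q.1 q.2)
      (M ×ˢ Ω) := by
  refine contDiffOn_pi.2 fun j => ?_
  exact (ContDiffOn.fderiv_right_param (hM.prod hΩ) hφ).clm_apply contDiffOn_const

lemma contDiffOn_phaseHess (hM : IsOpen M) (hΩ : IsOpen Ω)
    (hφ : ContDiffOn ℝ (⊤ : ℕ∞) (fun q : (Fin (d + 1) → ℝ) × (Fin d → ℝ) => φ q.1 q.2) (M ×ˢ Ω)) :
    ContDiffOn ℝ (⊤ : ℕ∞) (phaseHess φ) (M ×ˢ Ω) :=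
  ContDiffOn.fderiv_right_param (hM.prod hΩ) (contDiffOn_phaseGrad hM hΩ hφ)

lemma mixedHess_eq (hM : IsOpen M) (hΩ : IsOpen Ω)
    (hφ : ContDiffOn ℝ (⊤ : ℕ∞) (fun q : (Fin (d + 1) → ℝ) × (Fin d → ℝ) => φ q.1 q.2) (M ×ˢ Ω))
    {p : (Fin (d + 1) → ℝ) × (Fin d → ℝ)} (hp : p ∈ M ×ˢ Ω) (i : Fin (d + 1)) (j : Fin d) :
    mixedHess (d + 1) φ p.1 p.2 i j =
      fderiv ℝ (fun x => phaseGrad φ x p.2) p.1 (Pi.single i 1) j := by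
  have h := differentiableAt_left_of_contDiffOn (hM.prod hΩ) (contDiffOn_phaseGrad hM hΩ hφ) hp
  rw [fderiv_pi (fun j => differentiableAt_pi.1 h j)]
  rfl

lemma contDiffOn_gaussMap (hM : IsOpen M) (hΩ : IsOpen Ω)
    (hφ : ContDiffOn ℝ (⊤ : ℕ∞) (fun q : (Fin (d + 1) → ℝ) × (Fin d → ℝ) => φ q.1 q.2) (M ×ˢ Ω)) :
    ContDiffOn ℝ (⊤ : ℕ∞) (fun q : (Fin (d + 1) → ℝ) × (Fin d → ℝ) =>
      gaussMap (d + 1) φ q.1 q.2) (M ×ˢ Ω) := by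
  refine contDiffOn_pi.2 fun i => ?_
  unfold gaussMap
  refine ContDiffOn.matrix_det fun a b => ?_
  simp only [Matrix.of_apply]
  split_ifs with h
  · have h1 := (ContDiffOn.fderiv_left_param (hM.prod hΩ) (contDiffOn_phaseGrad hM hΩ hφ)).clm_apply
      (contDiffOn_const (c := Pi.single a (1 : ℝ)))
    refine (contDiffOn_pi.1 h1 ⟨b, h⟩).congr fun p hp => ?_
    exact mixedHess_eq hM hΩ hφ hp a ⟨b, h⟩
  · exact contDiffOn_const

lemma sum_mul_gaussMap (x : Fin (d + 1) → ℝ) (ξ : Fin d → ℝ) (w : Fin (d + 1) → ℝ) :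
    ∑ i, w i * gaussMap (d + 1) φ x ξ i = Matrix.det (Matrix.of fun a b : Fin (d + 1) =>
      if h : (b : ℕ) < d + 1 - 1 then mixedHess (d + 1) φ x ξ a ⟨(b : ℕ), h⟩ else w a) := by
  set N : Matrix (Fin (d + 1)) (Fin (d + 1)) ℝ := Matrix.of fun a b : Fin (d + 1) =>
      if h : (b : ℕ) < d + 1 - 1 then mixedHess (d + 1) φ x ξ a ⟨(b : ℕ), h⟩ else 0 with hN
  have key : ∀ v : Fin (d + 1) → ℝ, (Matrix.of fun a b : Fin (d + 1) =>
      if h : (b : ℕ) < d + 1 - 1 then mixedHess (d + 1) φ x ξ a ⟨(b : ℕ), h⟩ else v a) =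
      N.updateCol (Fin.last d) v := by
    intro v
    ext a b
    rw [Matrix.updateCol_apply]
    by_cases hb : b = Fin.last d
    · subst hb; simp
    · have : (b : ℕ) < d + 1 - 1 := by
        have := b.2
        have h2 : (b : ℕ) ≠ d := fun h => hb (Fin.ext h)
        omega
      rw [if_neg hb, hN, Matrix.of_apply, Matrix.of_apply, dif_pos this, dif_pos this]
  rw [key, ← Matrix.cramer_apply]
  unfold gaussMap
  simp only [key, ← Matrix.cramer_apply]
  conv_rhs => rw [pi_eq_sum_univ w]
  rw [map_sum, Finset.sum_apply]
  refine Finset.sum_congr rfl fun i _ => ?_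
  have hi : (Pi.single i 1 : Fin (d + 1) → ℝ) = fun j => if i = j then 1 else 0 := by
    ext j
    simp [Pi.single_apply, eq_comm]
  rw [map_smul, Pi.smul_apply, smul_eq_mul, hi]

lemma fderiv_phaseGrad_apply (hM : IsOpen M) (hΩ : IsOpen Ω)
    (hφ : ContDiffOn ℝ (⊤ : ℕ∞) (fun q : (Fin (d + 1) → ℝ) × (Fin d → ℝ) => φ q.1 q.2) (M ×ˢ Ω))
    {p : (Fin (d + 1) → ℝ) × (Fin d → ℝ)} (hp : p ∈ M ×ˢ Ω) (e : Fin (d + 1) → ℝ) (j : Fin d) :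
    fderiv ℝ (fun x => phaseGrad φ x p.2) p.1 e j =
      ∑ i, mixedHess (d + 1) φ p.1 p.2 i j * e i := by
  rw [apply_eq_sum_single, Finset.sum_apply]
  refine Finset.sum_congr rfl fun i _ => ?_
  rw [mixedHess_eq hM hΩ hφ hp, Pi.smul_apply, smul_eq_mul, mul_comm]

lemma fderiv_phaseGrad_gaussMap (hM : IsOpen M) (hΩ : IsOpen Ω)
    (hφ : ContDiffOn ℝ (⊤ : ℕ∞) (fun q : (Fin (d + 1) → ℝ) × (Fin d → ℝ) => φ q.1 q.2) (M ×ˢ Ω))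
    {p : (Fin (d + 1) → ℝ) × (Fin d → ℝ)} (hp : p ∈ M ×ˢ Ω) :
    fderiv ℝ (fun x => phaseGrad φ x p.2) p.1 (gaussMap (d + 1) φ p.1 p.2) = 0 := by
  ext j
  rw [fderiv_phaseGrad_apply hM hΩ hφ hp, sum_mul_gaussMap, Pi.zero_apply]
  refine Matrix.det_zero_of_column_eq (i := Fin.castSucc j) (j := Fin.last d)
    (Fin.castSucc_lt_last j).ne fun k => ?_
  simp

lemma surjective_fderiv_phaseGrad (hM : IsOpen M) (hΩ : IsOpen Ω)
    (hφ : ContDiffOn ℝ (⊤ : ℕ∞) (fun q : (Fin (d + 1) → ℝ) × (Fin d → ℝ) => φ q.1 q.2) (M ×ˢ Ω))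
    {p : (Fin (d + 1) → ℝ) × (Fin d → ℝ)} (hp : p ∈ M ×ˢ Ω)
    (hr : (mixedHess (d + 1) φ p.1 p.2).rank = d) :
    Function.Surjective (fderiv ℝ (fun x => phaseGrad φ x p.2) p.1) := by
  have h1 : ∀ e, fderiv ℝ (fun x => phaseGrad φ x p.2) p.1 e =
      (mixedHess (d + 1) φ p.1 p.2).transpose.mulVecLin e := by
    intro e
    ext j
    rw [fderiv_phaseGrad_apply hM hΩ hφ hp]
    rfl
  rw [← Matrix.rank_transpose, Matrix.rank] at hr
  have h2 : (mixedHess (d + 1) φ p.1 p.2).transpose.mulVecLin.range = ⊤ := by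
    apply Submodule.eq_top_of_finrank_eq
    rw [hr]; simp
  intro f
  obtain ⟨e, he⟩ := LinearMap.range_eq_top.1 h2 f
  exact ⟨e, (h1 e).trans he⟩

end PhaseData

section PhaseData

variable {d : ℕ} {φ : (Fin (d + 1) → ℝ) → (Fin d → ℝ) → ℝ} {M : Set (Fin (d + 1) → ℝ)}
  {Ω : Set (Fin d → ℝ)}

lemma contDiffOn_phaseGDHess (hM : IsOpen M) (hΩ : IsOpen Ω)
    (hφ : ContDiffOn ℝ (⊤ : ℕ∞) (fun q : (Fin (d + 1) → ℝ) × (Fin d → ℝ) => φ q.1 q.2) (M ×ˢ Ω)) :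
    ContDiffOn ℝ (⊤ : ℕ∞) (phaseGDHess φ) (M ×ˢ Ω) :=
  (ContDiffOn.fderiv_left_param (hM.prod hΩ) (contDiffOn_phaseHess hM hΩ hφ)).clm_apply
    (contDiffOn_gaussMap hM hΩ hφ)

lemma hessXi_eq (hM : IsOpen M) (hΩ : IsOpen Ω)
    (hφ : ContDiffOn ℝ (⊤ : ℕ∞) (fun q : (Fin (d + 1) → ℝ) × (Fin d → ℝ) => φ q.1 q.2) (M ×ˢ Ω))
    {p : (Fin (d + 1) → ℝ) × (Fin d → ℝ)} (hp : p ∈ M ×ˢ Ω) (i j : Fin d) :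
    hessXi (d + 1) φ p.1 p.2 i j = phaseHess φ p (Pi.single j 1) i := by
  have h := differentiableAt_right_of_contDiffOn (hM.prod hΩ) (contDiffOn_phaseGrad hM hΩ hφ) hp
  unfold phaseHess
  rw [fderiv_pi (fun j => differentiableAt_pi.1 h j)]
  rfl

lemma fderiv_clm_apply_apply {E : Type*} [NormedAddCommGroup E] [NormedSpace ℝ E]
    {L : E → (Fin d → ℝ) →L[ℝ] (Fin d → ℝ)} {x : E} (hL : DifferentiableAt ℝ L x)
    (w : Fin d → ℝ) (i : Fin d) (e : E) :
    fderiv ℝ (fun x => L x w i) x e = fderiv ℝ L x e w i := by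
  have h := (((ContinuousLinearMap.proj (R := ℝ) (φ := fun _ : Fin d => ℝ) i).comp
    (ContinuousLinearMap.apply ℝ (Fin d → ℝ) w)).hasFDerivAt (x := L x)).comp x hL.hasFDerivAt
  exact congrArg (fun l => l e) h.fderiv

lemma GDhess_eq (hM : IsOpen M) (hΩ : IsOpen Ω)
    (hφ : ContDiffOn ℝ (⊤ : ℕ∞) (fun q : (Fin (d + 1) → ℝ) × (Fin d → ℝ) => φ q.1 q.2) (M ×ˢ Ω))
    {p : (Fin (d + 1) → ℝ) × (Fin d → ℝ)} (hp : p ∈ M ×ˢ Ω) (i j : Fin d) :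
    GDhess (d + 1) φ p.1 p.2 i j = phaseGDHess φ p (Pi.single j 1) i := by
  have h := differentiableAt_left_of_contDiffOn (hM.prod hΩ) (contDiffOn_phaseHess hM hΩ hφ) hp
  unfold phaseGDHess
  rw [← fderiv_clm_apply_apply h]
  have he : (fun y => hessXi (d + 1) φ y p.2 i j) =ᶠ[𝓝 p.1]
      fun x => phaseHess φ (x, p.2) (Pi.single j 1) i := by
    filter_upwards [hM.mem_nhds hp.1] with y hy
    exact hessXi_eq hM hΩ hφ (p := (y, p.2)) ⟨hy, hp.2⟩ i j
  exact congrArg (fun l : (Fin (d + 1) → ℝ) →L[ℝ] ℝ => l (gaussMap (d + 1) φ p.1 p.2)) he.fderiv_eq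

lemma GD2hess_eq (hM : IsOpen M) (hΩ : IsOpen Ω)
    (hφ : ContDiffOn ℝ (⊤ : ℕ∞) (fun q : (Fin (d + 1) → ℝ) × (Fin d → ℝ) => φ q.1 q.2) (M ×ˢ Ω))
    {p : (Fin (d + 1) → ℝ) × (Fin d → ℝ)} (hp : p ∈ M ×ˢ Ω) (i j : Fin d) :
    GD2hess (d + 1) φ p.1 p.2 i j = fderiv ℝ (fun x => phaseGDHess φ (x, p.2)) p.1
      (gaussMap (d + 1) φ p.1 p.2) (Pi.single j 1) i := by
  have h := differentiableAt_left_of_contDiffOn (hM.prod hΩ) (contDiffOn_phaseGDHess hM hΩ hφ) hp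
  rw [← fderiv_clm_apply_apply h]
  have he : (fun y => GDhess (d + 1) φ y p.2 i j) =ᶠ[𝓝 p.1]
      fun x => phaseGDHess φ (x, p.2) (Pi.single j 1) i := by
    filter_upwards [hM.mem_nhds hp.1] with y hy
    exact GDhess_eq hM hΩ hφ (p := (y, p.2)) ⟨hy, hp.2⟩ i j
  exact congrArg (fun l : (Fin (d + 1) → ℝ) →L[ℝ] ℝ => l (gaussMap (d + 1) φ p.1 p.2)) he.fderiv_eq

lemma isPhaseData_of_isHormander (hM : IsOpen M) (hΩ : IsOpen Ω)
    (hφ : IsHormander (d + 1) φ M Ω) (hB : BourgainCond (d + 1) φ M Ω) :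
    IsPhaseData (phaseGrad φ) (phaseHess φ) (phaseGDHess φ)
      (fun p => gaussMap (d + 1) φ p.1 p.2) (M ×ˢ Ω) := by
  obtain ⟨hs, hr, -⟩ := hφ
  obtain ⟨lam, hlam⟩ := hB
  refine ⟨hM.prod hΩ, (contDiffOn_phaseGrad hM hΩ hs).of_le (by simp),
    (contDiffOn_phaseHess hM hΩ hs).of_le (by simp),
    (contDiffOn_phaseGDHess hM hΩ hs).of_le (by simp), fun p hp => ?_, fun p hp =>
    fderiv_phaseGrad_gaussMap hM hΩ hs hp, fun p hp =>
    surjective_fderiv_phaseGrad hM hΩ hs hp (hr p.1 hp.1 p.2 hp.2), fun p hp => rfl,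
    fun p hp => ⟨lam p.1 p.2, ?_⟩⟩
  · exact (differentiableAt_right_of_contDiffOn (hM.prod hΩ)
      (contDiffOn_phaseGrad hM hΩ hs) hp).hasFDerivAt
  · ext ω i
    rw [apply_eq_sum_single, apply_eq_sum_single (lam p.1 p.2 • phaseGDHess φ p)]
    simp only [Finset.sum_apply, Pi.smul_apply]
    refine Finset.sum_congr rfl fun j _ => ?_
    rw [← GD2hess_eq hM hΩ hs hp, hlam p.1 hp.1 p.2 hp.2, Matrix.smul_apply,
      GDhess_eq hM hΩ hs hp]
    rfl

lemma injective_phaseGDHess (hM : IsOpen M) (hΩ : IsOpen Ω)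
    (hφ : IsHormander (d + 1) φ M Ω) {p : (Fin (d + 1) → ℝ) × (Fin d → ℝ)} (hp : p ∈ M ×ˢ Ω) :
    Function.Injective (phaseGDHess φ p) := by
  obtain ⟨hs, -, hd⟩ := hφ
  have h1 : ∀ ω, phaseGDHess φ p ω = (GDhess (d + 1) φ p.1 p.2).mulVec ω := by
    intro ω
    ext i
    rw [apply_eq_sum_single, Finset.sum_apply]
    refine Finset.sum_congr rfl fun j _ => ?_
    rw [Pi.smul_apply, smul_eq_mul, mul_comm, ← GDhess_eq hM hΩ hs hp]
  have h2 := Matrix.mulVec_injective_of_isUnit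
    ((Matrix.isUnit_iff_isUnit_det _).2 (hd p.1 hp.1 p.2 hp.2).isUnit)
  intro a b hab
  exact h2 (by rw [← h1 a, ← h1 b, hab])

lemma exists_isChart_phaseGrad (hM : IsOpen M) (hΩ : IsOpen Ω) (hd : 0 < d)
    (hφ : IsHormander (d + 1) φ M Ω) (hB : BourgainCond (d + 1) φ M Ω)
    {x₀ xc : Fin (d + 1) → ℝ} {r₀ : ℝ} (hr₀ : 0 < r₀) (hM₀ : closedBall x₀ r₀ ⊆ M)
    {ξc : Fin d → ℝ} (hxc : xc ∈ closedBall x₀ r₀) (hξc : ξc ∈ Ω) :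
    ∃ (T : (Fin (d + 1) → ℝ) → (Fin d → ℝ) → ℝ) (w : Fin d → ℝ) (κ c lam₀ : ℝ) (K : ℕ),
      IsChart (phaseGrad φ) x₀ r₀ xc ξc T w κ K c lam₀ := by
  have hp : (xc, ξc) ∈ M ×ˢ Ω := ⟨hM₀ hxc, hξc⟩
  have hinj := injective_phaseGDHess hM hΩ hφ hp
  have hne : phaseGDHess φ (xc, ξc) (Pi.single ⟨0, hd⟩ 1) ≠ 0 := by
    intro h0
    have := hinj (h0.trans (map_zero _).symm)
    exact one_ne_zero ((by simp : (1 : ℝ) = (Pi.single ⟨0, hd⟩ 1 : Fin d → ℝ) ⟨0, hd⟩).trans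
      (congrFun this _))
  obtain ⟨i, hi⟩ := Function.ne_iff.1 hne
  exact (isPhaseData_of_isHormander hM hΩ hφ hB).exists_isChart (by simp) hp hinj
    ((ContinuousLinearMap.proj (R := ℝ) (φ := fun _ : Fin d => ℝ) i).comp
      (ContinuousLinearMap.apply ℝ (Fin d → ℝ) (Pi.single ⟨0, hd⟩ 1))) hi hr₀ hxc

end PhaseData

section Rescale

variable {F : Type*} [NormedAddCommGroup F] [NormedSpace ℝ F]

/-- The affine map of parameter space sending `q` to `0` and acting on the directions by `A`,
after the shear `B`. -/
def rescale (A B : F →L[ℝ] F) (r : ℝ) (q p : F × F) : F × F :=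
  (r • A (p.1 - q.1), r • (p.2 - q.2 - B (p.1 - q.1)))

variable {A B : F →L[ℝ] F} {r K : ℝ}

lemma dist_rescale_fst (hr : 0 ≤ r) (q a b : F × F) :
    dist (rescale A B r q a).1 (rescale A B r q b).1 = r * ‖A (a.1 - b.1)‖ := by
  simp only [rescale, dist_eq_norm]
  rw [← smul_sub, ← map_sub, norm_smul, Real.norm_of_nonneg hr]
  congr 3
  abel

lemma dist_rescale_snd (hr : 0 ≤ r) (q a b : F × F) :
    dist (rescale A B r q a).2 (rescale A B r q b).2 = r * ‖a.2 - b.2 - B (a.1 - b.1)‖ := by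
  simp only [rescale, dist_eq_norm]
  rw [← smul_sub, norm_smul, Real.norm_of_nonneg hr]
  congr 2
  have : a.1 - b.1 = (a.1 - q.1) - (b.1 - q.1) := by abel
  rw [this, map_sub B (a.1 - q.1)]
  abel

lemma dist_rescale_fst_le (hr : 0 ≤ r) (hA : ‖A‖ ≤ K) (q a b : F × F) :
    dist (rescale A B r q a).1 (rescale A B r q b).1 ≤ r * (K * dist a b) := by
  rw [dist_rescale_fst hr]
  gcongr
  have h1 : ‖a.1 - b.1‖ ≤ dist a b := by rw [← dist_eq_norm]; exact le_max_left _ _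
  exact (A.le_opNorm _).trans (mul_le_mul hA h1 (norm_nonneg _) ((norm_nonneg _).trans hA))

lemma dist_rescale_snd_le (hr : 0 ≤ r) (hB : ‖B‖ ≤ K) (q a b : F × F) :
    dist (rescale A B r q a).2 (rescale A B r q b).2 ≤ r * ((1 + K) * dist a b) := by
  rw [dist_rescale_snd hr]
  gcongr
  have h1 : ‖a.1 - b.1‖ ≤ dist a b := by rw [← dist_eq_norm]; exact le_max_left _ _
  have h2 : ‖a.2 - b.2‖ ≤ dist a b := by rw [← dist_eq_norm]; exact le_max_right _ _
  have h3 := (B.le_opNorm (a.1 - b.1)).trans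
    (mul_le_mul hB h1 (norm_nonneg _) ((norm_nonneg _).trans hB))
  linarith [norm_sub_le (a.2 - b.2) (B (a.1 - b.1))]

lemma dist_rescale_le (hr : 0 ≤ r) (hK : 1 ≤ K) (hA : ‖A‖ ≤ K) (hB : ‖B‖ ≤ K) (q a b : F × F) :
    dist (rescale A B r q a) (rescale A B r q b) ≤ r * (2 * K * dist a b) := by
  refine max_le ((dist_rescale_fst_le hr hA q a b).trans ?_)
    ((dist_rescale_snd_le hr hB q a b).trans ?_)
  all_goals gcongr; linarith

lemma dist_fst_le_of_rescale (hr : 0 < r) (hA : ∀ ω, ‖ω‖ ≤ K * ‖A ω‖) (q a b : F × F) :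
    r * dist a.1 b.1 ≤ K * dist (rescale A B r q a).1 (rescale A B r q b).1 := by
  rw [dist_rescale_fst hr.le, dist_eq_norm]
  nlinarith [hA (a.1 - b.1)]

lemma dist_le_of_rescale (hr : 0 < r) (hK : 1 ≤ K) (hA : ∀ ω, ‖ω‖ ≤ K * ‖A ω‖) (hB : ‖B‖ ≤ K)
    (q a b : F × F) :
    r * dist a b ≤ 2 * K ^ 2 * dist (rescale A B r q a) (rescale A B r q b) := by
  set D := dist (rescale A B r q a) (rescale A B r q b) with hD
  have h1 : r * dist a.1 b.1 ≤ K * D :=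
    (dist_fst_le_of_rescale hr hA q a b).trans (by gcongr; exact le_max_left _ _)
  have h2 : r * ‖a.2 - b.2 - B (a.1 - b.1)‖ ≤ D := by
    rw [← dist_rescale_snd hr.le q]; exact le_max_right _ _
  have h3 : ‖B (a.1 - b.1)‖ ≤ K * dist a.1 b.1 := by
    rw [dist_eq_norm]
    exact (B.le_opNorm _).trans (by gcongr)
  have h4 : dist a.2 b.2 ≤ ‖a.2 - b.2 - B (a.1 - b.1)‖ + ‖B (a.1 - b.1)‖ := by
    rw [dist_eq_norm]
    simpa using norm_add_le (a.2 - b.2 - B (a.1 - b.1)) (B (a.1 - b.1))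
  have hD0 : 0 ≤ D := dist_nonneg
  have h5 : r * dist a.2 b.2 ≤ D + K * (K * D) := by
    nlinarith
  rw [Prod.dist_eq, mul_max_of_nonneg _ _ hr.le]
  have h6 : K * D ≤ K ^ 2 * D := by gcongr; nlinarith
  have h7 : 1 * D ≤ K ^ 2 * D := by gcongr; nlinarith
  refine max_le ?_ ?_ <;> nlinarith

end Rescale

section Straighten

/-- The closed `δ`-neighbourhood of the curve `{x ∈ U | g x p.1 = p.2}`. -/
def curveTube {E F : Type*} [PseudoMetricSpace E] (g : E → F → F) (U : Set E) (δ : ℝ)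
    (p : F × F) : Set E :=
  {y | ∃ x ∈ U, g x p.1 = p.2 ∧ dist y x ≤ δ}

variable {d : ℕ}

/-- `∇_ξ` of the restriction phase. -/
def restGrad (z : Fin (d + 1) → ℝ) (ξ : Fin d → ℝ) : Fin d → ℝ :=
  fun j => z j.castSucc + z (Fin.last d) * ξ j

lemma restGrad_snoc (v ξ : Fin d → ℝ) (t : ℝ) :
    restGrad (Fin.snoc (v - t • ξ) t) ξ = v := by
  ext j
  simp [restGrad]

lemma norm_snoc_le {v : Fin d → ℝ} {t a : ℝ} (hv : ‖v‖ ≤ a) (ht : |t| ≤ a) :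
    ‖(Fin.snoc v t : Fin (d + 1) → ℝ)‖ ≤ a := by
  rw [pi_norm_le_iff_of_nonneg ((norm_nonneg _).trans hv)]
  intro i
  refine Fin.lastCases ?_ (fun j => ?_) i
  · simpa using ht
  · simpa using (norm_le_pi_norm v j).trans hv

variable {g : (Fin (d + 1) → ℝ) → (Fin d → ℝ) → (Fin d → ℝ)} {x₀ xc : Fin (d + 1) → ℝ}
  {r₀ κ K c lam₀ : ℝ} {ξc w : Fin d → ℝ} {T : (Fin (d + 1) → ℝ) → (Fin d → ℝ) → ℝ}

lemma IsChart.snoc_mem_curveTube (h : IsChart g x₀ r₀ xc ξc T w κ K c lam₀)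
    {x' : Fin (d + 1) → ℝ} {ξ' : Fin d → ℝ} (hξ' : ξ' ∈ ball ξc κ)
    {A B : (Fin d → ℝ) →L[ℝ] (Fin d → ℝ)} (hA : ‖A‖ ≤ K) (hB : ‖B‖ ≤ K)
    (hs : ∀ x ∈ ball xc κ, ∀ ξ ∈ ball ξc κ,
      ‖g x ξ' - g x' ξ' + (B + T x ξ' • A) (ξ - ξ') - (g x ξ - g x' ξ')‖ ≤
        K * (‖ξ - ξ'‖ ^ 2 + ‖g x ξ - g x' ξ'‖ ^ 2))
    {s : ℝ} (hs0 : 0 < s) (hs1 : s ≤ 1) {x y : Fin (d + 1) → ℝ} (hx : x ∈ ball xc κ)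
    (hy : y ∈ ball xc κ) {ξ : Fin d → ℝ} (hξ : ξ ∈ ball ξc κ) (hyx : dist y x ≤ s ^ 2)
    (hd : dist (ξ, g x ξ) (ξ', g x' ξ') ≤ s) :
    (Fin.snoc ((1 / (4 * K ^ 2 * s)) • (g y ξ' - g x' ξ')) (T y ξ') : Fin (d + 1) → ℝ) ∈
      curveTube restGrad (closedBall 0 1) s
        (rescale A B (1 / (4 * K ^ 2 * s)) (ξ', g x' ξ') (ξ, g x ξ)) := by
  have hK := h.one_le_K
  have hK2 : K ≤ K ^ 2 := by nlinarith
  set r := 1 / (4 * K ^ 2 * s) with hr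
  have hr0 : 0 < r := by positivity
  have hrs : r * s = 1 / (4 * K ^ 2) := by rw [hr]; field_simp
  have hrK : r * s * K ^ 2 = 1 / 4 := by rw [hrs]; field_simp
  set Λ := rescale A B r (ξ', g x' ξ') (ξ, g x ξ) with hΛ
  have hself : rescale A B r (ξ', g x' ξ') (ξ', g x' ξ') = 0 := by simp [rescale]
  have hd1 : ‖ξ - ξ'‖ ≤ s := by
    rw [← dist_eq_norm]; exact (le_max_left _ _).trans hd
  have hd2 : ‖g x ξ - g x' ξ'‖ ≤ s := by
    rw [← dist_eq_norm]; exact (le_max_right _ _).trans hd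
  have hΛ1 : ‖Λ.1‖ ≤ r * (K * s) := by
    have := dist_rescale_fst_le (B := B) hr0.le hA (ξ', g x' ξ') (ξ, g x ξ) (ξ', g x' ξ')
    rw [hself] at this
    simp only [Prod.fst_zero, dist_zero_right] at this
    exact this.trans (by gcongr)
  have hΛ2 : ‖Λ.2‖ ≤ r * ((1 + K) * s) := by
    have := dist_rescale_snd_le (A := A) hr0.le hB (ξ', g x' ξ') (ξ, g x ξ) (ξ', g x' ξ')
    rw [hself] at this
    simp only [Prod.snd_zero, dist_zero_right] at this
    exact this.trans (by gcongr)
  have hrs0 : 0 < r * s := by positivity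
  have hrsK : r * s * K ≤ 1 / 4 := by rw [← hrK]; gcongr
  have hrs1 : r * s * 1 ≤ 1 / 4 := by rw [← hrK]; gcongr; nlinarith
  have hT := h.abs_T_le y hy ξ' hξ'
  refine ⟨Fin.snoc (Λ.2 - T y ξ' • Λ.1) (T y ξ'), ?_, restGrad_snoc _ _ _, ?_⟩
  · rw [mem_closedBall, dist_zero_right]
    refine norm_snoc_le ?_ (by linarith)
    have h1 : ‖T y ξ' • Λ.1‖ ≤ 1 / 2 * (r * (K * s)) := by
      rw [norm_smul, Real.norm_eq_abs]; gcongr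
    linarith [norm_sub_le Λ.2 (T y ξ' • Λ.1)]
  · rw [dist_snoc, dist_self]
    refine max_le ?_ hs0.le
    have h1 := hs x hx ξ hξ
    have h2 : ‖g y ξ' - g x ξ'‖ ≤ K * s ^ 2 := by
      rw [← dist_eq_norm]
      exact (h.dist_le y hy x hx ξ' hξ').trans (by gcongr)
    have h3 : |T y ξ' - T x ξ'| ≤ K * s ^ 2 := by
      rw [← Real.dist_eq]
      exact (h.dist_T_le y hy x hx ξ' hξ').trans (by gcongr)
    have h4 : ‖A (ξ - ξ')‖ ≤ K * s := (A.le_opNorm _).trans (by gcongr)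
    have e : r • (g y ξ' - g x' ξ') - (Λ.2 - T y ξ' • Λ.1) =
        r • ((g y ξ' - g x ξ') + (g x ξ' - g x' ξ' + (B + T x ξ' • A) (ξ - ξ') -
          (g x ξ - g x' ξ')) + (T y ξ' - T x ξ') • A (ξ - ξ')) := by
      simp only [hΛ, rescale, _root_.add_apply, _root_.smul_apply]
      module
    rw [dist_eq_norm, e, norm_smul, Real.norm_of_nonneg hr0.le]
    have h5 : ‖(T y ξ' - T x ξ') • A (ξ - ξ')‖ ≤ (K * s ^ 2) * (K * s) := by
      rw [norm_smul, Real.norm_eq_abs]; gcongr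
    have h6 := norm_add₃_le (a := g y ξ' - g x ξ') (b := g x ξ' - g x' ξ' +
      (B + T x ξ' • A) (ξ - ξ') - (g x ξ - g x' ξ')) (c := (T y ξ' - T x ξ') • A (ξ - ξ'))
    have h7 : K * (‖ξ - ξ'‖ ^ 2 + ‖g x ξ - g x' ξ'‖ ^ 2) ≤ K * (s ^ 2 + s ^ 2) := by gcongr
    have h8 : (K * s ^ 2) * (K * s) ≤ K ^ 2 * s ^ 2 := by
      have : (K * s ^ 2) * (K * s) = K ^ 2 * s ^ 2 * s := by ring
      rw [this]
      exact mul_le_of_le_one_right (by positivity) hs1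
    have h9 : K * s ^ 2 ≤ K ^ 2 * s ^ 2 := by gcongr
    calc _ ≤ r * (4 * (K ^ 2 * s ^ 2)) := by gcongr; linarith
      _ = 4 * (r * s * K ^ 2) * s := by ring
      _ = s := by rw [hrK]; ring

end Straighten

section Cluster

/-- The assertion `SK′` for the curves `{x ∈ U | g x ξ = v}`. -/
def CurveSK {n d : ℕ} (g : (Fin n → ℝ) → (Fin d → ℝ) → (Fin d → ℝ)) (U : Set (Fin n → ℝ))
    (S : Set (Fin d → ℝ)) (ε η δ : ℝ) : Prop :=
  ∀ P : Finset ((Fin d → ℝ) × (Fin d → ℝ)),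
    (∀ p ∈ P, p ∈ S ×ˢ ((fun q : (Fin n → ℝ) × (Fin d → ℝ) => g q.1 q.2) '' (U ×ˢ S))) →
    (∀ p ∈ P, ∀ q ∈ P, p ≠ q → δ ≤ dist p q) →
    (∀ ρ ∈ Set.Icc δ 1, ∃ Q : Finset ((Fin d → ℝ) × (Fin d → ℝ)),
      (∀ q ∈ Q, q ∈ S ×ˢ ((fun q : (Fin n → ℝ) × (Fin d → ℝ) => g q.1 q.2) '' (U ×ˢ S))) ∧
      (∀ p ∈ P, Metric.ball p δ ⊆ ⋃ q ∈ Q, Metric.ball q ρ) ∧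
      FewParallel Q ρ (δ ^ (-η))) →
    ∀ Y : ((Fin d → ℝ) × (Fin d → ℝ)) → Set (Fin n → ℝ),
      (∀ p ∈ P, MeasurableSet (Y p) ∧ Y p ⊆ curveTube g U δ p) →
      ENNReal.ofReal (δ ^ η) ≤ ∑ p ∈ P, volume (Y p) →
      ENNReal.ofReal (δ ^ ε) ≤ volume (⋃ p ∈ P, Y p)

variable {d : ℕ}

variable {g : (Fin (d + 1) → ℝ) → (Fin d → ℝ) → (Fin d → ℝ)} {x₀ xc : Fin (d + 1) → ℝ}
  {r₀ κ K c lam₀ : ℝ} {ξc w : Fin d → ℝ} {T : (Fin (d + 1) → ℝ) → (Fin d → ℝ) → ℝ}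

lemma IsChart.le_dist_snoc (h : IsChart g x₀ r₀ xc ξc T w κ K c lam₀) {ξ : Fin d → ℝ}
    (hξ : ξ ∈ ball ξc κ) (v : Fin d → ℝ) {x y : Fin (d + 1) → ℝ} (hx : x ∈ ball xc κ)
    (hy : y ∈ ball xc κ) :
    dist x y ≤ K * dist (Fin.snoc (g x ξ - v) (T x ξ) : Fin (d + 1) → ℝ)
      (Fin.snoc (g y ξ - v) (T y ξ)) := by
  rw [dist_snoc, dist_sub_right]
  exact h.le_max x hx y hy ξ hξ

lemma IsChart.dist_snoc_le (h : IsChart g x₀ r₀ xc ξc T w κ K c lam₀) {ξ : Fin d → ℝ}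
    (hξ : ξ ∈ ball ξc κ) (v : Fin d → ℝ) {x y : Fin (d + 1) → ℝ} (hx : x ∈ ball xc κ)
    (hy : y ∈ ball xc κ) :
    dist (Fin.snoc (g x ξ - v) (T x ξ) : Fin (d + 1) → ℝ)
      (Fin.snoc (g y ξ - v) (T y ξ)) ≤ K * dist x y := by
  rw [dist_snoc, dist_sub_right]
  exact max_le (h.dist_le x hx y hy ξ hξ) (h.dist_T_le x hx y hy ξ hξ)

lemma IsChart.volume_le_image (h : IsChart g x₀ r₀ xc ξc T w κ K c lam₀) {ξ : Fin d → ℝ}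
    (hξ : ξ ∈ ball ξc κ) (v : Fin d → ℝ) {R : ℝ} (hR : 0 < R) {S : Set (Fin (d + 1) → ℝ)}
    (hS : S ⊆ ball xc κ) :
    volume S ≤ ENNReal.ofReal (K ^ (d + 1) * R ^ d) *
      volume ((fun x => (Fin.snoc ((1 / R) • (g x ξ - v)) (T x ξ) : Fin (d + 1) → ℝ)) '' S) := by
  have hK := h.one_le_K
  rw [volume_image_snoc_smul (by positivity) (fun x => g x ξ - v), ← mul_assoc,
    ← ENNReal.ofReal_mul (by positivity)]
  have : K ^ (d + 1) * R ^ d * (1 / R) ^ d = K ^ (d + 1) := by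
    rw [mul_assoc, ← mul_pow, mul_one_div_cancel hR.ne', one_pow, mul_one]
  rw [this]
  exact volume_le_of_dist_le (by positivity)
    fun x hx y hy => h.le_dist_snoc hξ v (hS hx) (hS hy)

lemma IsChart.volume_image_le (h : IsChart g x₀ r₀ xc ξc T w κ K c lam₀) {ξ : Fin d → ℝ}
    (hξ : ξ ∈ ball ξc κ) (v : Fin d → ℝ) {R : ℝ} (hR : 0 < R) {S : Set (Fin (d + 1) → ℝ)}
    (hS : S ⊆ ball xc κ) :
    volume ((fun x => (Fin.snoc ((1 / R) • (g x ξ - v)) (T x ξ) : Fin (d + 1) → ℝ)) '' S) ≤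
      ENNReal.ofReal (K ^ (d + 1) / R ^ d) * volume S := by
  have hK := h.one_le_K
  rw [volume_image_snoc_smul (by positivity) (fun x => g x ξ - v)]
  have : K ^ (d + 1) / R ^ d = (1 / R) ^ d * K ^ (d + 1) := by
    rw [one_div_pow]; ring
  rw [this, ENNReal.ofReal_mul (by positivity), mul_assoc]
  gcongr
  exact volume_image_le_of_dist_le (by positivity)
    fun x hx y hy => h.dist_snoc_le hξ v (hS hx) (hS hy)

lemma IsChart.measurableSet_image (h : IsChart g x₀ r₀ xc ξc T w κ K c lam₀) {ξ : Fin d → ℝ}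
    (hξ : ξ ∈ ball ξc κ) (v : Fin d → ℝ) {R : ℝ} (hR : 0 < R) {S : Set (Fin (d + 1) → ℝ)}
    (hS : S ⊆ ball xc κ) (hSm : MeasurableSet S) :
    MeasurableSet
      ((fun x => (Fin.snoc ((1 / R) • (g x ξ - v)) (T x ξ) : Fin (d + 1) → ℝ)) '' S) := by
  have hg : ContinuousOn (fun x => g x ξ) S :=
    (LipschitzOnWith.of_dist_le_mul (K := K.toNNReal) fun x hx y hy => by
      rw [Real.coe_toNNReal _ (zero_le_one.trans h.one_le_K)]
      exact h.dist_le x (hS hx) y (hS hy) ξ hξ).continuousOn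
  have hT : ContinuousOn (fun x => T x ξ) S :=
    (LipschitzOnWith.of_dist_le_mul (K := K.toNNReal) fun x hx y hy => by
      rw [Real.coe_toNNReal _ (zero_le_one.trans h.one_le_K)]
      exact h.dist_T_le x (hS hx) y (hS hy) ξ hξ).continuousOn
  refine hSm.image_of_continuousOn_injOn (continuousOn_pi.2 fun i => ?_) fun x hx y hy hxy => ?_
  · refine Fin.lastCases ?_ (fun j => ?_) i
    · simpa using hT
    · simp only [Fin.snoc_castSucc]
      exact continuousOn_pi.1 ((hg.sub continuousOn_const).const_smul (1 / R)) j
  · obtain ⟨h1, h2⟩ := Fin.snoc_inj.1 hxy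
    have h3 : g x ξ = g y ξ := sub_left_injective
      (smul_right_injective _ (one_div_pos.2 hR).ne' h1)
    have := h.le_max x (hS hx) y (hS hy) ξ hξ
    rw [h3, h2, dist_self, dist_self, max_self, mul_zero] at this
    exact dist_le_zero.1 this

end Cluster

section Cluster

variable {d : ℕ}

lemma mem_image_restGrad {v : Fin d → ℝ} (hv : ‖v‖ ≤ 1) :
    v ∈ (fun q : (Fin (d + 1) → ℝ) × (Fin d → ℝ) => restGrad q.1 q.2) ''
      (closedBall 0 1 ×ˢ closedBall 0 1) := by
  refine ⟨(Fin.snoc v 0, 0), ⟨?_, by simp⟩, ?_⟩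
  · rw [mem_closedBall, dist_zero_right]
    exact norm_snoc_le hv (by simp)
  · simpa using restGrad_snoc v 0 0

variable {g : (Fin (d + 1) → ℝ) → (Fin d → ℝ) → (Fin d → ℝ)} {x₀ xc : Fin (d + 1) → ℝ}
  {r₀ κ c lam₀ : ℝ} {K : ℕ} {ξc w : Fin d → ℝ} {T : (Fin (d + 1) → ℝ) → (Fin d → ℝ) → ℝ}

theorem IsChart.le_volume_cluster (h : IsChart g x₀ r₀ xc ξc T w κ K c lam₀) {s : ℝ}
    (hs : 0 < s) (hs1 : s ≤ 1) (hsκ : s ^ 2 ≤ κ / 4) {x' : Fin (d + 1) → ℝ} (hx' : x' ∈ ball xc κ)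
    {ξ' : Fin d → ℝ} (hξ' : ξ' ∈ ball ξc κ) {b e N : ℝ}
    (hSK : CurveSK (restGrad (d := d)) (closedBall 0 1) (closedBall 0 1) b e s)
    {U : Set (Fin (d + 1) → ℝ)} {P : Finset ((Fin d → ℝ) × (Fin d → ℝ))}
    (hP : ∀ p ∈ P, dist p (ξ', g x' ξ') ≤ s) (hPξ : ∀ p ∈ P, p.1 ∈ ball ξc κ)
    (hsep : ∀ p ∈ P, ∀ q ∈ P, p ≠ q → 8 * (K : ℝ) ^ 4 * s ^ 2 ≤ dist p q)
    (hQ : ∀ ρ ∈ Icc (s ^ 2) s, ∃ Q, (∀ p ∈ P, ∃ q ∈ Q, dist p q < ρ) ∧ FewParallel Q ρ N)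
    (hN : (2 * ((4 * K ^ 3 + 2 : ℕ) : ℝ) + 3) ^ (3 * d) * N ≤ s ^ (-e))
    {Y : (Fin d → ℝ) × (Fin d → ℝ) → Set (Fin (d + 1) → ℝ)}
    (hY : ∀ p ∈ P, MeasurableSet (Y p) ∧ Y p ⊆ ball xc (3 * κ / 4) ∩ curveTube g U (s ^ 2) p)
    (hvol : ENNReal.ofReal ((K : ℝ) ^ (d + 1) * (4 * K ^ 2 * s) ^ d * s ^ e) ≤
      ∑ p ∈ P, volume (Y p)) :
    ENNReal.ofReal ((4 * (K : ℝ) ^ 2 * s) ^ d / K ^ (d + 1) * s ^ b) ≤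
      volume (⋃ p ∈ P, Y p) := by
  classical
  have hK := h.one_le_K
  have hK2 : (K : ℝ) ≤ (K : ℝ) ^ 2 := by nlinarith
  have hK3 : (K : ℝ) ^ 2 ≤ (K : ℝ) ^ 3 := by nlinarith [sq_nonneg (K : ℝ)]
  have hκ := h.κ_pos
  obtain ⟨A, B, hA, hB, hAi, hstr⟩ := h.straight x' hx' ξ' hξ'
  set R : ℝ := 4 * (K : ℝ) ^ 2 * s with hR
  have hR0 : 0 < R := by positivity
  set Λ := rescale A B (1 / R) (ξ', g x' ξ') with hΛ
  set Φ : (Fin (d + 1) → ℝ) → (Fin (d + 1) → ℝ) :=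
    fun x => Fin.snoc ((1 / R) • (g x ξ' - g x' ξ')) (T x ξ') with hΦ
  have hr0 : 0 < 1 / R := by positivity
  have hinj : Function.Injective Λ := by
    intro a a' haa
    have := dist_le_of_rescale hr0 hK hAi hB (ξ', g x' ξ') a a'
    rw [← hΛ, haa, dist_self, mul_zero] at this
    exact dist_le_zero.1 (nonpos_of_mul_nonpos_right this hr0)
  have hinv : ∀ p, Function.invFun Λ (Λ p) = p := Function.leftInverse_invFun hinj
  have hself : Λ (ξ', g x' ξ') = 0 := by simp [hΛ, rescale]
  have hrs : 1 / R * s = 1 / (4 * (K : ℝ) ^ 2) := by rw [hR]; field_simp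
  have hYs : ∀ p ∈ P, Y p ⊆ ball xc κ := fun p hp =>
    ((hY p hp).2.trans inter_subset_left).trans (ball_subset_ball (by linarith))
  have hball : ∀ p ∈ P, ‖Λ p‖ ≤ 1 := by
    intro p hp
    have h1 := dist_rescale_le hr0.le hK hA hB (ξ', g x' ξ') p (ξ', g x' ξ')
    rw [← hΛ, hself, dist_zero_right] at h1
    refine h1.trans ?_
    calc 1 / R * (2 * K * dist p (ξ', g x' ξ')) ≤ 1 / R * (2 * K * s) := by
          gcongr; exact hP p hp
      _ = 1 / R * s * (2 * K) := by ring
      _ = (2 * K) / (4 * (K : ℝ) ^ 2) := by rw [hrs]; ring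
      _ ≤ 1 := by rw [div_le_one (by positivity)]; linarith
  have hmem : ∀ p ∈ P, Λ p ∈ (closedBall 0 1 : Set (Fin d → ℝ)) ×ˢ
      ((fun q : (Fin (d + 1) → ℝ) × (Fin d → ℝ) => restGrad q.1 q.2) ''
      (closedBall 0 1 ×ˢ closedBall 0 1)) := by
    intro p hp
    refine ⟨?_, mem_image_restGrad ((norm_snd_le _).trans (hball p hp))⟩
    rw [mem_closedBall, dist_zero_right]
    exact (norm_fst_le _).trans (hball p hp)
  have hsepΛ : ∀ a ∈ P.image Λ, ∀ a' ∈ P.image Λ, a ≠ a' → s ≤ dist a a' := by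
    intro a ha a' ha' hne
    obtain ⟨p, hp, rfl⟩ := Finset.mem_image.1 ha
    obtain ⟨q, hq, rfl⟩ := Finset.mem_image.1 ha'
    have h1 := hsep p hp q hq fun hpq => hne (by rw [hpq])
    have h2 := dist_le_of_rescale hr0 hK hAi hB (ξ', g x' ξ') p q
    rw [← hΛ] at h2
    have h3 : 1 / R * (8 * (K : ℝ) ^ 4 * s ^ 2) = 2 * (K : ℝ) ^ 2 * s := by
      rw [hR]; field_simp; norm_num
    have h4 : 1 / R * (8 * (K : ℝ) ^ 4 * s ^ 2) ≤ 1 / R * dist p q := by gcongr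
    rw [h3] at h4
    exact le_of_mul_le_mul_left (h4.trans h2) (by positivity)
  have key := hSK (P.image Λ) (Finset.forall_mem_image.2 hmem) hsepΛ ?_
    (fun a => Φ '' Y (Function.invFun Λ a)) ?_ ?_
  · rw [Finset.set_biUnion_finset_image] at key
    simp only [hinv] at key
    rw [← image_iUnion₂] at key
    have h1 := key.trans (h.volume_image_le hξ' (g x' ξ') hR0 (S := ⋃ p ∈ P, Y p)
      (iUnion₂_subset hYs))
    calc _ = ENNReal.ofReal (R ^ d / K ^ (d + 1)) * ENNReal.ofReal (s ^ b) :=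
          ENNReal.ofReal_mul (by positivity)
      _ ≤ ENNReal.ofReal (R ^ d / K ^ (d + 1)) *
          (ENNReal.ofReal (K ^ (d + 1) / R ^ d) * volume (⋃ p ∈ P, Y p)) := by gcongr
      _ = volume (⋃ p ∈ P, Y p) := by
          rw [← mul_assoc, ← ENNReal.ofReal_mul (by positivity)]
          have : R ^ d / (K : ℝ) ^ (d + 1) * (K ^ (d + 1) / R ^ d) = 1 := by field_simp
          rw [this, ENNReal.ofReal_one, one_mul]
  · intro ρ hρ
    obtain ⟨Q, hQ1, hQ2⟩ := hQ (s * ρ) ⟨by nlinarith [hρ.1], by nlinarith [hρ.2]⟩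
    have hρ0 : 0 < ρ := hs.trans_le hρ.1
    choose! f hf hfd using hQ1
    have hcover := exists_cover_fewParallel hQ2 (by positivity) hs hρ.1
      (4 * K ^ 3 + 2) hsepΛ (fun a => f (Function.invFun Λ a)) ?_ ?_ ?_
    · obtain ⟨R', hR', hcov, hfew⟩ := hcover
      refine ⟨R', fun q hq => ?_, hcov, fun S hS hS' => (hfew S hS hS').trans hN⟩
      obtain ⟨p, hp, rfl⟩ := Finset.mem_image.1 (hR' hq)
      exact hmem p hp
    · intro a ha
      obtain ⟨p, hp, rfl⟩ := Finset.mem_image.1 ha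
      rw [hinv]; exact hf p hp
    · intro a ha a' ha' haa
      obtain ⟨p, hp, rfl⟩ := Finset.mem_image.1 ha
      obtain ⟨q, hq, rfl⟩ := Finset.mem_image.1 ha'
      simp only [hinv]
      have h1 := dist_fst_le_of_rescale (B := B) hr0 hAi (ξ', g x' ξ') p q
      rw [← hΛ] at h1
      have h2 : dist p.1 q.1 ≤ 4 * (K : ℝ) ^ 3 * (s * ρ) := by
        have h3 : 1 / R * dist p.1 q.1 ≤ 1 / R * (4 * (K : ℝ) ^ 3 * (s * ρ)) := by
          refine h1.trans ?_
          have : 1 / R * (4 * (K : ℝ) ^ 3 * (s * ρ)) = K * ρ := by rw [hR]; field_simp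
          rw [this]; gcongr
        exact le_of_mul_le_mul_left h3 hr0
      have h4 : dist (f p).1 p.1 ≤ s * ρ := by
        rw [dist_comm]; exact (le_max_left _ _).trans (hfd p hp).le
      have h5 : dist q.1 (f q).1 ≤ s * ρ := (le_max_left _ _).trans (hfd q hq).le
      push_cast
      linarith [dist_triangle4 (f p).1 p.1 q.1 (f q).1]
    · intro a ha a' ha' haa
      obtain ⟨p, hp, rfl⟩ := Finset.mem_image.1 ha
      obtain ⟨q, hq, rfl⟩ := Finset.mem_image.1 ha'
      simp only [hinv] at haa
      have h1 := dist_rescale_le hr0.le hK hA hB (ξ', g x' ξ') p q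
      rw [← hΛ] at h1
      have h2 : dist p q ≤ 2 * (s * ρ) := by
        have h4 := hfd p hp
        have h5 := hfd q hq
        rw [← haa, dist_comm] at h5
        linarith [dist_triangle p (f p) q]
      refine h1.trans ?_
      have h3 : 1 / R * (2 * K * dist p q) ≤ 1 / R * (2 * K * (2 * (s * ρ))) := by gcongr
      have h4 : 1 / R * (2 * K * (2 * (s * ρ))) = ρ / K := by rw [hR]; field_simp; norm_num
      rw [h4] at h3
      refine h3.trans ?_
      have h5 : ρ / (K : ℝ) ≤ ρ := div_le_self hρ0.le hK
      push_cast
      nlinarith [pow_nonneg (zero_le_one.trans hK) 3]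
  · intro a ha
    obtain ⟨p, hp, rfl⟩ := Finset.mem_image.1 ha
    simp only [hinv]
    refine ⟨h.measurableSet_image hξ' _ hR0 (hYs p hp) (hY p hp).1, ?_⟩
    rintro _ ⟨y, hy, rfl⟩
    have hyκ := hYs p hp hy
    obtain ⟨hyb, x, hx, hgx, hyx⟩ := (hY p hp).2 hy
    have hxκ : x ∈ ball xc κ := by
      rw [mem_ball] at hyb ⊢
      rw [dist_comm] at hyx
      linarith [dist_triangle x y xc]
    have hpe : p = (p.1, g x p.1) := by rw [hgx]
    have hd := hP p hp
    rw [hpe] at hd ⊢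
    exact h.snoc_mem_curveTube hξ' hA hB hstr hs hs1 hxκ hyκ (hPξ p hp) hyx hd
  · rw [Finset.sum_image hinj.injOn]
    simp only [hinv]
    have h1 : ENNReal.ofReal (K ^ (d + 1) * R ^ d) * ENNReal.ofReal (s ^ e) ≤
        ENNReal.ofReal (K ^ (d + 1) * R ^ d) * ∑ p ∈ P, volume (Φ '' Y p) := by
      rw [← ENNReal.ofReal_mul (by positivity), Finset.mul_sum]
      exact hvol.trans (Finset.sum_le_sum fun p hp =>
        h.volume_le_image hξ' (g x' ξ') hR0 (hYs p hp))
    exact (ENNReal.mul_le_mul_iff_right (by rw [ne_eq, ENNReal.ofReal_eq_zero, not_le]; positivity)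
      ENNReal.ofReal_ne_top).1 h1

end Cluster

section Clusters

theorem exists_clusters (d N N' : ℕ) [NeZero N] [NeZero N'] :
    ∃ C : ℝ, 0 < C ∧ ∀ (P : Finset ((Fin d → ℝ) × (Fin d → ℝ)))
      (f : (Fin d → ℝ) × (Fin d → ℝ) → ℝ) (δ r : ℝ), 0 < δ → 0 < r →
      (∀ p ∈ P, ∀ q ∈ P, p ≠ q → δ ≤ dist p q) →
      ∃ P' ⊆ P, ∃ a : (Fin d → ℝ) × (Fin d → ℝ) → (Fin d → ℝ) × (Fin d → ℝ),
        (∀ p ∈ P', a p ∈ P') ∧ (∀ p ∈ P', dist p (a p) < r) ∧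
        (∀ p ∈ P', ∀ q ∈ P', a p ≠ a q → ((N' : ℝ) - 1) * r ≤ dist (a p) (a q)) ∧
        (∀ p ∈ P', ∀ q ∈ P', p ≠ q → ((N : ℝ) - 1) * δ ≤ dist p q) ∧
        (∑ p ∈ P, f p) / C ≤ ∑ p ∈ P', f p := by
  classical
  refine ⟨Fintype.card (Fin d ⊕ Fin d → ZMod N) * Fintype.card (Fin d ⊕ Fin d → ZMod N'), by
    have h1 : 0 < Fintype.card (Fin d ⊕ Fin d → ZMod N) := Fintype.card_pos
    have h2 : 0 < Fintype.card (Fin d ⊕ Fin d → ZMod N') := Fintype.card_pos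
    positivity, fun P f δ r hδ hr hsep => ?_⟩
  obtain ⟨b, hb⟩ := exists_le_sum_filter P
    (fun p i => (pairCell δ p i : ZMod N)) f
  set P₁ := P.filter fun p => (fun i => (pairCell δ p i : ZMod N)) = b with hP₁
  obtain ⟨a, ha1, ha2, ha3, ha4⟩ := exists_pairCell_dist_lt P₁ hr
  obtain ⟨b', hb'⟩ := exists_le_sum_filter P₁
    (fun p i => (pairCell r p i : ZMod N')) f
  set P₂ := P₁.filter fun p => (fun i => (pairCell r p i : ZMod N')) = b' with hP₂
  have h21 : ∀ p ∈ P₂, p ∈ P₁ := fun p hp => (Finset.mem_filter.1 hp).1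
  have h10 : ∀ p ∈ P₁, p ∈ P := fun p hp => (Finset.mem_filter.1 hp).1
  refine ⟨P₂, fun p hp => h10 p (h21 p hp), a, fun p hp => ?_, fun p hp => ha2 p (h21 p hp),
    fun p hp q hq hpq => ?_, fun p hp q hq hpq => ?_, ?_⟩
  · refine Finset.mem_filter.2 ⟨ha1 p (h21 p hp), ?_⟩
    rw [ha4 p (h21 p hp)]
    exact (Finset.mem_filter.1 hp).2
  · refine le_dist_of_pairCell_congr hr (ha3 p (h21 p hp) q (h21 q hq) hpq) fun i => ?_
    rw [ha4 p (h21 p hp), ha4 q (h21 q hq)]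
    exact congrFun ((Finset.mem_filter.1 hp).2.trans (Finset.mem_filter.1 hq).2.symm) i
  · refine le_dist_of_pairCell_congr hδ (fun h => ?_) fun i => ?_
    · exact (dist_lt_of_pairCell_eq hδ h).not_ge
        (hsep p (h10 p (h21 p hp)) q (h10 q (h21 q hq)) hpq)
    · exact congrFun ((Finset.mem_filter.1 (h21 p hp)).2.trans
        (Finset.mem_filter.1 (h21 q hq)).2.symm) i
  · rw [← div_div]
    refine le_trans ?_ hb'
    gcongr

/-- Points of large mass: if few points share a large total mass and no point is too heavy, then
many points are fairly heavy. -/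
theorem le_card_filter_mul {α : Type*} (R : Finset α) (m : α → ℝ) {A τ M : ℝ} (hτ : 0 ≤ τ)
    (hR : R.card * τ ≤ A / 2) (hA : A ≤ ∑ q ∈ R, m q) (hM : ∀ q ∈ R, m q ≤ M) :
    A / 2 ≤ (R.filter fun q => τ ≤ m q).card * M := by
  classical
  have h1 := Finset.sum_filter_add_sum_filter_not R (fun q => τ ≤ m q) m
  have h2 : ∑ q ∈ R with ¬ τ ≤ m q, m q ≤ R.card * τ := by
    calc ∑ q ∈ R with ¬ τ ≤ m q, m q ≤ ∑ q ∈ R with ¬ τ ≤ m q, τ :=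
          Finset.sum_le_sum fun q hq => (not_le.1 (Finset.mem_filter.1 hq).2).le
      _ = ((R.filter fun q => ¬ τ ≤ m q).card : ℝ) * τ := by simp
      _ ≤ R.card * τ := by gcongr; exact Finset.filter_subset _ _
  have h3 : ∑ q ∈ R with τ ≤ m q, m q ≤ (R.filter fun q => τ ≤ m q).card * M := by
    calc ∑ q ∈ R with τ ≤ m q, m q ≤ ∑ q ∈ R with τ ≤ m q, M :=
          Finset.sum_le_sum fun q hq => hM q (Finset.mem_filter.1 hq).1
      _ = _ := by simp
  linarith

variable {d : ℕ}

variable {g : (Fin (d + 1) → ℝ) → (Fin d → ℝ) → (Fin d → ℝ)} {x₀ xc : Fin (d + 1) → ℝ}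
  {r₀ κ K c lam₀ : ℝ} {ξc w : Fin d → ℝ} {T : (Fin (d + 1) → ℝ) → (Fin d → ℝ) → ℝ}

lemma IsChart.volume_le_of_dist_le (h : IsChart g x₀ r₀ xc ξc T w κ K c lam₀) {ξ : Fin d → ℝ}
    (hξ : ξ ∈ ball ξc κ) {v : Fin d → ℝ} {a : ℝ} (ha : 0 ≤ a) {S : Set (Fin (d + 1) → ℝ)}
    (hS : S ⊆ ball xc κ) (hSa : ∀ x ∈ S, dist (g x ξ) v ≤ a) :
    volume S ≤ ENNReal.ofReal (K ^ (d + 1) * (2 * a) ^ d) := by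
  have hK := h.one_le_K
  have h1 := h.volume_le_image hξ v one_pos hS
  rw [one_pow, mul_one] at h1
  rw [ENNReal.ofReal_mul (by positivity)]
  refine h1.trans ?_
  gcongr
  have h2 := volume_snoc_box (d := d) (b := 1 / 2) ha
  rw [show 2 * (1 / 2 : ℝ) = 1 by norm_num, mul_one] at h2
  rw [← h2]
  refine measure_mono ?_
  rintro _ ⟨x, hx, rfl⟩
  refine ⟨fun i => ?_, ?_⟩
  · have := (norm_le_pi_norm (g x ξ - v) i).trans ((dist_eq_norm _ _).symm.le.trans (hSa x hx))
    simpa using this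
  · simpa using h.abs_T_le x (hS hx) ξ hξ

end Clusters

section Fat

variable {d : ℕ}

variable {g : (Fin (d + 1) → ℝ) → (Fin d → ℝ) → (Fin d → ℝ)} {x₀ xc : Fin (d + 1) → ℝ}
  {r₀ κ c lam₀ : ℝ} {K : ℕ} {ξc w : Fin d → ℝ} {T : (Fin (d + 1) → ℝ) → (Fin d → ℝ) → ℝ}

theorem IsChart.le_volume_fat (h : IsChart g x₀ r₀ xc ξc T w κ K c lam₀) {s : ℝ}
    (hs : 0 < s) (hs2 : s ≤ 1 / 2) (hsκ : s ≤ κ) (hsl : s ≤ 4 * K * lam₀)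
    {S : Set (Fin d → ℝ)} {ε η N θ c₀ : ℝ} (hc₀ : c₀ ≤ 1) (hc₀c : 4 * K * c₀ ≤ c) (hθ : 0 < θ)
    (hSK : CurveSK g (closedBall x₀ r₀) S ε η s) {G : Finset ((Fin d → ℝ) × (Fin d → ℝ))}
    (hG : ∀ q ∈ G, ∃ x ∈ ball xc κ ∩ closedBall x₀ r₀, g x q.1 = q.2)
    (hGξ : ∀ q ∈ G, q.1 ∈ ball ξc κ) (hGS : ∀ q ∈ G, q.1 ∈ S)
    (hsep : ∀ p ∈ G, ∀ q ∈ G, p ≠ q → s ≤ dist p q)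
    (hQ : ∀ ρ ∈ Icc s 1, ∃ Q, (∀ p ∈ G, ∃ q ∈ Q, dist p q < ρ) ∧ FewParallel Q ρ N)
    (hN : (2 * ((4 : ℕ) : ℝ) + 3) ^ (3 * d) * N ≤ s ^ (-η))
    {Z : (Fin d → ℝ) × (Fin d → ℝ) → Set (Fin (d + 1) → ℝ)}
    (hZ : ∀ q ∈ G, ∀ y ∈ Z q, ∃ x ∈ ball xc κ ∩ closedBall x₀ r₀, ∃ ξ ∈ ball ξc κ,
      y ∈ ball xc (3 * κ / 4) ∧ dist y x ≤ s ^ 2 ∧ dist (ξ, g x ξ) q ≤ c₀ * s)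
    (hL : ∀ q ∈ G, ENNReal.ofReal (2 * (θ * (K ^ (d + 1) * (2 * (3 * K * s)) ^ d))) ≤
      volume (Z q))
    (hcard : s ^ η ≤ G.card * (θ * (K ^ (d + 1) * (2 * (3 * K * s)) ^ d))) :
    s ^ ε ≤ s ^ η ∧ ENNReal.ofReal (θ * s ^ ε) ≤ volume (⋃ q ∈ G, Z q) := by
  classical
  have hK := h.one_le_K
  have hκ := h.κ_pos
  set lam : ℝ := s / (4 * K) with hlam
  have hlam0 : 0 < lam := by positivity
  have hKlam : K * lam = s / 4 := by rw [hlam]; field_simp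
  have hclam : c₀ * s ≤ c * lam := by
    rw [hlam, mul_div_assoc', le_div_iff₀ (by positivity)]
    nlinarith
  have hlam1 : lam ≤ lam₀ := by
    rw [hlam, div_le_iff₀ (by positivity)]; linarith
  set u : (Fin d → ℝ) × (Fin d → ℝ) := (0, lam • w) with hu
  set L : ℝ := K ^ (d + 1) * (2 * (3 * K * s)) ^ d with hLdef
  have hL0 : 0 < L := by positivity
  set Y : (Fin d → ℝ) × (Fin d → ℝ) → Set (Fin (d + 1) → ℝ) := fun q =>
    denseCells volume (gridCell (s / 8)) (ENNReal.ofReal θ) (Z q) with hY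
  have hs8 : 0 < s / 8 := by positivity
  have hss : s ^ 2 ≤ s / 2 := by nlinarith
  have hnear : ∀ q ∈ G, ∀ x, ∀ y ∈ Z q, dist x y < s / 8 →
      x ∈ ball xc κ ∧ dist (g x q.1) q.2 ≤ 3 * K * s := by
    intro q hq x y hy hxy
    obtain ⟨z, hz, ξ, hξ, hyb, hyz, hzq⟩ := hZ q hq y hy
    have hxκ : x ∈ ball xc κ := by
      rw [mem_ball] at hyb ⊢
      linarith [dist_triangle x y xc]
    refine ⟨hxκ, ?_⟩
    have h1 := h.dist_le x hxκ z hz.1 q.1 (hGξ q hq)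
    have h2 := h.dist_right_le z hz.1 q.1 (hGξ q hq) ξ hξ
    have h3 : dist (g z ξ) q.2 ≤ c₀ * s := (le_max_right _ _).trans hzq
    have h4 : dist q.1 ξ ≤ c₀ * s := by rw [dist_comm]; exact (le_max_left _ _).trans hzq
    have h5 : c₀ * s ≤ s := mul_le_of_le_one_left hs.le hc₀
    have h6 : dist x z ≤ s := by linarith [dist_triangle x y z]
    have h7 : (K : ℝ) * dist x z ≤ K * s := by gcongr
    have h8 : (K : ℝ) * dist q.1 ξ ≤ K * s := by gcongr; linarith
    have h9 : s ≤ K * s := le_mul_of_one_le_left hs.le hK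
    linarith [dist_triangle4 (g x q.1) (g z q.1) (g z ξ) q.2]
  have hYdist : ∀ q ∈ G, ∀ x ∈ Y q, ∃ y ∈ Z q, dist x y < s / 8 := by
    intro q hq x hx
    obtain ⟨⟨y, hy, hyx⟩, -⟩ := hx
    exact ⟨y, hy, dist_lt_of_gridCell_eq hs8 hyx.symm⟩
  have hYm : ∀ q, MeasurableSet (Y q) := fun q => measurableSet_denseCells (measurable_gridCell _) _
  have hYball : ∀ q ∈ G, Y q ⊆ ball xc κ := fun q hq x hx => by
    obtain ⟨y, hy, hxy⟩ := hYdist q hq x hx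
    exact (hnear q hq x y hy hxy).1
  have hYfin : ∀ q ∈ G, volume (Y q) ≠ ⊤ := fun q hq =>
    ((measure_mono (hYball q hq)).trans_lt measure_ball_lt_top).ne
  have hYL : ∀ q ∈ G, θ * L ≤ volume.real (Y q) := by
    intro q hq
    have h1 := measure_le_measure_denseCells_add (μ := volume) (θ := ENNReal.ofReal θ)
      (measurable_gridCell (s / 8)) (Z q) {x | x ∈ ball xc κ ∧ dist (g x q.1) q.2 ≤ 3 * K * s}
      fun y hy x hxy => hnear q hq x y hy (dist_lt_of_gridCell_eq hs8 hxy)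
    have h2 := h.volume_le_of_dist_le (hGξ q hq) (v := q.2) (a := 3 * K * s) (by positivity)
      (S := {x | x ∈ ball xc κ ∧ dist (g x q.1) q.2 ≤ 3 * K * s}) (fun x hx => hx.1)
      fun x hx => hx.2
    have h3 : ENNReal.ofReal (2 * (θ * L)) ≤ volume (Y q) + ENNReal.ofReal (θ * L) := by
      refine (hL q hq).trans (h1.trans ?_)
      rw [ENNReal.ofReal_mul hθ.le]
      gcongr
    rw [← ENNReal.ofReal_toReal (hYfin q hq), ← ENNReal.ofReal_add (by simp) (by positivity),
      ENNReal.ofReal_le_ofReal_iff (by positivity)] at h3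
    rw [measureReal_def]
    linarith
  have hsum : s ^ η ≤ ∑ q ∈ G, volume.real (Y q) := by
    refine hcard.trans ?_
    rw [← nsmul_eq_mul]
    exact Finset.card_nsmul_le_sum _ _ _ hYL
  obtain ⟨a, ha⟩ := exists_sum_volume_inter_closedBall_eq (Nat.succ_ne_zero d) G Y (‖xc‖ + κ)
    (fun q hq x hx => by
      have := hYball q hq hx
      rw [mem_ball] at this
      rw [mem_closedBall]
      have h2 := dist_triangle x xc 0
      rw [dist_zero_right] at h2 ⊢
      rw [dist_zero_right] at h2
      linarith) (by positivity) hsum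
  have hfin : ∀ q ∈ G, volume (Y q ∩ closedBall 0 a) ≠ ⊤ := fun q hq =>
    measure_ne_top_of_subset inter_subset_left (hYfin q hq)
  have hsumE : ∑ q ∈ G, volume (Y q ∩ closedBall 0 a) = ENNReal.ofReal (s ^ η) := by
    rw [← ha, ENNReal.ofReal_sum_of_nonneg fun _ _ => measureReal_nonneg]
    exact Finset.sum_congr rfl fun q hq => (ofReal_measureReal (hfin q hq)).symm
  have hinj : Function.Injective fun q : (Fin d → ℝ) × (Fin d → ℝ) => q + u :=
    add_left_injective u
  have hshift : ∀ q ∈ G, ∀ x ∈ ball xc κ ∩ closedBall x₀ r₀, ∀ ξ ∈ ball ξc κ,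
      dist (ξ, g x ξ) q ≤ c₀ * s →
      ∃ x' ∈ closedBall x₀ r₀, g x' (q + u).1 = (q + u).2 ∧ dist x x' ≤ s / 4 := by
    intro q hq x hx ξ hξ hd
    obtain ⟨x', hx', h1, h2⟩ := h.shift x hx ξ hξ q.1 (hGξ q hq) q.2 lam hlam0 hlam1
      (((le_max_left _ _).trans hd).trans hclam) (((le_max_right _ _).trans hd).trans hclam)
    refine ⟨x', hx', by simpa [hu] using h1, ?_⟩
    rw [dist_comm, ← hKlam]; exact h2
  have hmem : ∀ q ∈ G, q + u ∈ S ×ˢ ((fun q : (Fin (d + 1) → ℝ) × (Fin d → ℝ) => g q.1 q.2) ''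
      (closedBall x₀ r₀ ×ˢ S)) := by
    intro q hq
    obtain ⟨x, hx, hxq⟩ := hG q hq
    have hc0 : 0 ≤ c * lam := by have := h.c_pos; positivity
    obtain ⟨x', hx', h1, -⟩ := h.shift x hx q.1 (hGξ q hq) q.1 (hGξ q hq) q.2 lam hlam0 hlam1
      (by rwa [dist_self]) (by rwa [hxq, dist_self])
    have e1 : (q + u).1 = q.1 := by simp [hu]
    refine ⟨by rw [e1]; exact hGS q hq, (x', q.1), ⟨hx', hGS q hq⟩, ?_⟩
    simpa [hu] using h1
  have key := hSK (G.image fun q => q + u) (Finset.forall_mem_image.2 hmem) ?_ ?_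
    (fun p => Y (p - u) ∩ closedBall 0 a) ?_ ?_
  · rw [Finset.set_biUnion_finset_image] at key
    simp only [add_sub_cancel_right] at key
    have hle : ENNReal.ofReal (s ^ ε) ≤ ENNReal.ofReal (s ^ η) := by
      rw [← hsumE]
      exact key.trans (measure_biUnion_finset_le _ _)
    refine ⟨(ENNReal.ofReal_le_ofReal_iff (by positivity)).1 hle, ?_⟩
    rw [ENNReal.ofReal_mul hθ.le]
    refine le_trans ?_ (mul_measure_biUnion_denseCells_le (μ := volume)
      (θ := ENNReal.ofReal θ) (measurable_gridCell (s / 8)) G Z)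
    gcongr
    refine key.trans (measure_mono ?_)
    exact iUnion₂_mono fun q hq => inter_subset_left
  · refine Finset.forall_mem_image.2 fun p hp => Finset.forall_mem_image.2 fun q hq hpq => ?_
    rw [dist_add_right]
    exact hsep p hp q hq fun h => hpq (by rw [h])
  · intro ρ hρ
    obtain ⟨Q, hQ1, hQ2⟩ := hQ ρ hρ
    have hρ0 : 0 < ρ := hs.trans_le hρ.1
    choose! f hf hfd using hQ1
    have hcover := exists_cover_fewParallel (P := G.image fun q => q + u) hQ2 hρ0 hs hρ.1 4 ?_
      (fun p => f (p - u)) ?_ ?_ ?_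
    · obtain ⟨R', hR', hcov, hfew⟩ := hcover
      refine ⟨R', fun q hq => ?_, hcov, fun S hS hS' => (hfew S hS hS').trans hN⟩
      obtain ⟨p, hp, rfl⟩ := Finset.mem_image.1 (hR' hq)
      exact hmem p hp
    · refine Finset.forall_mem_image.2 fun p hp => Finset.forall_mem_image.2 fun q hq hpq => ?_
      rw [dist_add_right]
      exact hsep p hp q hq fun h => hpq (by rw [h])
    · refine Finset.forall_mem_image.2 fun p hp => ?_
      rw [add_sub_cancel_right]; exact hf p hp
    · refine Finset.forall_mem_image.2 fun p hp => Finset.forall_mem_image.2 fun q hq hpq => ?_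
      simp only [add_sub_cancel_right, Prod.fst_add, dist_add_right] at hpq ⊢
      have h4 : dist (f p).1 p.1 ≤ ρ := by
        rw [dist_comm]; exact (le_max_left _ _).trans (hfd p hp).le
      have h5 : dist q.1 (f q).1 ≤ ρ := (le_max_left _ _).trans (hfd q hq).le
      push_cast
      linarith [dist_triangle4 (f p).1 p.1 q.1 (f q).1]
    · refine Finset.forall_mem_image.2 fun p hp => Finset.forall_mem_image.2 fun q hq hpq => ?_
      simp only [add_sub_cancel_right, dist_add_right] at hpq ⊢
      have h4 := hfd p hp
      have h5 := hfd q hq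
      rw [← hpq, dist_comm] at h5
      push_cast
      linarith [dist_triangle p (f p) q]
  · refine Finset.forall_mem_image.2 fun q hq => ?_
    simp only [add_sub_cancel_right]
    refine ⟨(hYm q).inter measurableSet_closedBall, ?_⟩
    rintro x ⟨hx, -⟩
    obtain ⟨y, hy, hxy⟩ := hYdist q hq x hx
    obtain ⟨z, hz, ξ, hξ, hyb, hyz, hzq⟩ := hZ q hq y hy
    obtain ⟨x', hx', h1, h2⟩ := hshift q hq z hz ξ hξ hzq
    refine ⟨x', hx', h1, ?_⟩
    linarith [dist_triangle4 x y z x']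
  · rw [Finset.sum_image hinj.injOn]
    simp only [add_sub_cancel_right]
    exact hsumE.ge

end Fat

section Heavy

/-- A separated family covered by few balls in each direction is not too large. -/
theorem FewParallel.card_le_of_cover {d : ℕ} {P Q : Finset ((Fin d → ℝ) × (Fin d → ℝ))} {ρ N : ℝ}
    (h : FewParallel Q ρ N) (hρ : 0 < ρ) (hcov : ∀ p ∈ P, ∃ q ∈ Q, dist p q < ρ)
    (hsep : ∀ p ∈ P, ∀ q ∈ P, p ≠ q → ρ ≤ dist p q) {R : ℝ} (hR : ρ ≤ R)
    (hP : ∀ p ∈ P, ∀ q ∈ P, dist p.1 q.1 ≤ R) :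
    (P.card : ℝ) ≤ (7 * R / ρ) ^ d * (9 ^ (3 * d) * N) := by
  choose! f hf hfd using hcov
  have h1 : ∀ p ∈ P, ∀ q ∈ P, dist p.1 q.1 ≤ ρ → dist (f p).1 (f q).1 ≤ (3 : ℕ) * ρ := by
    intro p hp q hq hpq
    have h4 : dist (f p).1 p.1 ≤ ρ := by
      rw [dist_comm]; exact (le_max_left _ _).trans (hfd p hp).le
    have h5 : dist q.1 (f q).1 ≤ ρ := (le_max_left _ _).trans (hfd q hq).le
    push_cast
    linarith [dist_triangle4 (f p).1 p.1 q.1 (f q).1]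
  have h2 : ∀ p ∈ P, ∀ q ∈ P, f p = f q → dist p q ≤ (3 : ℕ) * ρ := by
    intro p hp q hq hpq
    have h4 := hfd p hp
    have h5 := hfd q hq
    rw [← hpq, dist_comm] at h5
    push_cast
    linarith [dist_triangle p (f p) q]
  have key := (h.transfer hρ hρ ρ 3 hsep f hf h1 h2).card_le hρ hR hP
  norm_num at key ⊢
  exact key

variable {d : ℕ}

variable {g : (Fin (d + 1) → ℝ) → (Fin d → ℝ) → (Fin d → ℝ)} {x₀ xc : Fin (d + 1) → ℝ}
  {r₀ κ c lam₀ : ℝ} {K : ℕ} {ξc w : Fin d → ℝ} {T : (Fin (d + 1) → ℝ) → (Fin d → ℝ) → ℝ}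

lemma IsChart.volume_shading_le (h : IsChart g x₀ r₀ xc ξc T w κ K c lam₀) {δ : ℝ} (hδ : 0 ≤ δ)
    (hδκ : δ ≤ κ / 4) {U : Set (Fin (d + 1) → ℝ)} {p : (Fin d → ℝ) × (Fin d → ℝ)}
    (hp : p.1 ∈ ball ξc κ) {Y : Set (Fin (d + 1) → ℝ)}
    (hY : Y ⊆ ball xc (3 * κ / 4) ∩ curveTube g U δ p) :
    volume Y ≤ ENNReal.ofReal (K ^ (d + 1) * (2 * (K * δ)) ^ d) := by
  have hκ := h.κ_pos
  have hK := h.one_le_K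
  have hb : ball xc (3 * κ / 4) ⊆ ball xc κ := ball_subset_ball (by linarith)
  refine h.volume_le_of_dist_le hp (v := p.2) (by positivity) (fun y hy => hb (hY hy).1)
    fun y hy => ?_
  obtain ⟨hyb, x, -, hxp, hyx⟩ := hY hy
  have hx : x ∈ ball xc κ := by
    rw [mem_ball] at hyb ⊢
    have := dist_triangle x y xc
    rw [dist_comm x y] at this
    linarith
  rw [← hxp]
  exact (h.dist_le y (hb hyb) x hx p.1 hp).trans (by gcongr)

theorem IsChart.exists_heavy (h : IsChart g x₀ r₀ xc ξc T w κ K c lam₀) {s : ℝ}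
    (hs : 0 < s) (hs1 : s ≤ 1) (hsκ : s ^ 2 ≤ κ / 4) {U : Set (Fin (d + 1) → ℝ)}
    {P : Finset ((Fin d → ℝ) × (Fin d → ℝ))} (hPξ : ∀ p ∈ P, p.1 ∈ ball ξc κ)
    (hsep : ∀ p ∈ P, ∀ q ∈ P, p ≠ q → s ^ 2 ≤ dist p q) {N : ℝ}
    (hQ : ∀ ρ ∈ Icc (s ^ 2) 1, ∃ Q, (∀ p ∈ P, ∃ q ∈ Q, dist p q < ρ) ∧ FewParallel Q ρ N)
    {a : (Fin d → ℝ) × (Fin d → ℝ) → (Fin d → ℝ) × (Fin d → ℝ)} (ha : ∀ p ∈ P, a p ∈ P)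
    (had : ∀ p ∈ P, dist p (a p) < s) (hasep : ∀ p ∈ P, ∀ q ∈ P, a p ≠ a q → s ≤ dist (a p) (a q))
    {Y : (Fin d → ℝ) × (Fin d → ℝ) → Set (Fin (d + 1) → ℝ)}
    (hY : ∀ p ∈ P, Y p ⊆ ball xc (3 * κ / 4) ∩ curveTube g U (s ^ 2) p) {A τ : ℝ} (hτ : 0 ≤ τ)
    (hA : A ≤ ∑ p ∈ P, volume.real (Y p))
    (hτA : (7 * (2 * κ + 1) / s) ^ d * (9 ^ (3 * d) * N) * τ ≤ A / 2) :
    A / 2 ≤ (((P.image a).filter fun q => τ ≤ ∑ p ∈ P with a p = q, volume.real (Y p)).card : ℝ) *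
      ((7 * (2 * s) / s ^ 2) ^ d * (9 ^ (3 * d) * N) * (K ^ (d + 1) * (2 * (K * s ^ 2)) ^ d)) := by
  classical
  have hκ := h.κ_pos
  have hs2 : s ^ 2 ≤ s := by nlinarith
  have hs20 : 0 < s ^ 2 := by positivity
  have hdist : ∀ p ∈ P, ∀ q ∈ P, dist p.1 q.1 ≤ 2 * κ + 1 := fun p hp q hq => by
    have h1 := hPξ p hp
    have h2 := hPξ q hq
    rw [mem_ball] at h1 h2
    linarith [dist_triangle_right p.1 q.1 ξc]
  refine le_card_filter_mul (P.image a) _ hτ ?_ ?_ ?_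
  · refine le_trans ?_ hτA
    gcongr
    obtain ⟨Q, hQ1, hQ2⟩ := hQ s ⟨hs2, hs1⟩
    refine hQ2.card_le_of_cover hs ?_ ?_ (by linarith) ?_
    · exact Finset.forall_mem_image.2 fun p hp => hQ1 _ (ha p hp)
    · exact Finset.forall_mem_image.2 fun p hp => Finset.forall_mem_image.2 fun q hq hpq =>
        hasep p hp q hq hpq
    · exact Finset.forall_mem_image.2 fun p hp => Finset.forall_mem_image.2 fun q hq =>
        hdist _ (ha p hp) _ (ha q hq)
  · refine hA.trans (Finset.sum_fiberwise_of_maps_to (g := a) ?_ _).ge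
    exact fun p hp => Finset.mem_image_of_mem a hp
  · intro q hq
    obtain ⟨Q, hQ1, hQ2⟩ := hQ (s ^ 2) ⟨le_rfl, by nlinarith⟩
    have hcard : ((P.filter fun p => a p = q).card : ℝ) ≤
        (7 * (2 * s) / s ^ 2) ^ d * (9 ^ (3 * d) * N) := by
      refine hQ2.card_le_of_cover hs20 (fun p hp => hQ1 p (Finset.mem_filter.1 hp).1)
        (fun p hp p' hp' => hsep p (Finset.mem_filter.1 hp).1 p' (Finset.mem_filter.1 hp').1)
        (by linarith) fun p hp p' hp' => ?_
      obtain ⟨hp, hpq⟩ := Finset.mem_filter.1 hp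
      obtain ⟨hp', hpq'⟩ := Finset.mem_filter.1 hp'
      have h1 := had p hp
      have h2 := had p' hp'
      rw [hpq] at h1
      rw [hpq'] at h2
      refine (le_max_left _ _).trans (?_ : dist p p' ≤ 2 * s)
      linarith [dist_triangle_right p p' q]
    have hvr : ∀ p ∈ P.filter fun p => a p = q, volume.real (Y p) ≤
        K ^ (d + 1) * (2 * (K * s ^ 2)) ^ d := fun p hp => by
      have hp := (Finset.mem_filter.1 hp).1
      refine ENNReal.toReal_le_of_le_ofReal (by positivity) ?_
      exact h.volume_shading_le hs20.le hsκ (hPξ p hp) (hY p hp)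
    calc ∑ p ∈ P with a p = q, volume.real (Y p) ≤
        ((P.filter fun p => a p = q).card : ℝ) * (K ^ (d + 1) * (2 * (K * s ^ 2)) ^ d) := by
          rw [← nsmul_eq_mul]; exact Finset.sum_le_card_nsmul _ _ _ hvr
      _ ≤ _ := by gcongr

end Heavy

section Local

variable {d : ℕ}

variable {g : (Fin (d + 1) → ℝ) → (Fin d → ℝ) → (Fin d → ℝ)} {x₀ xc : Fin (d + 1) → ℝ}
  {r₀ κ c lam₀ : ℝ} {K : ℕ} {ξc w : Fin d → ℝ} {T : (Fin (d + 1) → ℝ) → (Fin d → ℝ) → ℝ}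

set_option maxHeartbeats 2000000 in
theorem IsChart.exists_le_volume (h : IsChart g x₀ r₀ xc ξc T w κ K c lam₀) {C₁ : ℝ}
    (hC₁ : 0 < C₁) :
    ∃ θ₀ : ℝ, 0 < θ₀ ∧ ∀ s σ β : ℝ, 0 < s → s ≤ θ₀ → 0 < β → β ≤ σ → σ ≤ θ₀ →
      ∀ ε η ηt : ℝ, s ^ ηt = σ ^ 5 → s ^ η = β ^ 10 → s ^ (η / 10) = β →
      ∀ S : Set (Fin d → ℝ), CurveSK g (closedBall x₀ r₀) S ε η s →
      CurveSK (restGrad (d := d)) (closedBall 0 1) (closedBall 0 1) (η / 10) ηt s →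
      ∀ P : Finset ((Fin d → ℝ) × (Fin d → ℝ)), (∀ p ∈ P, p.1 ∈ ball ξc κ ∩ S) →
      (∀ p ∈ P, ∀ q ∈ P, p ≠ q → s ^ 2 ≤ dist p q) →
      (∀ ρ ∈ Icc (s ^ 2) 1, ∃ Q, (∀ p ∈ P, ∃ q ∈ Q, dist p q < ρ) ∧ FewParallel Q ρ σ⁻¹) →
      ∀ Y : (Fin d → ℝ) × (Fin d → ℝ) → Set (Fin (d + 1) → ℝ),
      (∀ p ∈ P, MeasurableSet (Y p) ∧ (Y p).Nonempty ∧
        Y p ⊆ ball xc (3 * κ / 4) ∩ curveTube g (closedBall x₀ r₀) (s ^ 2) p) →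
      σ / C₁ ≤ ∑ p ∈ P, volume.real (Y p) →
      ENNReal.ofReal (s ^ (2 * ε)) ≤ volume (⋃ p ∈ P, Y p) := by
  classical
  have hK := h.one_le_K
  have hκ := h.κ_pos
  have hc := h.c_pos
  have hlam₀ := h.lam₀_pos
  have hK0 : (0 : ℝ) < K := zero_lt_one.trans_le hK
  obtain ⟨c₀, hc₀, hc₀1, hc₀c⟩ : ∃ c₀ : ℝ, 0 < c₀ ∧ c₀ ≤ 1 ∧ 4 * K * c₀ ≤ c := by
    refine ⟨min 1 (c / (4 * K)), by positivity, min_le_left _ _, ?_⟩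
    calc 4 * K * min 1 (c / (4 * K)) ≤ 4 * K * (c / (4 * K)) := by
          gcongr; exact min_le_right _ _
      _ = c := by field_simp
  obtain ⟨C, hC, hcl⟩ := exists_clusters d (8 * K ^ 4 + 1) (⌈1 / c₀⌉₊ + 1)
  set C₈ : ℝ := K ^ (d + 1) * (2 * K) ^ d with hC₈
  set A₃ : ℝ := (7 * (2 * κ + 1)) ^ d * 9 ^ (3 * d) with hA₃
  set C₂ : ℝ := 14 ^ d * 9 ^ (3 * d) * C₈ with hC₂
  set C₄ : ℝ := K ^ (d + 1) * (4 * K ^ 2) ^ d with hC₄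
  set C₅ : ℝ := (4 * (K : ℝ) ^ 2) ^ d / K ^ (d + 1) with hC₅
  set C₇ : ℝ := K ^ (d + 1) * (6 * K) ^ d with hC₇
  set C₉ : ℝ := C₁ * C with hC₉
  set B₁ : ℝ := (2 * ((4 * K ^ 3 + 2 : ℕ) : ℝ) + 3) ^ (3 * d) with hB₁
  set B₂ : ℝ := (2 * ((4 : ℕ) : ℝ) + 3) ^ (3 * d) with hB₂
  have h8 : 0 < C₈ := by positivity
  have h3 : 0 < A₃ := by positivity
  have h2 : 0 < C₂ := by positivity
  have h4 : 0 < C₄ := by positivity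
  have h5 : 0 < C₅ := by positivity
  have h7 : 0 < C₇ := by positivity
  have h9 : 0 < C₉ := by positivity
  have hB1 : 0 < B₁ := by positivity
  have hB2 : 0 < B₂ := by positivity
  set L : List ℝ := [1 / 2, κ / 4, 4 * K * lam₀, 1 / (2 * C₉ * A₃ * C₄), 1 / B₁, 1 / B₂,
    C₅ / (4 * C₉ * C₂), C₅ / (2 * C₇)] with hL
  obtain ⟨θ₀, hθ₀, hθL⟩ : ∃ θ₀ : ℝ, 0 < θ₀ ∧ ∀ x ∈ L, θ₀ ≤ x := by
    have : ∀ L : List ℝ, (∀ x ∈ L, 0 < x) → ∃ θ₀ : ℝ, 0 < θ₀ ∧ ∀ x ∈ L, θ₀ ≤ x := by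
      intro L
      induction L with
      | nil => exact fun _ => ⟨1, one_pos, by simp⟩
      | cons a L ih =>
        intro hL
        obtain ⟨t, ht, htL⟩ := ih fun x hx => hL x (List.mem_cons_of_mem a hx)
        refine ⟨min a t, lt_min (hL a List.mem_cons_self) ht, fun x hx => ?_⟩
        rcases List.mem_cons.1 hx with rfl | hx
        · exact min_le_left _ _
        · exact (min_le_right _ _).trans (htL x hx)
    refine this L ?_
    simp only [hL, List.mem_cons, List.not_mem_nil, or_false, forall_eq_or_imp, forall_eq]
    refine ⟨?_, ?_, ?_, ?_, ?_, ?_, ?_, ?_⟩ <;> positivity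
  simp only [hL, List.mem_cons, List.not_mem_nil, or_false, forall_eq_or_imp, forall_eq] at hθL
  obtain ⟨t1, t2, t3, t4, t5, t6, t7, t8⟩ := hθL
  refine ⟨θ₀, hθ₀, fun s σ β hs hsθ hβ hβσ hσθ ε η ηt e1 e2 e3 S hSK hSR P hPξ hsep hQ Y hY
    hvol => ?_⟩
  have hσ : 0 < σ := hβ.trans_le hβσ
  have hσ1 : σ ≤ 1 := by linarith
  have hβ1 : β ≤ 1 := by linarith
  have hs2 : s ≤ 1 / 2 := by linarith
  have hs1 : s ≤ 1 := by linarith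
  have hsκ : s ≤ κ / 4 := by linarith
  have hss : s ^ 2 ≤ s := by nlinarith
  have hs20 : 0 < s ^ 2 := by positivity
  have hsκ2 : s ^ 2 ≤ κ / 4 := hss.trans hsκ
  have m1 : 2 * C₉ * A₃ * C₄ * σ ≤ 1 := by
    have := hσθ.trans t4
    rw [le_div_iff₀ (by positivity)] at this; linarith
  have m2 : B₁ * σ ≤ 1 := by
    have := hσθ.trans t5
    rw [le_div_iff₀ (by positivity)] at this; linarith
  have m3 : B₂ * β ≤ 1 := by
    have := (hβσ.trans hσθ).trans t6
    rw [le_div_iff₀ (by positivity)] at this; linarith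
  have m4 : β ≤ C₅ / (4 * C₉ * C₂) := (hβσ.trans hσθ).trans t7
  have m5 : β ≤ C₅ / (2 * C₇) := (hβσ.trans hσθ).trans t8
  obtain ⟨P', hP'P, a, ha, had, hasep, hsep', hsum⟩ := hcl P (fun p => volume.real (Y p)) (s ^ 2)
    (c₀ * s) hs20 (by positivity) hsep
  have hN' : ((⌈1 / c₀⌉₊ + 1 : ℕ) : ℝ) - 1 = ⌈1 / c₀⌉₊ := by push_cast; ring
  have hcs : c₀ * s ≤ s := mul_le_of_le_one_left hs.le hc₀1
  have had' : ∀ p ∈ P', dist p (a p) < s := fun p hp => (had p hp).trans_le hcs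
  have hasep' : ∀ p ∈ P', ∀ q ∈ P', a p ≠ a q → s ≤ dist (a p) (a q) := by
    intro p hp q hq hpq
    refine le_trans ?_ (hasep p hp q hq hpq)
    rw [hN', ← mul_assoc]
    have : 1 ≤ (⌈1 / c₀⌉₊ : ℝ) * c₀ := by
      rw [← div_le_iff₀ hc₀]; exact Nat.le_ceil _
    nlinarith
  have hsep'' : ∀ p ∈ P', ∀ q ∈ P', p ≠ q → 8 * (K : ℝ) ^ 4 * s ^ 2 ≤ dist p q := by
    intro p hp q hq hpq
    have := hsep' p hp q hq hpq
    push_cast at this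
    linarith
  have hP'ξ : ∀ p ∈ P', p.1 ∈ ball ξc κ := fun p hp => (hPξ p (hP'P hp)).1
  have hQ' : ∀ ρ ∈ Icc (s ^ 2) 1, ∃ Q, (∀ p ∈ P', ∃ q ∈ Q, dist p q < ρ) ∧
      FewParallel Q ρ σ⁻¹ := fun ρ hρ => by
    obtain ⟨Q, hQ1, hQ2⟩ := hQ ρ hρ
    exact ⟨Q, fun p hp => hQ1 p (hP'P hp), hQ2⟩
  set τ : ℝ := K ^ (d + 1) * (4 * K ^ 2 * s) ^ d * s ^ ηt with hτ
  have hτ0 : 0 ≤ τ := by positivity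
  have hτe : τ = C₄ * s ^ d * σ ^ 5 := by
    rw [hτ, hC₄, e1, mul_pow _ s]; ring
  have hsd : 0 < s ^ d := by positivity
  have hA : σ / C₉ ≤ ∑ p ∈ P', volume.real (Y p) := by
    refine le_trans ?_ hsum
    rw [hC₉, ← div_div]
    gcongr
  have hheavy := h.exists_heavy hs hs1 hsκ2 hP'ξ
    (fun p hp q hq hpq => hsep p (hP'P hp) q (hP'P hq) hpq) hQ' ha had' hasep'
    (fun p hp => (hY p (hP'P hp)).2.2) hτ0 hA (by
      have : (7 * (2 * κ + 1) / s) ^ d * (9 ^ (3 * d) * σ⁻¹) * τ =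
          (2 * C₉ * A₃ * C₄ * σ) * σ ^ 3 / (2 * C₉) := by
        rw [hτe, hA₃, div_pow]; field_simp
      rw [this, div_div, mul_comm C₉ 2]
      gcongr
      calc 2 * C₉ * A₃ * C₄ * σ * σ ^ 3 ≤ 1 * σ ^ 1 := by
            gcongr ?_ * ?_
            exact pow_le_pow_of_le_one hσ.le hσ1 (by norm_num)
        _ = σ := by ring)
  set G := (P'.image a).filter fun q => τ ≤ ∑ p ∈ P' with a p = q, volume.real (Y p) with hG
  have hGP : ∀ q ∈ G, q ∈ P' ∧ ∃ p ∈ P', a p = q := by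
    intro q hq
    obtain ⟨p, hp, rfl⟩ := Finset.mem_image.1 (Finset.mem_filter.1 hq).1
    exact ⟨ha p hp, p, hp, rfl⟩
  have hcard : σ ^ 2 / (2 * C₉ * C₂) ≤ G.card * s ^ d := by
    have : (7 * (2 * s) / s ^ 2) ^ d * (9 ^ (3 * d) * σ⁻¹) *
        ((K : ℝ) ^ (d + 1) * (2 * (K * s ^ 2)) ^ d) = C₂ * s ^ d / σ := by
      have e : (7 * (2 * s) / s ^ 2) ^ d = 14 ^ d / s ^ d := by
        rw [← div_pow]; congr 1; field_simp; norm_num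
      have e' : (2 * ((K : ℝ) * s ^ 2)) ^ d = (2 * K) ^ d * (s ^ d * s ^ d) := by
        rw [← mul_pow, ← mul_pow]; congr 1; ring
      rw [e, e', hC₂, hC₈]; field_simp
    rw [this, div_div, div_le_iff₀ (by positivity)] at hheavy
    rw [div_le_iff₀ (by positivity)]
    have h' : (G.card : ℝ) * (C₂ * s ^ d / σ) * (C₉ * 2) * σ =
      G.card * s ^ d * (2 * C₉ * C₂) := by field_simp
    rw [← h', sq]
    gcongr
  set Z : (Fin d → ℝ) × (Fin d → ℝ) → Set (Fin (d + 1) → ℝ) :=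
    fun q => ⋃ p ∈ P'.filter fun p => a p = q, Y p with hZ
  have hpt : ∀ p ∈ P', ∀ y ∈ Y p, ∃ x ∈ ball xc κ ∩ closedBall x₀ r₀, g x p.1 = p.2 ∧
      y ∈ ball xc (3 * κ / 4) ∧ dist y x ≤ s ^ 2 := by
    intro p hp y hy
    obtain ⟨hyb, x, hx, hxp, hyx⟩ := (hY p (hP'P hp)).2.2 hy
    refine ⟨x, ⟨?_, hx⟩, hxp, hyb, hyx⟩
    rw [mem_ball] at hyb ⊢
    have := dist_triangle x y xc
    rw [dist_comm x y] at this
    linarith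
  have hZvol : ∀ q ∈ G, ENNReal.ofReal (C₅ * s ^ d * β) ≤ volume (Z q) := by
    intro q hq
    obtain ⟨hqP, -⟩ := hGP q hq
    obtain ⟨y, hy⟩ := (hY q (hP'P hqP)).2.1
    obtain ⟨x', hx', hxq, -⟩ := hpt q hqP y hy
    have hq' : (q.1, g x' q.1) = q := by rw [hxq]
    have key := h.le_volume_cluster (P := P'.filter fun p => a p = q) (Y := Y) (N := σ⁻¹) hs hs1
      hsκ2 hx'.1 (hP'ξ q hqP) hSR
      (fun p hp => by
        obtain ⟨hp, hpq⟩ := Finset.mem_filter.1 hp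
        rw [hq', ← hpq]; exact (had' p hp).le)
      (fun p hp => hP'ξ p (Finset.mem_filter.1 hp).1)
      (fun p hp p' hp' => hsep'' p (Finset.mem_filter.1 hp).1 p' (Finset.mem_filter.1 hp').1)
      (fun ρ hρ => by
        obtain ⟨Q, hQ1, hQ2⟩ := hQ' ρ ⟨hρ.1, hρ.2.trans hs1⟩
        exact ⟨Q, fun p hp => hQ1 p (Finset.mem_filter.1 hp).1, hQ2⟩)
      (by
        rw [Real.rpow_neg hs.le, e1, ← hB₁, ← div_eq_mul_inv, div_le_iff₀ hσ]
        have : (σ ^ 5)⁻¹ * σ = 1 / σ ^ 4 := by field_simp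
        rw [this, le_div_iff₀ (by positivity)]
        calc B₁ * σ ^ 4 = B₁ * σ * σ ^ 3 := by ring
          _ ≤ 1 * 1 := by gcongr; exact pow_le_one₀ hσ.le hσ1
          _ = 1 := one_mul 1)
      (fun p hp => ⟨(hY p (hP'P (Finset.mem_filter.1 hp).1)).1,
        (hY p (hP'P (Finset.mem_filter.1 hp).1)).2.2⟩)
      (by
        have hτq := (Finset.mem_filter.1 hq).2
        refine (ENNReal.ofReal_le_ofReal hτq).trans ?_
        rw [ENNReal.ofReal_sum_of_nonneg fun _ _ => measureReal_nonneg]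
        exact Finset.sum_le_sum fun p _ => ENNReal.ofReal_toReal_le)
    rw [e3] at key
    have : C₅ * s ^ d * β = (4 * (K : ℝ) ^ 2 * s) ^ d / K ^ (d + 1) * β := by
      rw [hC₅, mul_pow _ s]; ring
    rwa [this]
  set θ : ℝ := C₅ * β / (2 * C₇) with hθ
  have hθ0 : 0 < θ := by positivity
  have hL7 : (K : ℝ) ^ (d + 1) * (2 * (3 * K * s)) ^ d = C₇ * s ^ d := by
    rw [hC₇, show 2 * (3 * K * s) = 6 * K * s by ring, mul_pow _ s, mul_assoc]
  have hfat := h.le_volume_fat (Z := Z) (G := G) (N := σ⁻¹) (θ := θ) hs hs2 (by linarith)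
    (hsθ.trans t3) hc₀1 hc₀c hθ0 hSK
    (fun q hq => by
      obtain ⟨hqP, -⟩ := hGP q hq
      obtain ⟨y, hy⟩ := (hY q (hP'P hqP)).2.1
      obtain ⟨x', hx', hxq, -⟩ := hpt q hqP y hy
      exact ⟨x', hx', hxq⟩)
    (fun q hq => hP'ξ q (hGP q hq).1) (fun q hq => (hPξ q (hP'P (hGP q hq).1)).2)
    (fun p hp q hq hpq => by
      obtain ⟨-, p', hp', rfl⟩ := hGP p hp
      obtain ⟨-, q', hq', rfl⟩ := hGP q hq
      exact hasep' p' hp' q' hq' hpq)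
    (fun ρ hρ => by
      obtain ⟨Q, hQ1, hQ2⟩ := hQ' ρ ⟨hss.trans hρ.1, hρ.2⟩
      exact ⟨Q, fun p hp => hQ1 p (hGP p hp).1, hQ2⟩)
    (by
      rw [Real.rpow_neg hs.le, e2, ← hB₂, ← div_eq_mul_inv, div_le_iff₀ hσ]
      have : (β ^ 10)⁻¹ * β ≤ (β ^ 10)⁻¹ * σ := by gcongr
      refine le_trans ?_ this
      have : (β ^ 10)⁻¹ * β = 1 / β ^ 9 := by field_simp
      rw [this, le_div_iff₀ (by positivity)]
      calc B₂ * β ^ 9 = B₂ * β * β ^ 8 := by ring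
        _ ≤ 1 * 1 := by gcongr; exact pow_le_one₀ hβ.le hβ1
        _ = 1 := one_mul 1)
    (fun q hq y hy => by
      simp only [hZ, mem_iUnion] at hy
      obtain ⟨p, hp, hy⟩ := hy
      obtain ⟨hp, hpq⟩ := Finset.mem_filter.1 hp
      obtain ⟨x, hx, hxp, hyb, hyx⟩ := hpt p hp y hy
      refine ⟨x, hx, p.1, hP'ξ p hp, hyb, hyx, ?_⟩
      rw [hxp, ← hpq]
      exact (had p hp).le)
    (fun q hq => by
      have : 2 * (θ * ((K : ℝ) ^ (d + 1) * (2 * (3 * K * s)) ^ d)) = C₅ * s ^ d * β := by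
        rw [hL7, hθ]; field_simp
      rw [this]
      exact hZvol q hq)
    (by
      have e : (G.card : ℝ) * (θ * ((K : ℝ) ^ (d + 1) * (2 * (3 * K * s)) ^ d)) =
          G.card * s ^ d * (C₅ * β / 2) := by
        rw [hL7, hθ]; field_simp
      rw [e, e2]
      calc β ^ 10 = β * β ^ 3 * β ^ 6 := by ring
        _ ≤ C₅ / (4 * C₉ * C₂) * β ^ 3 * 1 := by gcongr; exact pow_le_one₀ hβ.le hβ1
        _ = β ^ 2 / (2 * C₉ * C₂) * (C₅ * β / 2) := by field_simp; ring
        _ ≤ σ ^ 2 / (2 * C₉ * C₂) * (C₅ * β / 2) := by gcongr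
        _ ≤ _ := by gcongr)
  obtain ⟨f1, f2⟩ := hfat
  refine le_trans ?_ (f2.trans (measure_mono ?_))
  · apply ENNReal.ofReal_le_ofReal
    have e : s ^ (2 * ε) = s ^ ε * s ^ ε := by rw [← Real.rpow_add hs]; congr 1; ring
    rw [e]
    gcongr
    rw [e2] at f1
    refine f1.trans ?_
    calc β ^ 10 = β * β * β ^ 8 := by ring
      _ ≤ C₅ / (2 * C₇) * β * 1 := by gcongr; exact pow_le_one₀ hβ.le hβ1
      _ = θ := by rw [hθ]; ring
  · refine iUnion₂_subset fun q hq => iUnion₂_subset fun p hp => ?_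
    exact subset_biUnion_of_mem (u := Y) (hP'P (Finset.mem_filter.1 hp).1)

end Local

section Assembly

lemma eventually_rpow_le {a c : ℝ} (ha : 0 < a) (hc : 0 < c) :
    ∀ᶠ t : ℝ in 𝓝[>] 0, t ^ a ≤ c := by
  have h := (Real.continuousAt_rpow_const 0 a (Or.inr ha.le)).tendsto
  rw [Real.zero_rpow ha.ne'] at h
  exact (h.mono_left nhdsWithin_le_nhds).eventually (ge_mem_nhds hc)

variable {d : ℕ} {g : (Fin (d + 1) → ℝ) → (Fin d → ℝ) → (Fin d → ℝ)} {x₀ : Fin (d + 1) → ℝ}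
  {r₀ : ℝ} {S : Set (Fin d → ℝ)}

theorem exists_curveSK_of_charts (hS : IsCompact S)
    (hchart : ∀ z ∈ closedBall x₀ r₀ ×ˢ S,
      ∃ (T : (Fin (d + 1) → ℝ) → (Fin d → ℝ) → ℝ) (w : Fin d → ℝ) (κ c lam₀ : ℝ) (K : ℕ),
        IsChart g x₀ r₀ z.1 z.2 T w κ K c lam₀)
    (ε : ℝ) {η ηt : ℝ} (hηt : 0 < ηt) (hle : ηt ≤ η / 10) :
    ∃ δ₀ : ℝ, 0 < δ₀ ∧ ∀ δ : ℝ, 0 < δ → δ < δ₀ →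
      CurveSK g (closedBall x₀ r₀) S ε η (δ ^ ((1:ℝ)/2)) →
      CurveSK (restGrad (d := d)) (closedBall 0 1) (closedBall 0 1) (η / 10) ηt
        (δ ^ ((1:ℝ)/2)) →
      CurveSK g (closedBall x₀ r₀) S ε (ηt / 10) δ := by
  classical
  choose! T w κ c lam₀ K hch using hchart
  obtain ⟨t, htK, ht⟩ := ((isCompact_closedBall x₀ r₀).prod hS).elim_nhds_subcover
    (fun z => ball z.1 (κ z / 2) ×ˢ ball z.2 (κ z / 2)) fun z hz =>
      prod_mem_nhds (ball_mem_nhds _ (half_pos (hch z hz).κ_pos))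
        (ball_mem_nhds _ (half_pos (hch z hz).κ_pos))
  have hC₁ : (0 : ℝ) < t.card + 1 := by positivity
  choose! θ₀ hθ₀ hmain using fun z hz => (hch z hz).exists_le_volume hC₁
  have hev : ∀ᶠ δ : ℝ in 𝓝[>] 0, δ ^ ((1 : ℝ) / 2) ≤ 1 ∧ ∀ z ∈ t, δ ^ ((1 : ℝ) / 2) ≤ θ₀ z ∧
      δ ^ (ηt / 10) ≤ θ₀ z ∧ δ ^ (1 : ℝ) ≤ κ z / 4 := by
    refine (eventually_rpow_le (by norm_num) one_pos).and
      ((Filter.eventually_all_finset t).2 fun z hz => ?_)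
    have hκ := (hch z (htK z hz)).κ_pos
    exact (eventually_rpow_le (by norm_num) (hθ₀ z (htK z hz))).and
      ((eventually_rpow_le (by positivity) (hθ₀ z (htK z hz))).and
        (eventually_rpow_le one_pos (by positivity)))
  obtain ⟨δ₀, hδ₀, hsub⟩ := mem_nhdsGT_iff_exists_Ioo_subset.1 hev
  refine ⟨δ₀, hδ₀, fun δ hδ hδδ hSK hSR P hP hsep hQ Y hY hvol => ?_⟩
  obtain ⟨hs1, hsm⟩ := hsub ⟨hδ, hδδ⟩
  set s : ℝ := δ ^ ((1 : ℝ) / 2) with hsdef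
  have hs : 0 < s := by positivity
  have hs2 : s ^ 2 = δ := by
    rw [hsdef, ← Real.rpow_natCast, ← Real.rpow_mul hδ.le]; norm_num
  have hpow : ∀ a : ℝ, s ^ a = δ ^ (a / 2) := fun a => by
    rw [hsdef, ← Real.rpow_mul hδ.le]; congr 1; ring
  set σ : ℝ := s ^ (ηt / 5) with hσdef
  have hσδ : δ ^ (ηt / 10) = σ := by rw [hσdef, hpow]; congr 1; ring
  have hσ : 0 < σ := by positivity
  set β : ℝ := s ^ (η / 10) with hβdef
  have hβ : 0 < β := by positivity
  have hβσ : β ≤ σ := Real.rpow_le_rpow_of_exponent_ge hs hs1 (by linarith)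
  have e1 : s ^ ηt = σ ^ 5 := by
    rw [hσdef, ← Real.rpow_natCast, ← Real.rpow_mul hs.le]; congr 1; push_cast; ring
  have e2 : s ^ η = β ^ 10 := by
    rw [hβdef, ← Real.rpow_natCast, ← Real.rpow_mul hs.le]; congr 1; push_cast; ring
  set Y' : (Fin (d + 1) → ℝ) × (Fin d → ℝ) → (Fin d → ℝ) × (Fin d → ℝ) →
      Set (Fin (d + 1) → ℝ) := fun z p =>
    if p.1 ∈ ball z.2 (κ z / 2) then Y p ∩ ball z.1 (3 * κ z / 4) else ∅ with hY'
  have hY'Y : ∀ z p, Y' z p ⊆ Y p := fun z p => by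
    simp only [hY']; split_ifs
    · exact inter_subset_left
    · exact empty_subset _
  have hY'b : ∀ z p, Y' z p ⊆ ball z.1 (3 * κ z / 4) := fun z p => by
    simp only [hY']; split_ifs
    · exact inter_subset_right
    · exact empty_subset _
  have hcov : ∀ p ∈ P, Y p ⊆ ⋃ z ∈ t, Y' z p := by
    intro p hp y hy
    obtain ⟨x, hx, hxp, hyx⟩ := (hY p hp).2 hy
    obtain ⟨z, hz, hxz⟩ := mem_iUnion₂.1 (ht (⟨hx, (hP p hp).1⟩ : (x, p.1) ∈ closedBall x₀ r₀ ×ˢ S))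
    refine mem_iUnion₂.2 ⟨z, hz, ?_⟩
    simp only [hY', if_pos hxz.2]
    refine ⟨hy, ?_⟩
    have h1 := (hsm z hz).2.2
    rw [Real.rpow_one] at h1
    have h2 : dist x z.1 < κ z / 2 := hxz.1
    rw [mem_ball]
    linarith [dist_triangle y x z.1]
  have hfin : ∀ z p, volume (Y' z p) ≠ ⊤ := fun z p =>
    measure_ne_top_of_subset (hY'b z p) measure_ball_lt_top.ne
  have htot : σ ≤ ∑ z ∈ t, ∑ p ∈ P, volume.real (Y' z p) := by
    rw [hσδ] at hvol
    rw [← ENNReal.ofReal_le_ofReal_iff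
      (Finset.sum_nonneg fun _ _ => Finset.sum_nonneg fun _ _ => measureReal_nonneg),
      Finset.sum_comm, ENNReal.ofReal_sum_of_nonneg
        fun _ _ => Finset.sum_nonneg fun _ _ => measureReal_nonneg]
    refine hvol.trans (Finset.sum_le_sum fun p hp => ?_)
    rw [ENNReal.ofReal_sum_of_nonneg fun _ _ => measureReal_nonneg]
    refine (measure_mono (hcov p hp)).trans ((measure_biUnion_finset_le _ _).trans ?_)
    exact Finset.sum_le_sum fun z _ => (ofReal_measureReal (hfin z p)).ge
  obtain ⟨z, hz, hzs⟩ : ∃ z ∈ t, σ / (t.card + 1) ≤ ∑ p ∈ P, volume.real (Y' z p) := by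
    by_contra! hcon
    have h1 := Finset.sum_le_card_nsmul t _ _ fun z hz => (hcon z hz).le
    rw [nsmul_eq_mul, mul_div_assoc'] at h1
    have h2 : (t.card : ℝ) * σ / (t.card + 1) < σ := by
      rw [div_lt_iff₀ hC₁]; linarith
    linarith
  have hκ := (hch z (htK z hz)).κ_pos
  set P' := P.filter fun p => (Y' z p).Nonempty with hP'
  have hP'P : ∀ p ∈ P', p ∈ P := fun p hp => (Finset.mem_filter.1 hp).1
  have hP'z : ∀ p ∈ P', p.1 ∈ ball z.2 (κ z / 2) := fun p hp => by
    obtain ⟨y, hy⟩ := (Finset.mem_filter.1 hp).2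
    by_contra hcon
    simp only [hY', if_neg hcon, mem_empty_iff_false] at hy
  have hsum : ∑ p ∈ P', volume.real (Y' z p) = ∑ p ∈ P, volume.real (Y' z p) := by
    refine Finset.sum_filter_of_ne fun p _ hne => ?_
    rw [nonempty_iff_ne_empty]
    intro h0
    rw [h0] at hne
    simp at hne
  have key := hmain z (htK z hz) s σ β hs (hsm z hz).1 hβ hβσ (hσδ ▸ (hsm z hz).2.1) ε η ηt
    e1 e2 rfl S hSK hSR P'
    (fun p hp => ⟨ball_subset_ball (by linarith) (hP'z p hp), (hP p (hP'P p hp)).1⟩)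
    (fun p hp q hq hpq => by rw [hs2]; exact hsep p (hP'P p hp) q (hP'P q hq) hpq)
    (fun ρ hρ => by
      rw [hs2] at hρ
      obtain ⟨Q, -, hQ1, hQ2⟩ := hQ ρ hρ
      refine ⟨Q, fun p hp => ?_, ?_⟩
      · obtain ⟨q, hq, hpq⟩ := mem_iUnion₂.1 (hQ1 p (hP'P p hp) (mem_ball_self hδ))
        exact ⟨q, hq, hpq⟩
      · rwa [Real.rpow_neg hδ.le, hσδ] at hQ2)
    (Y' z)
    (fun p hp => by
      refine ⟨?_, (Finset.mem_filter.1 hp).2, fun y hy => ⟨hY'b z p hy, ?_⟩⟩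
      · simp only [hY', if_pos (hP'z p hp)]
        exact (hY p (hP'P p hp)).1.inter measurableSet_ball
      · rw [hs2]; exact (hY p (hP'P p hp)).2 (hY'Y z p hy))
    (by rwa [hsum])
  rw [hpow, mul_div_cancel_left₀ _ two_ne_zero] at key
  refine key.trans (measure_mono (iUnion₂_subset fun p hp => ?_))
  exact (hY'Y z p).trans (subset_biUnion_of_mem (u := Y) (hP'P p hp))

end Assembly

section Phase

lemma tube_eq_curveTube {d : ℕ} (φ : (Fin (d + 1) → ℝ) → (Fin d → ℝ) → ℝ)
    {M M₀ : Set (Fin (d + 1) → ℝ)} (hM₀ : M₀ ⊆ M) (δ : ℝ) (p : (Fin d → ℝ) × (Fin d → ℝ)) :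
    tube (d + 1) φ M M₀ δ p = curveTube (phaseGrad φ) M₀ δ p := by
  ext y
  constructor
  · rintro ⟨x, ⟨⟨-, hx⟩, hx₀⟩, hyx⟩
    exact ⟨x, hx₀, hx, hyx⟩
  · rintro ⟨x, hx₀, hx, hyx⟩
    exact ⟨x, ⟨⟨hM₀ hx₀, hx⟩, hx₀⟩, hyx⟩

lemma SKp_iff_curveSK {d : ℕ} (φ : (Fin (d + 1) → ℝ) → (Fin d → ℝ) → ℝ)
    {M M₀ : Set (Fin (d + 1) → ℝ)} (hM₀ : M₀ ⊆ M) (S : Set (Fin d → ℝ)) (ε η δ : ℝ) :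
    SKp (d + 1) φ M M₀ S ε η δ ↔ CurveSK (phaseGrad φ) M₀ S ε η δ := by
  simp only [SKp, CurveSK, FewParallel, phaseGrad]
  refine forall₄_congr fun P _ _ _ => forall_congr' fun Y => ?_
  have : ∀ p, tube (d + 1) φ M M₀ δ p = curveTube (gradXi (d + 1) φ) M₀ δ p :=
    tube_eq_curveTube φ hM₀ δ
  simp only [this]
  rfl

lemma phaseGrad_φrest (d : ℕ) : phaseGrad (φrest d) = restGrad := by
  funext x ξ j
  have h : HasFDerivAt (φrest d x)
      (∑ j, x j.castSucc • (ContinuousLinearMap.proj j : (Fin d → ℝ) →L[ℝ] ℝ) +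
        ((1 / 2) * x (Fin.last d)) • ∑ j, (2 * ξ j) •
          (ContinuousLinearMap.proj j : (Fin d → ℝ) →L[ℝ] ℝ)) ξ := by
    have hp : ∀ j : Fin d, HasFDerivAt (fun ξ : Fin d → ℝ => ξ j)
      (ContinuousLinearMap.proj j : (Fin d → ℝ) →L[ℝ] ℝ) ξ := fun j => hasFDerivAt_apply j ξ
    refine (HasFDerivAt.fun_sum fun j _ => (hp j).const_mul _).add
      ((HasFDerivAt.fun_sum fun j _ => ?_).const_mul _)
    simpa using (hp j).pow 2
  change fderiv ℝ (φrest d x) ξ (Pi.single j 1) = _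
  rw [h.fderiv]
  simp [restGrad, Pi.single_apply]
  ring

end Phase

theorem stmt17 (m : ℕ)
    (M : Set (Fin (m+3) → ℝ)) (Ω : Set (Fin (m+2) → ℝ))
    (hMo : IsOpen M) (hMc : IsConnected M) (hΩo : IsOpen Ω) (hΩc : IsConnected Ω)
    (φ : (Fin (m+3) → ℝ) → (Fin (m+2) → ℝ) → ℝ)
    (hφ : IsHormander (m+3) φ M Ω)
    (hB : BourgainCond (m+3) φ M Ω)
    (x₀ : Fin (m+3) → ℝ) (r₀ : ℝ) (hr₀ : 0 < r₀) (hM₀ : closedBall x₀ r₀ ⊆ M)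
    (ξc : Fin (m+2) → ℝ) (r₁ : ℝ) (hr₁ : 0 < r₁) (hS₀ : closedBall ξc r₁ ⊆ Ω)
    (ε η ηt : ℝ) (hε : 0 < ε) (hη : 0 < η) (hηt : 0 < ηt) (hle : ηt ≤ η / 10) :
    ∃ δ₀ : ℝ, 0 < δ₀ ∧ ∀ δ : ℝ, 0 < δ → δ < δ₀ →
      SKp (m+3) φ M (closedBall x₀ r₀) (closedBall ξc r₁) ε η (δ ^ ((1:ℝ)/2)) →
      SKp (m+3) (φrest (m+2)) univ (closedBall 0 1) (closedBall 0 1)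
        (η / 10) ηt (δ ^ ((1:ℝ)/2)) →
      SKp (m+3) φ M (closedBall x₀ r₀) (closedBall ξc r₁) ε (ηt / 10) δ := by
  obtain ⟨δ₀, hδ₀, h⟩ := exists_curveSK_of_charts (g := phaseGrad φ) (x₀ := x₀) (r₀ := r₀)
    (isCompact_closedBall ξc r₁)
    (fun z hz => exists_isChart_phaseGrad hMo hΩo (Nat.succ_pos _) hφ hB hr₀ hM₀ hz.1 (hS₀ hz.2))
    ε hηt hle
  refine ⟨δ₀, hδ₀, fun δ hδ hδδ h1 h2 => ?_⟩
  have h1' := (SKp_iff_curveSK φ hM₀ _ _ _ _).1 h1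
  have h2' := (SKp_iff_curveSK (φrest (m + 2)) (subset_univ _) _ _ _ _).1 h2
  rw [phaseGrad_φrest] at h2'
  exact (SKp_iff_curveSK φ hM₀ _ _ _ _).2 (h δ hδ hδδ h1' h2')
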